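/- Let p ≥ q > 0 and let 𝒮_p, 𝒮_q ⊆ ℝ³ be the corresponding polynomial spiral shells. If 1 ≤ K < p/q, then there is no K-quasiconformal homeomorphism F: ℝ³ → ℝ³ with F(𝒮_p) = 𝒮_q. -/

import Mathlib

open Metric Set Filter MeasureTheory Topology
open scoped RealInnerProductSpace

noncomputable section

/-- `d`-dimensional Euclidean space. -/
abbrev Euc (d : ℕ) : Type := EuclideanSpace ℝ (Fin d)

/-- The number of cubes in the axes-oriented `r`-mesh of `ℝ^d` that intersect `E`;
for nonempty bounded `E` this is the box-counting number `N_r(E)`. -/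
def meshCubeCount (d : ℕ) (r : ℝ) (E : Set (Euc d)) : ℕ :=
  Set.ncard {k : Fin d → ℤ | ∃ x ∈ E, ∀ i, (k i : ℝ) * r ≤ x i ∧ x i < ((k i : ℝ) + 1) * r}

/-- The lower box dimension `liminf_{r → 0⁺} log N_r(E) / (- log r)`. -/
def lowerBoxDim (d : ℕ) (E : Set (Euc d)) : ℝ :=
  liminf (fun r : ℝ => Real.log (meshCubeCount d r E : ℝ) / -Real.log r) (𝓝[>] (0 : ℝ))

/-- The upper box dimension `limsup_{r → 0⁺} log N_r(E) / (- log r)`. -/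
def upperBoxDim (d : ℕ) (E : Set (Euc d)) : ℝ :=
  limsup (fun r : ℝ => Real.log (meshCubeCount d r E : ℝ) / -Real.log r) (𝓝[>] (0 : ℝ))

/-- The box dimension of `E` exists and equals `v`. -/
def HasBoxDim (d : ℕ) (E : Set (Euc d)) (v : ℝ) : Prop :=
  lowerBoxDim d E = v ∧ upperBoxDim d E = v

/-- The `θ`-Assouad spectrum of `E ⊆ ℝ^d`. -/
def assouadSpec (d : ℕ) (θ : ℝ) (E : Set (Euc d)) : ℝ :=
  sInf {α : ℝ | 0 < α ∧ ∃ C : ℝ, 0 < C ∧ ∀ r : ℝ, 0 < r → r < 1 → ∀ x ∈ E,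
    (meshCubeCount d r (ball x (r ^ θ) ∩ E) : ℝ) ≤ C * (r ^ (θ - 1)) ^ α}

/-- The regularized (upper) `θ`-Assouad spectrum of `E ⊆ ℝ^d`. -/
def regAssouadSpec (d : ℕ) (θ : ℝ) (E : Set (Euc d)) : ℝ :=
  sInf {α : ℝ | 0 < α ∧ ∃ C : ℝ, 0 < C ∧ ∀ r R : ℝ, 0 < r → 0 < R → r ≤ R ^ (1 / θ) → R < 1 →
    ∀ x ∈ E, (meshCubeCount d r (ball x R ∩ E) : ℝ) ≤ C * (R / r) ^ α}

/-- The Assouad dimension of `E ⊆ ℝ^d`. -/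
def assouadDim (d : ℕ) (E : Set (Euc d)) : ℝ :=
  sInf {α : ℝ | 0 < α ∧ ∃ C : ℝ, 0 < C ∧ ∀ r R : ℝ, 0 < r → r ≤ R → ∀ x ∈ E,
    (meshCubeCount d r (ball x R ∩ E) : ℝ) ≤ C * (R / r) ^ α}

/-- The (Euclidean) distance between two sets. -/
def setDistance {d : ℕ} (A B : Set (Euc d)) : ℝ :=
  sInf (Set.image2 dist A B)

/-- `S ⊆ ℝ^d` is a topological sphere: the image of the unit sphere under a
self-homeomorphism of `ℝ^d`. -/
def IsTopologicalSphere (d : ℕ) (S : Set (Euc d)) : Prop :=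
  ∃ f : Euc d ≃ₜ Euc d, S = f '' sphere (0 : Euc d) 1

/-- `g` is a similarity of `ℝ^d` with similarity ratio `c`, i.e. `g x = c • A x + t`
with `c > 0`, `A` orthogonal and `t ∈ ℝ^d`. -/
def IsSimilarityRatio {d : ℕ} (g : Euc d → Euc d) (c : ℝ) : Prop :=
  0 < c ∧ ∃ A : Euc d ≃ₗᵢ[ℝ] Euc d, ∃ t : Euc d, ∀ x, g x = c • A x + t

/-- `g` is a similarity map of `ℝ^d`. -/
def IsSimilarity {d : ℕ} (g : Euc d → Euc d) : Prop :=
  ∃ c : ℝ, IsSimilarityRatio g c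

/-- `S` is a concentric sphere collection centered at `x₀` and generated by the
topological sphere `S₀`. -/
def IsConcentricSphereColl (d : ℕ) (x₀ : Euc d) (S₀ S : Set (Euc d)) : Prop :=
  ∃ f : Euc d ≃ₜ Euc d, S₀ = f '' sphere (0 : Euc d) 1 ∧ x₀ ∈ f '' ball (0 : Euc d) 1 ∧
    ∃ g : ℕ → Euc d → Euc d, g 0 = id ∧ (∀ n, IsSimilarity (g n)) ∧
      S = (⋃ n : ℕ, g n '' S₀) ∧
      ∃ c₁ c₂ : ℝ, ∃ n₀ : ℕ, ∃ a : ℕ → ℝ,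
        c₁ ∈ Ioc (0 : ℝ) 1 ∧ c₂ ∈ Ioc (0 : ℝ) 1 ∧ 1 ≤ n₀ ∧
        StrictAnti a ∧ Tendsto a atTop (𝓝 (0 : ℝ)) ∧
        ∀ n : ℕ, n₀ ≤ n →
          hausdorffDist (g n '' S₀) {x₀} = c₁ * a n ∧
          setDistance (g n '' S₀) (g (n + 1) '' S₀) = c₂ * (a n - a (n + 1))

/-- `S` is a `p`-polynomially concentric sphere collection centered at `x₀` and generated
by the topological sphere `S₀` (the defining sequence is `a n = n ^ (-p)`). -/
def IsPConcentricSphereColl (d : ℕ) (p : ℝ) (x₀ : Euc d) (S₀ S : Set (Euc d)) : Prop :=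
  ∃ f : Euc d ≃ₜ Euc d, S₀ = f '' sphere (0 : Euc d) 1 ∧ x₀ ∈ f '' ball (0 : Euc d) 1 ∧
    ∃ g : ℕ → Euc d → Euc d, g 0 = id ∧ (∀ n, IsSimilarity (g n)) ∧
      S = (⋃ n : ℕ, g n '' S₀) ∧
      ∃ c₁ c₂ : ℝ, ∃ n₀ : ℕ, ∃ a : ℕ → ℝ,
        c₁ ∈ Ioc (0 : ℝ) 1 ∧ c₂ ∈ Ioc (0 : ℝ) 1 ∧ 1 ≤ n₀ ∧
        StrictAnti a ∧ Tendsto a atTop (𝓝 (0 : ℝ)) ∧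
        (∀ n : ℕ, n₀ ≤ n → a n = (n : ℝ) ^ (-p)) ∧
        ∀ n : ℕ, n₀ ≤ n →
          hausdorffDist (g n '' S₀) {x₀} = c₁ * a n ∧
          setDistance (g n '' S₀) (g (n + 1) '' S₀) = c₂ * (a n - a (n + 1))

/-- The polynomial spiral shell `𝒮_p ⊆ ℝ³`. -/
def spiralShell (p : ℝ) : Set (Euc 3) :=
  {x : Euc 3 | ∃ u v : ℝ, 1 ≤ u ∧ 1 ≤ v ∧
    x = (WithLp.equiv 2 (Fin 3 → ℝ)).symm
      ![u ^ (-p) * Real.cos u * Real.sin v,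
        u ^ (-p) * Real.sin u * Real.sin v,
        u ^ (-p) * Real.cos v]}

/-- The union `⋃_{j ≥ 1} S(0, j^{-p})` of concentric round spheres in `ℝ³`. -/
def sphereUnion (p : ℝ) : Set (Euc 3) :=
  ⋃ j : ℕ, sphere (0 : Euc 3) (((j : ℝ) + 1) ^ (-p))

/-- `F : ℝ³ → ℝ³` is `K`-quasiconformal: `F` lies in the local Sobolev space
`W^{1,3}_loc(ℝ³; ℝ³)`, witnessed by a weak differential `DF` which is locally `L³`
(integrable on every ball) and satisfies the integration-by-parts identity against every
smooth compactly supported test function, and `|DF|³ ≤ K · det DF` almost everywhere. -/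
def IsQuasiconformal (K : ℝ) (F : Euc 3 → Euc 3) : Prop :=
  ∃ DF : Euc 3 → Euc 3 →L[ℝ] Euc 3,
    (∀ R : ℝ, 0 < R → IntegrableOn (fun x => ‖DF x‖ ^ (3 : ℕ)) (ball (0 : Euc 3) R) volume) ∧
    (∀ φ : Euc 3 → ℝ, ContDiff ℝ (⊤ : ℕ∞) φ → HasCompactSupport φ → ∀ v w : Euc 3,
      ∫ x, fderiv ℝ φ x v * ⟪F x, w⟫ = - ∫ x, φ x * ⟪DF x v, w⟫) ∧
    ∀ᵐ x ∂(volume : Measure (Euc 3)), ‖DF x‖ ^ (3 : ℕ) ≤ K * (DF x).det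

open scoped ENNReal

/-- The `j`-th standard basis vector of `ℝ³`. -/
abbrev stdVec (j : Fin 3) : Euc 3 := EuclideanSpace.single j (1 : ℝ)

/-- The matrix entries of a linear endomorphism of `ℝ³`. -/
def entry (A : Euc 3 →L[ℝ] Euc 3) (i j : Fin 3) : ℝ := A (stdVec j) i

/-- The `(i, j)` cofactor of a linear endomorphism of `ℝ³`. -/
def cofactor (A : Euc 3 →L[ℝ] Euc 3) (i j : Fin 3) : ℝ :=
  entry A (i + 1) (j + 1) * entry A (i + 2) (j + 2) -
    entry A (i + 1) (j + 2) * entry A (i + 2) (j + 1)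

/-- The pairing `ξ (adj(A) v)`. -/
def adjPair (A : Euc 3 →L[ℝ] Euc 3) (ξ : Euc 3 →L[ℝ] ℝ) (v : Euc 3) : ℝ :=
  ∑ i, ∑ j, ξ (stdVec j) * v i * cofactor A i j

lemma sum_smul_stdVec (x : Euc 3) : x = ∑ j, x j • stdVec j := by
  ext i
  fin_cases i <;> simp [Fin.sum_univ_three]

lemma apply_eq_entry (A : Euc 3 →L[ℝ] Euc 3) (x : Euc 3) (i : Fin 3) :
    A x i = ∑ j, x j * entry A i j := by
  conv_lhs => rw [sum_smul_stdVec x]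
  simp [entry, Fin.sum_univ_three]

lemma covector_apply (ξ : Euc 3 →L[ℝ] ℝ) (x : Euc 3) : ξ x = ∑ j, x j * ξ (stdVec j) := by
  conv_lhs => rw [sum_smul_stdVec x]
  simp [Fin.sum_univ_three]

lemma norm_sq_euc (x : Euc 3) : ‖x‖ ^ 2 = x 0 ^ 2 + x 1 ^ 2 + x 2 ^ 2 := by
  simp [EuclideanSpace.norm_sq_eq, Fin.sum_univ_three]

lemma inner_euc (x y : Euc 3) : ⟪x, y⟫ = x 0 * y 0 + x 1 * y 1 + x 2 * y 2 := by
  simp [PiLp.inner_apply, Fin.sum_univ_three]; ring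

lemma det_eq_entry (A : Euc 3 →L[ℝ] Euc 3) : A.det =
    entry A 0 0 * (entry A 1 1 * entry A 2 2 - entry A 1 2 * entry A 2 1)
    - entry A 0 1 * (entry A 1 0 * entry A 2 2 - entry A 1 2 * entry A 2 0)
    + entry A 0 2 * (entry A 1 0 * entry A 2 1 - entry A 1 1 * entry A 2 0) := by
  rw [ContinuousLinearMap.det,
    ← LinearMap.det_toMatrix (EuclideanSpace.basisFun (Fin 3) ℝ).toBasis, Matrix.det_fin_three]
  simp only [LinearMap.toMatrix_apply, OrthonormalBasis.coe_toBasis,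
    OrthonormalBasis.coe_toBasis_repr_apply, EuclideanSpace.basisFun_repr,
    EuclideanSpace.basisFun_apply, entry, stdVec]
  simp only [ContinuousLinearMap.coe_coe]
  ring

lemma adjPair_eq (A : Euc 3 →L[ℝ] Euc 3) (ξ : Euc 3 →L[ℝ] ℝ) (v : Euc 3) :
    adjPair A ξ v =
    v 0 * (ξ (stdVec 0) * (entry A 1 1 * entry A 2 2 - entry A 1 2 * entry A 2 1)
      - ξ (stdVec 1) * (entry A 1 0 * entry A 2 2 - entry A 1 2 * entry A 2 0)
      + ξ (stdVec 2) * (entry A 1 0 * entry A 2 1 - entry A 1 1 * entry A 2 0))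
    - v 1 * (ξ (stdVec 0) * (entry A 0 1 * entry A 2 2 - entry A 0 2 * entry A 2 1)
      - ξ (stdVec 1) * (entry A 0 0 * entry A 2 2 - entry A 0 2 * entry A 2 0)
      + ξ (stdVec 2) * (entry A 0 0 * entry A 2 1 - entry A 0 1 * entry A 2 0))
    + v 2 * (ξ (stdVec 0) * (entry A 0 1 * entry A 1 2 - entry A 0 2 * entry A 1 1)
      - ξ (stdVec 1) * (entry A 0 0 * entry A 1 2 - entry A 0 2 * entry A 1 0)
      + ξ (stdVec 2) * (entry A 0 0 * entry A 1 1 - entry A 0 1 * entry A 1 0)) := by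
  simp only [adjPair, cofactor, Fin.sum_univ_three]
  simp only [show (0 : Fin 3) + 1 = 1 from rfl, show (0 : Fin 3) + 2 = 2 from rfl,
    show (1 : Fin 3) + 1 = 2 from rfl, show (1 : Fin 3) + 2 = 0 from rfl,
    show (2 : Fin 3) + 1 = 0 from rfl, show (2 : Fin 3) + 2 = 1 from rfl]
  ring

lemma exists_perp (x y z : ℝ) : ∃ a b c : ℝ, a * x + b * y + c * z = 0 ∧
    0 < a ^ 2 + b ^ 2 + c ^ 2 := by
  by_cases h : x = 0 ∧ y = 0
  · exact ⟨1, 0, 0, by simp [h.1], by norm_num⟩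
  · refine ⟨-y, x, 0, by ring, ?_⟩
    rcases not_and_or.1 h with h | h
    · have := sq_pos_of_ne_zero h; nlinarith [sq_nonneg y]
    · have := sq_pos_of_ne_zero h; nlinarith [sq_nonneg x]

lemma triple_sq_le (a0 a1 a2 b0 b1 b2 v0 v1 v2 : ℝ) :
    ((a1 * b2 - a2 * b1) * v0 + (a2 * b0 - a0 * b2) * v1 + (a0 * b1 - a1 * b0) * v2) ^ 2 ≤
    (a0 ^ 2 + a1 ^ 2 + a2 ^ 2) * (b0 ^ 2 + b1 ^ 2 + b2 ^ 2) * (v0 ^ 2 + v1 ^ 2 + v2 ^ 2) := by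
  have h1 : ∀ c0 c1 c2 : ℝ, (c0 * v0 + c1 * v1 + c2 * v2) ^ 2 ≤
      (c0 ^ 2 + c1 ^ 2 + c2 ^ 2) * (v0 ^ 2 + v1 ^ 2 + v2 ^ 2) := fun c0 c1 c2 => by
    nlinarith [sq_nonneg (c0 * v1 - c1 * v0), sq_nonneg (c0 * v2 - c2 * v0),
      sq_nonneg (c1 * v2 - c2 * v1)]
  refine (h1 _ _ _).trans (mul_le_mul_of_nonneg_right ?_ (by positivity))
  nlinarith [sq_nonneg (a0 * b0 + a1 * b1 + a2 * b2)]

/-- The sharp bound for the adjugate. -/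
lemma abs_adjPair_le (A : Euc 3 →L[ℝ] Euc 3) (ξ : Euc 3 →L[ℝ] ℝ) (v : Euc 3) :
    |adjPair A ξ v| ≤ ‖ξ‖ * ‖A‖ ^ 2 * ‖v‖ := by
  set x : Euc 3 := !₂[ξ (stdVec 0), ξ (stdVec 1), ξ (stdVec 2)] with hx
  have hx0 : x 0 = ξ (stdVec 0) := by simp [hx]
  have hx1 : x 1 = ξ (stdVec 1) := by simp [hx]
  have hx2 : x 2 = ξ (stdVec 2) := by simp [hx]
  have hxξ : ‖x‖ ≤ ‖ξ‖ := by
    have h1 : ξ x = ‖x‖ ^ 2 := by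
      rw [covector_apply, norm_sq_euc, Fin.sum_univ_three, ← hx0, ← hx1, ← hx2]; ring
    have h2 := ξ.le_opNorm x
    rw [h1, Real.norm_of_nonneg (by positivity)] at h2
    by_contra h
    push Not at h
    have : 0 < ‖x‖ := (norm_nonneg ξ).trans_lt h
    nlinarith
  obtain ⟨a0, a1, a2, hperp, hpos⟩ := exists_perp (x 0) (x 1) (x 2)
  set a : Euc 3 := !₂[a0, a1, a2] with ha
  set b : Euc 3 := !₂[x 1 * a2 - x 2 * a1, x 2 * a0 - x 0 * a2, x 0 * a1 - x 1 * a0] with hb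
  have hna : ‖a‖ ^ 2 = a0 ^ 2 + a1 ^ 2 + a2 ^ 2 := by rw [norm_sq_euc]; simp [ha]
  have hnb : ‖b‖ ^ 2 = ‖x‖ ^ 2 * ‖a‖ ^ 2 := by
    rw [hna, norm_sq_euc, norm_sq_euc]; simp [hb]
    linear_combination (-(a0 * x 0 + a1 * x 1 + a2 * x 2)) * hperp
  have key : adjPair A ξ v * ‖a‖ ^ 2 =
      (A a 1 * A b 2 - A a 2 * A b 1) * v 0 + (A a 2 * A b 0 - A a 0 * A b 2) * v 1
      + (A a 0 * A b 1 - A a 1 * A b 0) * v 2 := by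
    rw [adjPair_eq, hna]
    simp only [apply_eq_entry, Fin.sum_univ_three, ← hx0, ← hx1, ← hx2]
    simp [ha, hb]
    linear_combination (v 0 * (a0 * (entry A 1 1 * entry A 2 2 - entry A 1 2 * entry A 2 1)
      - a1 * (entry A 1 0 * entry A 2 2 - entry A 1 2 * entry A 2 0)
      + a2 * (entry A 1 0 * entry A 2 1 - entry A 1 1 * entry A 2 0))
    - v 1 * (a0 * (entry A 0 1 * entry A 2 2 - entry A 0 2 * entry A 2 1)
      - a1 * (entry A 0 0 * entry A 2 2 - entry A 0 2 * entry A 2 0)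
      + a2 * (entry A 0 0 * entry A 2 1 - entry A 0 1 * entry A 2 0))
    + v 2 * (a0 * (entry A 0 1 * entry A 1 2 - entry A 0 2 * entry A 1 1)
      - a1 * (entry A 0 0 * entry A 1 2 - entry A 0 2 * entry A 1 0)
      + a2 * (entry A 0 0 * entry A 1 1 - entry A 0 1 * entry A 1 0))) * hperp
  have h3 := triple_sq_le (A a 0) (A a 1) (A a 2) (A b 0) (A b 1) (A b 2) (v 0) (v 1) (v 2)
  rw [← key, ← norm_sq_euc, ← norm_sq_euc, ← norm_sq_euc] at h3
  have hA := A.le_opNorm a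
  have hB := A.le_opNorm b
  have ha_pos : 0 < ‖a‖ ^ 2 := hna ▸ hpos
  have h4 : (adjPair A ξ v * ‖a‖ ^ 2) ^ 2 ≤ (‖x‖ * ‖A‖ ^ 2 * ‖v‖ * ‖a‖ ^ 2) ^ 2 := by
    calc _ ≤ ‖A a‖ ^ 2 * ‖A b‖ ^ 2 * ‖v‖ ^ 2 := h3
      _ ≤ (‖A‖ * ‖a‖) ^ 2 * (‖A‖ * ‖b‖) ^ 2 * ‖v‖ ^ 2 := by gcongr
      _ = _ := by rw [mul_pow ‖A‖ ‖b‖, hnb]; ring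
  have h5 := abs_le_of_sq_le_sq h4 (by positivity)

  have h6 : |adjPair A ξ v| * ‖a‖ ^ 2 ≤ ‖x‖ * ‖A‖ ^ 2 * ‖v‖ * ‖a‖ ^ 2 := by
    rw [← abs_of_pos ha_pos, ← abs_mul, abs_of_pos ha_pos]; exact h5
  refine (le_of_mul_le_mul_right h6 ha_pos).trans ?_
  gcongr

lemma abs_entry_le (A : Euc 3 →L[ℝ] Euc 3) (i j : Fin 3) : |entry A i j| ≤ ‖A‖ := by
  have h1 : |entry A i j| ≤ ‖A (stdVec j)‖ := by
    simpa [entry] using PiLp.norm_apply_le (A (stdVec j)) i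
  simpa using h1.trans (A.le_opNorm _)

lemma entry_sub (A B : Euc 3 →L[ℝ] Euc 3) (i j : Fin 3) :
    entry (A - B) i j = entry A i j - entry B i j := by simp [entry]

/-- Cubic local Lipschitz growth of a function of matrices. -/
def CubicLip (P : (Euc 3 →L[ℝ] Euc 3) → ℝ) : Prop :=
  ∃ C : ℝ, 0 ≤ C ∧ P 0 = 0 ∧ ∀ A B, |P A - P B| ≤ C * ‖A - B‖ * (1 + ‖A‖ ^ 2 + ‖B‖ ^ 2)

lemma cubicLip_cofactor (i j : Fin 3) : CubicLip (fun A => cofactor A i j) := by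
  refine ⟨4, by norm_num, by simp [cofactor, entry], fun A B => ?_⟩
  have key : ∀ i j k l, |entry A i j * entry A k l - entry B i j * entry B k l| ≤
      ‖A - B‖ * (‖A‖ + ‖B‖) := fun i j k l => by
    have : entry A i j * entry A k l - entry B i j * entry B k l =
      entry (A - B) i j * entry A k l + entry (A - B) k l * entry B i j := by
      simp only [entry_sub]; ring
    rw [this]
    refine (abs_add_le _ _).trans ?_
    rw [abs_mul, abs_mul, mul_add]
    gcongr <;> apply abs_entry_le
  have h1 := key (i + 1) (j + 1) (i + 2) (j + 2)
  have h2 := key (i + 1) (j + 2) (i + 2) (j + 1)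
  have h3 : |cofactor A i j - cofactor B i j| ≤ 2 * (‖A - B‖ * (‖A‖ + ‖B‖)) := by
    simp only [cofactor]
    rw [abs_le] at *
    constructor <;> linarith [h1.1, h1.2, h2.1, h2.2]
  refine h3.trans ?_
  have : ‖A‖ + ‖B‖ ≤ 2 * (1 + ‖A‖ ^ 2 + ‖B‖ ^ 2) := by
    nlinarith [sq_nonneg (‖A‖ - 1), sq_nonneg (‖B‖ - 1)]
  nlinarith [mul_le_mul_of_nonneg_left this (norm_nonneg (A - B))]

lemma cubicLip_det : CubicLip (fun A => A.det) := by
  refine ⟨12, by norm_num, by simp [det_eq_entry, entry], fun A B => ?_⟩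
  have key : ∀ i j k l m n, |entry A i j * entry A k l * entry A m n
      - entry B i j * entry B k l * entry B m n| ≤
      2 * (‖A - B‖ * (1 + ‖A‖ ^ 2 + ‖B‖ ^ 2)) := fun i j k l m n => by
    have : entry A i j * entry A k l * entry A m n - entry B i j * entry B k l * entry B m n =
      entry (A - B) i j * entry A k l * entry A m n +
      entry (A - B) k l * entry B i j * entry A m n +
      entry (A - B) m n * entry B i j * entry B k l := by
      simp only [entry_sub]; ring
    rw [this]
    have e1 : |entry (A - B) i j * entry A k l * entry A m n| ≤ ‖A - B‖ * ‖A‖ * ‖A‖ := by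
      rw [abs_mul, abs_mul]; gcongr <;> apply abs_entry_le
    have e2 : |entry (A - B) k l * entry B i j * entry A m n| ≤ ‖A - B‖ * ‖B‖ * ‖A‖ := by
      rw [abs_mul, abs_mul]; gcongr <;> apply abs_entry_le
    have e3 : |entry (A - B) m n * entry B i j * entry B k l| ≤ ‖A - B‖ * ‖B‖ * ‖B‖ := by
      rw [abs_mul, abs_mul]; gcongr <;> apply abs_entry_le
    refine (abs_add_three _ _ _).trans ?_
    have : ‖A‖ * ‖A‖ + ‖B‖ * ‖A‖ + ‖B‖ * ‖B‖ ≤ 2 * (1 + ‖A‖ ^ 2 + ‖B‖ ^ 2) := by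
      nlinarith [sq_nonneg (‖A‖ - ‖B‖)]
    nlinarith [mul_le_mul_of_nonneg_left this (norm_nonneg (A - B))]
  have h1 := abs_le.1 (key 0 0 1 1 2 2)
  have h2 := abs_le.1 (key 0 0 1 2 2 1)
  have h3 := abs_le.1 (key 0 1 1 0 2 2)
  have h4 := abs_le.1 (key 0 1 1 2 2 0)
  have h5 := abs_le.1 (key 0 2 1 0 2 1)
  have h6 := abs_le.1 (key 0 2 1 1 2 0)
  simp only [det_eq_entry]
  rw [abs_le]
  constructor <;> linarith [h1.1, h1.2, h2.1, h2.2, h3.1, h3.2, h4.1, h4.2, h5.1, h5.2, h6.1, h6.2]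

lemma cubicLip_norm_pow : CubicLip (fun A => ‖A‖ ^ 3) := by
  refine ⟨2, by norm_num, by simp, fun A B => ?_⟩
  have h := abs_norm_sub_norm_le A B
  have : ‖A‖ ^ 3 - ‖B‖ ^ 3 = (‖A‖ - ‖B‖) * (‖A‖ ^ 2 + ‖A‖ * ‖B‖ + ‖B‖ ^ 2) := by ring
  rw [this, abs_mul, abs_of_nonneg (a := _ + _ + _) (by positivity)]
  have h2 : ‖A‖ ^ 2 + ‖A‖ * ‖B‖ + ‖B‖ ^ 2 ≤ 2 * (1 + ‖A‖ ^ 2 + ‖B‖ ^ 2) := by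
    nlinarith [sq_nonneg (‖A‖ - ‖B‖)]
  calc _ ≤ ‖A - B‖ * (2 * (1 + ‖A‖ ^ 2 + ‖B‖ ^ 2)) := by gcongr
    _ = _ := by ring

/-- The triple product of the gradients of three functions on `ℝ³`. -/
def gradTriple (φ f g : Euc 3 → ℝ) (x : Euc 3) : ℝ :=
  fderiv ℝ φ x (stdVec 0) * (fderiv ℝ f x (stdVec 1) * fderiv ℝ g x (stdVec 2)
      - fderiv ℝ f x (stdVec 2) * fderiv ℝ g x (stdVec 1))
  + fderiv ℝ φ x (stdVec 1) * (fderiv ℝ f x (stdVec 2) * fderiv ℝ g x (stdVec 0)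
      - fderiv ℝ f x (stdVec 0) * fderiv ℝ g x (stdVec 2))
  + fderiv ℝ φ x (stdVec 2) * (fderiv ℝ f x (stdVec 0) * fderiv ℝ g x (stdVec 1)
      - fderiv ℝ f x (stdVec 1) * fderiv ℝ g x (stdVec 0))

lemma contDiff_fderiv_apply_const {f : Euc 3 → ℝ} (hf : ContDiff ℝ 2 f) (v : Euc 3) :
    ContDiff ℝ 1 (fun x => fderiv ℝ f x v) :=
  (hf.fderiv_right (m := 1) (by norm_num)).clm_apply contDiff_const

lemma fderiv_fderiv_apply_comm {f : Euc 3 → ℝ} (hf : ContDiff ℝ 2 f) (v w x : Euc 3) :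
    fderiv ℝ (fun y => fderiv ℝ f y v) x w = fderiv ℝ (fun y => fderiv ℝ f y w) x v := by
  have hd : DifferentiableAt ℝ (fderiv ℝ f) x :=
    (hf.fderiv_right (m := 1) (by norm_num)).differentiable (by norm_num) x
  rw [fderiv_clm_apply hd (differentiableAt_const v), fderiv_clm_apply hd (differentiableAt_const w)]
  simp only [fderiv_fun_const, Pi.zero_apply, ContinuousLinearMap.comp_zero, zero_add,
    ContinuousLinearMap.flip_apply]
  exact (hf.contDiffAt.isSymmSndFDerivAt (by simp)).eq w v

lemma integral_fderiv_mul_eq_neg {φ h : Euc 3 → ℝ} (hφ : ContDiff ℝ 1 φ)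
    (hc : HasCompactSupport φ) (hh : ContDiff ℝ 1 h) (v : Euc 3) :
    Integrable (fun x => fderiv ℝ φ x v * h x) ∧ Integrable (fun x => φ x * fderiv ℝ h x v) ∧
    ∫ x, fderiv ℝ φ x v * h x = - ∫ x, φ x * fderiv ℝ h x v := by
  have c1 : Continuous (fun x => fderiv ℝ φ x v) :=
    (hφ.continuous_fderiv (by norm_num)).clm_apply continuous_const
  have c2 : Continuous (fun x => fderiv ℝ h x v) :=
    (hh.continuous_fderiv (by norm_num)).clm_apply continuous_const
  have i1 : Integrable (fun x => fderiv ℝ φ x v * h x) :=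
    (c1.mul hh.continuous).integrable_of_hasCompactSupport ((hc.fderiv_apply ℝ v).mul_right)
  have i2 : Integrable (fun x => φ x * fderiv ℝ h x v) :=
    (hφ.continuous.mul c2).integrable_of_hasCompactSupport hc.mul_right
  refine ⟨i1, i2, ?_⟩
  have := integral_mul_fderiv_eq_neg_fderiv_mul_of_integrable (μ := volume) i1 i2
    ((hφ.continuous.mul hh.continuous).integrable_of_hasCompactSupport hc.mul_right)
    (fun x _ => hφ.differentiable (by norm_num) x)
    (fun x _ => hh.differentiable (by norm_num) x)
  linarith

lemma integral_gradTriple_eq_zero {φ f g : Euc 3 → ℝ} (hφ : ContDiff ℝ 1 φ)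
    (hc : HasCompactSupport φ) (hf : ContDiff ℝ 2 f) (hg : ContDiff ℝ 2 g) :
    Integrable (gradTriple φ f g) ∧ ∫ x, gradTriple φ f g x = 0 := by
  have hF := fun j => contDiff_fderiv_apply_const hf (stdVec j)
  have hG := fun j => contDiff_fderiv_apply_const hg (stdVec j)
  have dF := fun j x => (hF j).differentiable (by norm_num) x
  have dG := fun j x => (hG j).differentiable (by norm_num) x
  have hH : ∀ j k, ContDiff ℝ 1 (fun x => fderiv ℝ f x (stdVec j) * fderiv ℝ g x (stdVec k)
      - fderiv ℝ f x (stdVec k) * fderiv ℝ g x (stdVec j)) := fun j k =>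
    ((hF j).mul (hG k)).sub ((hF k).mul (hG j))
  have hD : ∀ j k x v, fderiv ℝ (fun x => fderiv ℝ f x (stdVec j) * fderiv ℝ g x (stdVec k)
      - fderiv ℝ f x (stdVec k) * fderiv ℝ g x (stdVec j)) x v =
      fderiv ℝ f x (stdVec j) * fderiv ℝ (fun y => fderiv ℝ g y (stdVec k)) x v
      + fderiv ℝ g x (stdVec k) * fderiv ℝ (fun y => fderiv ℝ f y (stdVec j)) x v
      - (fderiv ℝ f x (stdVec k) * fderiv ℝ (fun y => fderiv ℝ g y (stdVec j)) x v
      + fderiv ℝ g x (stdVec j) * fderiv ℝ (fun y => fderiv ℝ f y (stdVec k)) x v) := by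
    intro j k x v
    rw [fderiv_fun_sub ((dF j x).fun_mul (dG k x)) ((dF k x).fun_mul (dG j x)),
      fderiv_fun_mul (dF j x) (dG k x), fderiv_fun_mul (dF k x) (dG j x)]
    simp
  obtain ⟨a0, b0, e0⟩ := integral_fderiv_mul_eq_neg hφ hc (hH 1 2) (stdVec 0)
  obtain ⟨a1, b1, e1⟩ := integral_fderiv_mul_eq_neg hφ hc (hH 2 0) (stdVec 1)
  obtain ⟨a2, b2, e2⟩ := integral_fderiv_mul_eq_neg hφ hc (hH 0 1) (stdVec 2)
  have hi : Integrable (gradTriple φ f g) := (a0.add a1).add a2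
  refine ⟨hi, ?_⟩
  simp only [gradTriple]
  rw [integral_add (by exact a0.add a1) a2, integral_add a0 a1, e0, e1, e2, ← neg_add, ← neg_add,
    ← integral_add b0 b1, ← integral_add (by exact b0.add b1) b2, neg_eq_zero]
  refine integral_eq_zero_of_ae (ae_of_all _ fun x => ?_)
  simp only [Pi.zero_apply, hD]
  rw [fderiv_fderiv_apply_comm hf (stdVec 1) (stdVec 0), fderiv_fderiv_apply_comm hf (stdVec 2) (stdVec 0),
    fderiv_fderiv_apply_comm hf (stdVec 2) (stdVec 1), fderiv_fderiv_apply_comm hg (stdVec 1) (stdVec 0),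
    fderiv_fderiv_apply_comm hg (stdVec 2) (stdVec 0), fderiv_fderiv_apply_comm hg (stdVec 2) (stdVec 1)]
  ring

/-- The divergence of a vector field. -/
def divg (V : Euc 3 → Euc 3) (y : Euc 3) : ℝ := ∑ i, entry (fderiv ℝ V y) i i

lemma fderiv_coord {G : Euc 3 → Euc 3} {x : Euc 3} (hG : DifferentiableAt ℝ G x) (i j : Fin 3) :
    fderiv ℝ (fun y => G y i) x (stdVec j) = entry (fderiv ℝ G x) i j := by
  have h := ((EuclideanSpace.proj (𝕜 := ℝ) i).hasFDerivAt (x := G x)).comp x hG.hasFDerivAt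
  have h2 : HasFDerivAt (fun y => G y i) ((EuclideanSpace.proj (𝕜 := ℝ) i).comp (fderiv ℝ G x)) x := h
  rw [h2.fderiv]; rfl

lemma contDiff_coord {G : Euc 3 → Euc 3} {n : WithTop ℕ∞} (hG : ContDiff ℝ n G) (i : Fin 3) :
    ContDiff ℝ n (fun y => G y i) := by
  have := (EuclideanSpace.proj i : Euc 3 →L[ℝ] ℝ).contDiff (n := n)
  exact this.comp hG

/-- The integrand of the pulled-back divergence theorem. -/
def pullIntegrand (F : Euc 3 → Euc 3) (DF : Euc 3 → Euc 3 →L[ℝ] Euc 3) (η : Euc 3 → ℝ)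
    (V : Euc 3 → Euc 3) (x : Euc 3) : ℝ :=
  η x * divg V (F x) * (DF x).det + adjPair (DF x) (fderiv ℝ η x) (V (F x))

lemma integral_pull_smooth {G : Euc 3 → Euc 3} (hG : ContDiff ℝ 2 G) {η : Euc 3 → ℝ}
    (hη : ContDiff ℝ 1 η) (hc : HasCompactSupport η) {U : Set (Euc 3)} (hU : IsOpen U)
    {V : Euc 3 → Euc 3} (hV : ContDiffOn ℝ 1 V U) (hGU : ∀ x ∈ tsupport η, G x ∈ U) :
    Integrable (pullIntegrand G (fderiv ℝ G) η V) ∧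
    ∫ x, pullIntegrand G (fderiv ℝ G) η V x = 0 := by
  have dG : ∀ x, DifferentiableAt ℝ G x := fun x => hG.differentiable (by norm_num) x
  have dη : ∀ x, DifferentiableAt ℝ η x := fun x => hη.differentiable (by norm_num) x
  have hVG : ∀ x ∈ tsupport η, ContDiffAt ℝ 1 (V ∘ G) x := fun x hx =>
    (hV.contDiffAt (hU.mem_nhds (hGU x hx))).comp x (hG.contDiffAt.of_le (by norm_num))
  have hφ : ∀ i : Fin 3, ContDiff ℝ 1 (fun x => η x * V (G x) i) := fun i => by
    rw [contDiff_iff_contDiffAt]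
    intro x
    by_cases hx : x ∈ tsupport η
    · refine hη.contDiffAt.mul ?_
      have h1 := (EuclideanSpace.proj i : Euc 3 →L[ℝ] ℝ).contDiff (n := 1)
      exact h1.contDiffAt.comp x (hVG x hx)
    · have : (fun x => η x * V (G x) i) =ᶠ[𝓝 x] fun _ => 0 := by
        filter_upwards [notMem_tsupport_iff_eventuallyEq.1 hx] with y hy
        simp [hy]
      exact contDiffAt_const.congr_of_eventuallyEq this
  have hφc : ∀ i : Fin 3, HasCompactSupport (fun x => η x * V (G x) i) := fun i => hc.mul_right
  obtain ⟨i0, e0⟩ := integral_gradTriple_eq_zero (hφ 0) (hφc 0) (contDiff_coord hG 1) (contDiff_coord hG 2)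
  obtain ⟨i1, e1⟩ := integral_gradTriple_eq_zero (hφ 1) (hφc 1) (contDiff_coord hG 2) (contDiff_coord hG 0)
  obtain ⟨i2, e2⟩ := integral_gradTriple_eq_zero (hφ 2) (hφc 2) (contDiff_coord hG 0) (contDiff_coord hG 1)
  have key : pullIntegrand G (fderiv ℝ G) η V = fun x =>
      gradTriple (fun x => η x * V (G x) 0) (fun x => G x 1) (fun x => G x 2) x
      + gradTriple (fun x => η x * V (G x) 1) (fun x => G x 2) (fun x => G x 0) x
      + gradTriple (fun x => η x * V (G x) 2) (fun x => G x 0) (fun x => G x 1) x := by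
    funext x
    simp only [gradTriple, fderiv_coord (dG x)]
    by_cases hx : x ∈ tsupport η
    · have dV : DifferentiableAt ℝ V (G x) :=
        (hV.contDiffAt (hU.mem_nhds (hGU x hx))).differentiableAt (by norm_num)
      have hd : ∀ i j : Fin 3, fderiv ℝ (fun x => η x * V (G x) i) x (stdVec j) =
          η x * (∑ l, entry (fderiv ℝ G x) l j * entry (fderiv ℝ V (G x)) i l)
          + V (G x) i * fderiv ℝ η x (stdVec j) := fun i j => by
        have hVGd : DifferentiableAt ℝ (V ∘ G) x := (hVG x hx).differentiableAt (by norm_num)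
        have h1 : DifferentiableAt ℝ (fun x => V (G x) i) x :=
          (EuclideanSpace.proj (𝕜 := ℝ) i).differentiableAt.comp x hVGd
        rw [fderiv_fun_mul (dη x) h1]
        have h2 := fderiv_coord hVGd i j
        simp only [Function.comp_apply] at h2
        simp only [_root_.add_apply, _root_.smul_apply, smul_eq_mul, h2]
        congr 2
        rw [entry, fderiv_comp x dV (dG x)]
        simp only [ContinuousLinearMap.comp_apply]
        rw [apply_eq_entry]
        rfl
      simp only [hd]
      simp only [pullIntegrand, adjPair_eq, det_eq_entry, divg, Fin.sum_univ_three]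
      ring
    · have hx' := notMem_tsupport_iff_eventuallyEq.1 hx
      have hη0 : η x = 0 := hx'.eq_of_nhds
      have hη1 : fderiv ℝ η x = 0 := by rw [hx'.fderiv_eq]; simp
      have hd : ∀ i : Fin 3, fderiv ℝ (fun x => η x * V (G x) i) x = 0 := fun i => by
        have : (fun x => η x * V (G x) i) =ᶠ[𝓝 x] fun _ => 0 := by
          filter_upwards [hx'] with y hy
          simp [hy]
        rw [this.fderiv_eq]; simp
      simp [hd, pullIntegrand, adjPair_eq, hη0, hη1]
  rw [key]
  refine ⟨(i0.add i1).add i2, ?_⟩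
  rw [integral_add (by exact i0.add i1) i2, integral_add i0 i1, e0, e1, e2]
  simp

/-- Mollification by a bump function. -/
def moll {E : Type*} [NormedAddCommGroup E] [NormedSpace ℝ E] (ρ : ContDiffBump (0 : Euc 3))
    (h : Euc 3 → E) : Euc 3 → E :=
  convolution (ρ.normed volume) h (ContinuousLinearMap.lsmul ℝ ℝ) volume

section moll

variable {E : Type*} [NormedAddCommGroup E] [NormedSpace ℝ E] (ρ : ContDiffBump (0 : Euc 3))

lemma moll_apply (h : Euc 3 → E) (x : Euc 3) :
    moll ρ h x = ∫ t, ρ.normed volume t • h (x - t) := rfl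

lemma moll_apply' (h : Euc 3 → E) (x : Euc 3) :
    moll ρ h x = ∫ t, ρ.normed volume (x - t) • h t :=
  convolution_lsmul_swap

lemma integrable_normed_smul {h : Euc 3 → E} (hh : LocallyIntegrable h) (x : Euc 3) :
    Integrable (fun t => ρ.normed volume (x - t) • h t) := by
  refine hh.integrable_smul_left_of_hasCompactSupport
    (ρ.continuous_normed.comp (continuous_const.sub continuous_id)) ?_
  exact ρ.hasCompactSupport_normed.comp_homeomorph (Homeomorph.subLeft x)

lemma lintegral_normed : ∫⁻ t, ‖ρ.normed volume t‖ₑ = 1 := by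
  have h1 := ofReal_integral_eq_lintegral_ofReal (ρ.integrable_normed (μ := volume))
    (ae_of_all _ ρ.nonneg_normed)
  rw [ρ.integral_normed, ENNReal.ofReal_one] at h1
  rw [h1]
  exact lintegral_congr fun t => Real.enorm_of_nonneg (ρ.nonneg_normed t)

lemma enorm_moll_pow_le {h : Euc 3 → E} (hh : StronglyMeasurable h) (x : Euc 3) :
    ‖moll ρ h x‖ₑ ^ 3 ≤ ∫⁻ t, ‖ρ.normed volume t‖ₑ * ‖h (x - t)‖ₑ ^ 3 := by
  set w : Euc 3 → ℝ≥0∞ := fun t => ‖ρ.normed volume t‖ₑ with hw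
  set f : Euc 3 → ℝ≥0∞ := fun t => ‖h (x - t)‖ₑ with hf
  have mw : Measurable w := (ρ.continuous_normed.measurable).enorm
  have mf : Measurable f := (hh.comp_measurable (measurable_const.sub measurable_id)).enorm
  have h1 : ‖moll ρ h x‖ₑ ≤ ∫⁻ t, ((fun t => w t ^ (1 / 3 : ℝ) * f t) * fun t => w t ^ (2 / 3 : ℝ)) t := by
    rw [moll_apply]
    refine (enorm_integral_le_lintegral_enorm _).trans (le_of_eq (lintegral_congr fun t => ?_))
    simp only [Pi.mul_apply, enorm_smul]
    rw [mul_right_comm, ← ENNReal.rpow_add_of_nonneg _ _ (by norm_num) (by norm_num)]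
    norm_num [hw, hf]
  have h2 := ENNReal.lintegral_mul_le_Lp_mul_Lq volume
    (p := 3) (q := 3 / 2) (by rw [Real.holderConjugate_iff]; norm_num)
    ((mw.pow_const (1 / 3 : ℝ)).mul mf).aemeasurable
    (mw.pow_const (2 / 3 : ℝ)).aemeasurable
  have h3 : ∀ t, (w t ^ (2 / 3 : ℝ)) ^ (3 / 2 : ℝ) = w t := fun t => by
    rw [← ENNReal.rpow_mul]; norm_num
  have h4 : ∀ t, (w t ^ (1 / 3 : ℝ) * f t) ^ (3 : ℝ) = w t * f t ^ 3 := fun t => by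
    rw [ENNReal.mul_rpow_of_nonneg _ _ (by norm_num), ← ENNReal.rpow_mul]
    norm_num
  have h6 : ∫⁻ t, w t = 1 := lintegral_normed ρ
  simp only [h3, h6, ENNReal.one_rpow, mul_one] at h2
  have h5 := h1.trans h2
  calc ‖moll ρ h x‖ₑ ^ 3 ≤ ((∫⁻ t, (w t ^ (1 / 3 : ℝ) * f t) ^ (3 : ℝ)) ^ (1 / 3 : ℝ)) ^ 3 := by
        gcongr; exact h5
    _ = ∫⁻ t, (w t ^ (1 / 3 : ℝ) * f t) ^ (3 : ℝ) := by
        rw [← ENNReal.rpow_natCast, ← ENNReal.rpow_mul]; norm_num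
    _ = _ := lintegral_congr h4

lemma lintegral_moll_pow_le {h : Euc 3 → E} (hh : AEStronglyMeasurable h) (hρ : ρ.rOut ≤ 1) (R : ℝ) :
    ∫⁻ x in ball 0 R, ‖moll ρ h x‖ₑ ^ 3 ≤ ∫⁻ x in ball 0 (R + 1), ‖h x‖ₑ ^ 3 := by
  wlog hm : StronglyMeasurable h generalizing h
  · have h1 := this (h := hh.mk h) hh.stronglyMeasurable_mk.aestronglyMeasurable
      hh.stronglyMeasurable_mk
    have h2 : moll ρ h = moll ρ (hh.mk h) := by
      funext x
      rw [moll_apply', moll_apply']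
      refine integral_congr_ae ?_
      filter_upwards [hh.ae_eq_mk] with t ht
      rw [ht]
    rw [h2]
    refine h1.trans (le_of_eq (lintegral_congr_ae (ae_restrict_of_ae ?_)))
    filter_upwards [hh.ae_eq_mk] with t ht
    rw [ht]
  have mm : Measurable fun p : Euc 3 × Euc 3 => ‖h (p.1 - p.2)‖ₑ ^ 3 :=
    ((hm.comp_measurable (measurable_fst.sub measurable_snd)).enorm).pow_const 3
  calc _ ≤ ∫⁻ x in ball 0 R, ∫⁻ t, ‖ρ.normed volume t‖ₑ * ‖h (x - t)‖ₑ ^ 3 :=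
        lintegral_mono fun x => enorm_moll_pow_le ρ hm x
    _ = ∫⁻ t, ∫⁻ x in ball 0 R, ‖ρ.normed volume t‖ₑ * ‖h (x - t)‖ₑ ^ 3 := by
        refine lintegral_lintegral_swap (Measurable.aemeasurable ?_)
        exact (ρ.continuous_normed.measurable.enorm.comp measurable_snd).mul mm
    _ ≤ ∫⁻ t, ‖ρ.normed volume t‖ₑ * ∫⁻ x in ball 0 (R + 1), ‖h x‖ₑ ^ 3 := by
        refine lintegral_mono fun t => ?_
        by_cases ht : t ∈ ball (0 : Euc 3) ρ.rOut
        · have ht' : ‖t‖ < 1 := (mem_ball_zero_iff.1 ht).trans_le hρ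
          have mt : Measurable fun x => ‖h (x - t)‖ₑ ^ 3 :=
            ((hm.comp_measurable (measurable_id.sub measurable_const)).enorm).pow_const 3
          simp only
          rw [lintegral_const_mul _ mt]
          refine mul_le_mul_right ?_ _
          rw [← lintegral_indicator measurableSet_ball, ← lintegral_indicator measurableSet_ball,

            ← lintegral_sub_right_eq_self ((ball 0 (R + 1)).indicator fun x => ‖h x‖ₑ ^ 3) t]
          refine lintegral_mono fun x => ?_
          by_cases hx : x ∈ ball (0 : Euc 3) R
          · rw [indicator_of_mem hx, indicator_of_mem]
            rw [mem_ball_zero_iff] at *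
            calc ‖x - t‖ ≤ ‖x‖ + ‖t‖ := norm_sub_le _ _
              _ < R + 1 := add_lt_add hx ht'
          · rw [indicator_of_notMem hx]; exact zero_le
        · have : ρ.normed volume t = 0 := by
            rw [← Function.notMem_support, ρ.support_normed_eq]; exact ht
          simp [this]
    _ = _ := by
        rw [lintegral_mul_const _ ρ.continuous_normed.measurable.enorm, lintegral_normed, one_mul]

lemma moll_sub {f g : Euc 3 → E} (hf : LocallyIntegrable f) (hg : LocallyIntegrable g) :
    moll ρ (f - g) = moll ρ f - moll ρ g := by
  funext x
  simp only [Pi.sub_apply, moll_apply']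
  rw [← integral_sub (integrable_normed_smul ρ hf x) (integrable_normed_smul ρ hg x)]
  simp [smul_sub]

lemma contDiff_moll [CompleteSpace E] {h : Euc 3 → E} (hh : LocallyIntegrable h) (n : ℕ∞) :
    ContDiff ℝ n (moll ρ h) :=
  ρ.hasCompactSupport_normed.contDiff_convolution_left _ ρ.contDiff_normed hh

lemma inner_fderiv_moll {F : Euc 3 → Euc 3} (hF : Continuous F) (x v w : Euc 3) :
    ⟪fderiv ℝ (moll ρ F) x v, w⟫ =
      - ∫ y, fderiv ℝ (fun y => ρ.normed volume (x - y)) y v * ⟪F y, w⟫ := by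
  have hρ1 : ContDiff ℝ 1 (ρ.normed volume) := ρ.contDiff_normed (n := 1)
  have h1 := ρ.hasCompactSupport_normed.hasFDerivAt_convolution_left
    (ContinuousLinearMap.lsmul ℝ ℝ) (μ := volume) hρ1 hF.locallyIntegrable x
  have hd : fderiv ℝ (moll ρ F) x = _ := h1.fderiv
  have hint : Integrable (fun t => ((ContinuousLinearMap.lsmul ℝ ℝ).precompL (Euc 3))
      (fderiv ℝ (ρ.normed volume) (x - t)) (F t)) := by
    have := ((ρ.hasCompactSupport_normed (μ := volume)).fderiv ℝ).convolutionExists_left (μ := volume)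
      ((ContinuousLinearMap.lsmul ℝ ℝ).precompL (Euc 3)) (hρ1.continuous_fderiv (by norm_num))
      hF.locallyIntegrable x
    exact convolutionExistsAt_iff_integrable_swap.1 this
  rw [hd, convolution_eq_swap, ContinuousLinearMap.integral_apply hint, real_inner_comm,
    ← integral_inner (hint.apply_continuousLinearMap v), ← integral_neg]
  refine integral_congr_ae (ae_of_all _ fun y => ?_)
  have hder : fderiv ℝ (fun y => ρ.normed volume (x - y)) y v
      = - fderiv ℝ (ρ.normed volume) (x - y) v := by
    have hg : HasFDerivAt (fun y : Euc 3 => x - y) (-ContinuousLinearMap.id ℝ (Euc 3)) y :=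
      (hasFDerivAt_id y).const_sub x
    have := ((hρ1.differentiable (by norm_num) (x - y)).hasFDerivAt.comp y hg).fderiv
    simp only [Function.comp_def] at this
    rw [this]; simp
  simp only [hder, ContinuousLinearMap.precompL_apply, ContinuousLinearMap.lsmul_apply,
    inner_smul_right, real_inner_comm w]
  ring

end moll

/-- `DF` is a distributional differential of `F`. -/
def WeakDeriv (F : Euc 3 → Euc 3) (DF : Euc 3 → Euc 3 →L[ℝ] Euc 3) : Prop :=
  ∀ φ : Euc 3 → ℝ, ContDiff ℝ (⊤ : ℕ∞) φ → HasCompactSupport φ → ∀ v w : Euc 3,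
    ∫ x, fderiv ℝ φ x v * ⟪F x, w⟫ = - ∫ x, φ x * ⟪DF x v, w⟫

section

variable {F : Euc 3 → Euc 3} {DF : Euc 3 → Euc 3 →L[ℝ] Euc 3}

lemma normed_sub_test (ρ : ContDiffBump (0 : Euc 3)) (x : Euc 3) :
    ContDiff ℝ (⊤ : ℕ∞) (fun y => ρ.normed volume (x - y)) ∧
    HasCompactSupport (fun y => ρ.normed volume (x - y)) :=
  ⟨(ρ.contDiff_normed (n := ⊤)).comp (contDiff_const.sub contDiff_id),
    ρ.hasCompactSupport_normed.comp_homeomorph (Homeomorph.subLeft x)⟩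

lemma fderiv_moll_eq (hF : Continuous F) (hw : WeakDeriv F DF) (hl : LocallyIntegrable DF)
    (ρ : ContDiffBump (0 : Euc 3)) (x : Euc 3) :
    fderiv ℝ (moll ρ F) x = moll ρ DF x := by
  ext1 v
  refine ext_inner_right ℝ fun w => ?_
  rw [inner_fderiv_moll ρ hF, hw _ (normed_sub_test ρ x).1 (normed_sub_test ρ x).2, neg_neg,
    moll_apply', ContinuousLinearMap.integral_apply (integrable_normed_smul ρ hl x),
    real_inner_comm w,
    ← integral_inner ((integrable_normed_smul ρ hl x).apply_continuousLinearMap v)]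
  refine integral_congr_ae (ae_of_all _ fun y => ?_)
  simp [inner_smul_right, real_inner_comm w]

lemma exists_test_not_measurable {g : Euc 3 → ℝ} (hg : ¬ AEStronglyMeasurable g)
    {φ : Euc 3 → ℝ} (hφ : ContDiff ℝ (⊤ : ℕ∞) φ) (hc : HasCompactSupport φ) :
    ∃ ψ : Euc 3 → ℝ, ContDiff ℝ (⊤ : ℕ∞) ψ ∧ HasCompactSupport ψ ∧
      ¬ AEStronglyMeasurable (fun x => ψ x * g x) ∧
      ¬ AEStronglyMeasurable (fun x => (φ x + ψ x) * g x) := by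
  obtain ⟨R, hR0, hR⟩ : ∃ R : ℝ, 0 < R ∧ tsupport φ ⊆ closedBall 0 R :=
    (hc.isBounded.subset_closedBall_lt 0 0)
  obtain ⟨c, hcb⟩ := hc.exists_bound_of_continuous hφ.continuous
  have hc0 : 0 ≤ c := (norm_nonneg _).trans (hcb 0)
  let b : ℕ → ContDiffBump (0 : Euc 3) := fun n => ⟨R + n, R + n + 1, by positivity, by linarith⟩
  have hb : ∃ n, ¬ AEStronglyMeasurable (fun x => b n x * g x) := by
    by_contra! h
    refine hg (aestronglyMeasurable_of_tendsto_ae atTop h (ae_of_all _ fun x => ?_))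
    obtain ⟨N, hN⟩ := exists_nat_ge ‖x‖
    refine tendsto_const_nhds.congr' ?_
    filter_upwards [eventually_ge_atTop N] with n hn
    rw [(b n).one_of_mem_closedBall, one_mul]
    rw [mem_closedBall_zero_iff]
    have : (N : ℝ) ≤ n := by exact_mod_cast hn
    show ‖x‖ ≤ R + n
    linarith
  obtain ⟨n, hn⟩ := hb
  have h1 : ∀ x, φ x ≠ 0 → b n x = 1 := fun x hx => by
    refine (b n).one_of_mem_closedBall ?_
    have := hR (subset_tsupport _ hx)
    rw [mem_closedBall_zero_iff] at *
    show ‖x‖ ≤ R + n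
    linarith [(Nat.cast_nonneg n : (0 : ℝ) ≤ n)]
  have hψc : Continuous fun x => b n x := (b n).continuous
  refine ⟨fun x => (c + 1) * b n x, contDiff_const.mul (b n).contDiff,
    (b n).hasCompactSupport.mul_left, fun h => hn ?_, fun h => hn ?_⟩
  · convert (h.const_mul (c + 1)⁻¹) using 2 with x
    field_simp
  · have m : Measurable fun x => b n x / (φ x + (c + 1) * b n x) :=
      hψc.measurable.div (hφ.continuous.add (continuous_const.mul hψc)).measurable
    convert (m.aestronglyMeasurable.mul h) using 2 with x
    by_cases hx : b n x = 0
    · simp [hx]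
    · have : φ x + (c + 1) * b n x ≠ 0 := by
        by_cases hφx : φ x = 0
        · rw [hφx, zero_add]; positivity
        · rw [h1 x hφx]
          have := neg_le_of_abs_le (hcb x)
          intro h0; linarith
      simp only [Pi.mul_apply]
      rw [← mul_assoc, div_mul_cancel₀ _ this]

lemma integrable_test {φ : Euc 3 → ℝ} (hφ : ContDiff ℝ (⊤ : ℕ∞) φ) (hc : HasCompactSupport φ)
    (hF : Continuous F) (v w : Euc 3) : Integrable fun x => fderiv ℝ φ x v * ⟪F x, w⟫ :=
  (((hφ.continuous_fderiv (by simp)).clm_apply continuous_const).mul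
    (hF.inner continuous_const)).integrable_of_hasCompactSupport (hc.fderiv_apply ℝ v).mul_right

lemma integral_test_eq_zero (hF : Continuous F) (hw : WeakDeriv F DF) {v w : Euc 3}
    (hg : ¬ AEStronglyMeasurable (fun x => ⟪DF x v, w⟫))
    {φ : Euc 3 → ℝ} (hφ : ContDiff ℝ (⊤ : ℕ∞) φ) (hc : HasCompactSupport φ) :
    ∫ x, fderiv ℝ φ x v * ⟪F x, w⟫ = 0 := by
  obtain ⟨ψ, hψ, hψc, h1, h2⟩ := exists_test_not_measurable hg hφ hc
  have e1 := hw ψ hψ hψc v w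
  have e2 := hw (fun x => φ x + ψ x) (hφ.add hψ) (hc.add hψc) v w
  rw [integral_undef fun h => h1 h.1] at e1
  rw [integral_undef fun h => h2 h.1] at e2
  have e3 : ∀ x, fderiv ℝ (fun x => φ x + ψ x) x v * ⟪F x, w⟫ =
      fderiv ℝ φ x v * ⟪F x, w⟫ + fderiv ℝ ψ x v * ⟪F x, w⟫ := fun x => by
    rw [fderiv_fun_add (hφ.differentiable (by simp) x) (hψ.differentiable (by simp) x)]
    simp [add_mul]
  simp only [e3] at e2
  rw [integral_add (integrable_test hφ hc hF v w) (integrable_test hψ hψc hF v w), e1] at e2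
  simpa using e2

/-- A sequence of shrinking bump functions. -/
def shrinkBump (n : ℕ) : ContDiffBump (0 : Euc 3) :=
  ⟨1 / (2 * (n + 1)), 1 / (n + 1), by positivity, by
    gcongr; linarith [(Nat.cast_nonneg n : (0 : ℝ) ≤ n)]⟩

lemma shrinkBump_le (n : ℕ) : (shrinkBump n).rOut ≤ 1 := by
  show 1 / ((n : ℝ) + 1) ≤ 1
  rw [div_le_one (by positivity)]
  linarith [(Nat.cast_nonneg n : (0 : ℝ) ≤ n)]

lemma tendsto_shrinkBump : Tendsto (fun n => (shrinkBump n).rOut) atTop (𝓝 0) :=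
  tendsto_one_div_add_atTop_nhds_zero_nat

lemma tendstoUniformlyOn_moll {E : Type*} [NormedAddCommGroup E] [NormedSpace ℝ E]
    [CompleteSpace E] {h : Euc 3 → E} (hh : Continuous h) (R : ℝ) :
    TendstoUniformlyOn (fun n => moll (shrinkBump n) h) h atTop (closedBall 0 R) := by
  rw [Metric.tendstoUniformlyOn_iff]
  intro ε hε
  have hu := (isCompact_closedBall (0 : Euc 3) (R + 1)).uniformContinuousOn_of_continuous
    hh.continuousOn
  rw [Metric.uniformContinuousOn_iff] at hu
  obtain ⟨δ, hδ, hu⟩ := hu (ε / 2) (half_pos hε)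
  filter_upwards [tendsto_shrinkBump.eventually (gt_mem_nhds hδ)] with n hn x hx
  rw [dist_comm]
  refine lt_of_le_of_lt (ContDiffBump.dist_normed_convolution_le hh.aestronglyMeasurable
    fun y hy => (hu y ?_ x ?_ ((mem_ball.1 hy).trans hn)).le) (half_lt_self hε)
  · rw [mem_closedBall_zero_iff] at *
    have h1 := (mem_ball.1 hy).trans_le (shrinkBump_le n)
    rw [dist_eq_norm] at h1
    linarith [norm_le_norm_add_norm_sub' y x]
  · exact closedBall_subset_closedBall (by linarith) hx

lemma exists_norm_le_on {h : Euc 3 → Euc 3} (hh : Continuous h) (x : Euc 3) :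
    Tendsto (fun n => moll (shrinkBump n) h x) atTop (𝓝 (h x)) :=
  (tendstoUniformlyOn_moll hh ‖x‖).tendsto_at (by simp)

lemma eq_add_of_fderiv_moll (hF : Continuous F) {v : Euc 3}
    (h : ∀ n x, fderiv ℝ (moll (shrinkBump n) F) x v = 0) (x : Euc 3) : F (x + v) = F x := by
  have key : ∀ n, moll (shrinkBump n) F (x + v) = moll (shrinkBump n) F x := fun n => by
    have hd : Differentiable ℝ (moll (shrinkBump n) F) :=
      (contDiff_moll (shrinkBump n) hF.locallyIntegrable 1).differentiable (by simp)
    have hl : ∀ t : ℝ, HasDerivAt (fun t : ℝ => moll (shrinkBump n) F (x + t • v)) 0 t := fun t => by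
      have h1 : HasDerivAt (fun t : ℝ => x + t • v) v t := by
        simpa using ((hasDerivAt_id t).smul_const v).const_add x
      have := (hd (x + t • v)).hasFDerivAt.comp_hasDerivAt t h1
      rwa [h n] at this
    have := is_const_of_deriv_eq_zero (fun t => (hl t).differentiableAt) (fun t => (hl t).deriv) 1 0
    simpa using this
  refine tendsto_nhds_unique (exists_norm_le_on hF (x + v)) ?_
  simpa only [key] using exists_norm_le_on hF x

lemma aestronglyMeasurable_weakDeriv (hF : Continuous F) (hi : Function.Injective F)
    (hw : WeakDeriv F DF) : AEStronglyMeasurable DF := by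
  have key : ∀ v w, AEStronglyMeasurable (fun x => ⟪DF x v, w⟫) := by
    by_contra! hcon
    obtain ⟨v, w, hvw⟩ := hcon
    have h0 : ∀ w' (φ : Euc 3 → ℝ), ContDiff ℝ (⊤ : ℕ∞) φ → HasCompactSupport φ →
        ∫ x, fderiv ℝ φ x v * ⟪F x, w'⟫ = 0 := by
      intro w' φ hφ hc
      by_cases hw' : AEStronglyMeasurable (fun x => ⟪DF x v, w'⟫)
      · have h1 : ¬ AEStronglyMeasurable (fun x => ⟪DF x v, w' + w⟫) := fun h => hvw <| by
          refine (h.sub hw').congr (ae_of_all _ fun x => ?_)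
          simp [inner_add_right]
        have e1 := integral_test_eq_zero hF hw h1 hφ hc
        have e2 := integral_test_eq_zero hF hw hvw hφ hc
        simp only [inner_add_right, mul_add] at e1
        rw [integral_add (integrable_test hφ hc hF v w') (integrable_test hφ hc hF v w), e2] at e1
        simpa using e1
      · exact integral_test_eq_zero hF hw hw' hφ hc
    have h1 := eq_add_of_fderiv_moll hF (v := v) (fun n x => ext_inner_right ℝ fun w' => by
      rw [inner_fderiv_moll _ hF, h0 w' _ (normed_sub_test _ x).1 (normed_sub_test _ x).2]; simp) 0
    have hv : v = 0 := by simpa using hi h1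
    exact hvw (by simpa [hv] using aestronglyMeasurable_const)
  have hsum : DF = fun x => ∑ j, ∑ i, ⟪DF x (stdVec j), stdVec i⟫ •
      (EuclideanSpace.proj j : Euc 3 →L[ℝ] ℝ).smulRight (stdVec i) := by
    funext x
    ext y i
    rw [apply_eq_entry]
    simp only [inner_euc, Fin.sum_univ_three, entry]
    fin_cases i <;> simp <;> ring
  rw [hsum]
  refine Finset.aestronglyMeasurable_fun_sum _ fun j _ =>
    Finset.aestronglyMeasurable_fun_sum _ fun i _ => ?_
  exact (key _ _).smul_const _

end

/-- A continuous map with a measurable, locally cube-integrable distributional differential. -/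
structure IsSobolev (F : Euc 3 → Euc 3) (DF : Euc 3 → Euc 3 →L[ℝ] Euc 3) : Prop where
  cont : Continuous F
  meas : AEStronglyMeasurable DF
  int : ∀ R : ℝ, IntegrableOn (fun x => ‖DF x‖ ^ 3) (ball (0 : Euc 3) R)
  weak : WeakDeriv F DF

lemma memLp_three_of_integrable {E : Type*} [NormedAddCommGroup E] {f : Euc 3 → E} {μ : Measure (Euc 3)}
    (hf : AEStronglyMeasurable f μ) (hi : Integrable (fun x => ‖f x‖ ^ 3) μ) : MemLp f 3 μ := by
  have := (integrable_norm_rpow_iff hf (p := 3) (by norm_num) (by norm_num)).1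
  refine this ?_
  simpa using hi

lemma locallyIntegrable_of_cube {E : Type*} [NormedAddCommGroup E] {f : Euc 3 → E}
    (hf : AEStronglyMeasurable f)
    (hi : ∀ R : ℝ, IntegrableOn (fun x => ‖f x‖ ^ 3) (ball (0 : Euc 3) R)) :
    LocallyIntegrable f := by
  intro x
  refine ⟨ball 0 (‖x‖ + 1), isOpen_ball.mem_nhds (by simp), ?_⟩
  have : IsFiniteMeasure (volume.restrict (ball (0 : Euc 3) (‖x‖ + 1))) :=
    isFiniteMeasure_restrict.2 measure_ball_lt_top.ne
  exact (memLp_three_of_integrable hf.restrict (hi _)).integrable (by norm_num)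

section

variable {E : Type*} [NormedAddCommGroup E] [NormedSpace ℝ E]

lemma eLpNorm_three_pow {E : Type*} [NormedAddCommGroup E] (f : Euc 3 → E) (μ : Measure (Euc 3)) :
    eLpNorm f 3 μ ^ 3 = ∫⁻ x, ‖f x‖ₑ ^ 3 ∂μ := by
  have := eLpNorm_nnreal_pow_eq_lintegral (f := f) (μ := μ) (p := 3) (by norm_num)
  simp only [NNReal.coe_ofNat, ENNReal.coe_ofNat] at this
  exact_mod_cast this

lemma eLpNorm_moll_le (ρ : ContDiffBump (0 : Euc 3)) {h : Euc 3 → E}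
    (hh : AEStronglyMeasurable h) (hρ : ρ.rOut ≤ 1) (R : ℝ) :
    eLpNorm (moll ρ h) 3 (volume.restrict (ball 0 R)) ≤
      eLpNorm h 3 (volume.restrict (ball 0 (R + 1))) := by
  rw [← ENNReal.pow_le_pow_left_iff (n := 3) (by norm_num), eLpNorm_three_pow, eLpNorm_three_pow]
  exact lintegral_moll_pow_le ρ hh hρ R

lemma tendsto_eLpNorm_moll [CompleteSpace E] {f : Euc 3 → E} (hf : AEStronglyMeasurable f)
    (hi : ∀ R : ℝ, IntegrableOn (fun x => ‖f x‖ ^ 3) (ball (0 : Euc 3) R)) (R : ℝ) :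
    Tendsto (fun n => eLpNorm (fun x => moll (shrinkBump n) f x - f x) 3
      (volume.restrict (ball 0 R))) atTop (𝓝 0) := by
  have hl := locallyIntegrable_of_cube hf hi
  rw [ENNReal.tendsto_nhds_zero]
  intro ε hε
  by_cases hεt : ε = ∞
  · simp [hεt]
  have hε3 : ε / 3 ≠ 0 := by simp [hε.ne']
  have hm : MemLp ((ball (0 : Euc 3) (R + 1)).indicator f) 3 := by
    rw [memLp_indicator_iff_restrict measurableSet_ball]
    exact memLp_three_of_integrable hf.restrict (hi _)
  obtain ⟨g, hgc, hgε, hgcont, -⟩ := hm.exists_hasCompactSupport_eLpNorm_sub_le (by norm_num) hε3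
  have hg1 : eLpNorm (f - g) 3 (volume.restrict (ball 0 (R + 1))) ≤ ε / 3 := by
    refine le_trans ?_ hgε
    refine le_trans (le_of_eq (eLpNorm_congr_ae ?_))
      (eLpNorm_mono_measure ((ball (0 : Euc 3) (R + 1)).indicator f - g) Measure.restrict_le_self)
    filter_upwards [ae_restrict_mem measurableSet_ball] with x hx
    simp [indicator_of_mem hx]
  have hg2 : eLpNorm (g - f) 3 (volume.restrict (ball 0 R)) ≤ ε / 3 := by
    rw [eLpNorm_sub_comm]
    exact (eLpNorm_mono_measure _ (Measure.restrict_mono (ball_subset_ball (by linarith)) le_rfl)).trans hg1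
  have hunif := tendstoUniformlyOn_moll hgcont R
  have hV : volume (ball (0 : Euc 3) R) ^ (3 : ℝ)⁻¹ ≠ ∞ :=
    ENNReal.rpow_ne_top_of_nonneg (by norm_num) measure_ball_lt_top.ne
  obtain ⟨δ, hδ, hδε⟩ : ∃ δ : ℝ, 0 < δ ∧
      volume (ball (0 : Euc 3) R) ^ (3 : ℝ)⁻¹ * ENNReal.ofReal δ ≤ ε / 3 := by
    set V := volume (ball (0 : Euc 3) R) ^ (3 : ℝ)⁻¹
    have h3 : Tendsto (fun δ : ℝ => V * ENNReal.ofReal δ) (𝓝[>] 0) (𝓝 0) := by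
      have : Tendsto (fun δ : ℝ => ENNReal.ofReal δ) (𝓝[>] 0) (𝓝 0) := by
        simpa using (ENNReal.continuous_ofReal.tendsto (0 : ℝ)).mono_left nhdsWithin_le_nhds
      simpa using ENNReal.Tendsto.const_mul this (Or.inr hV)
    have h4 := (h3.eventually (ge_mem_nhds (pos_iff_ne_zero.2 hε3))).and self_mem_nhdsWithin
    obtain ⟨δ, hδ1, hδ2⟩ := h4.exists
    exact ⟨δ, hδ2, hδ1⟩
  rw [Metric.tendstoUniformlyOn_iff] at hunif
  filter_upwards [hunif δ hδ] with n hn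
  have hsplit : (fun x => moll (shrinkBump n) f x - f x) =
      moll (shrinkBump n) (f - g) + ((moll (shrinkBump n) g - g) + (g - f)) := by
    rw [moll_sub _ hl hgcont.locallyIntegrable]
    funext x; simp
  have m1 : AEStronglyMeasurable (moll (shrinkBump n) (f - g)) (volume.restrict (ball 0 R)) :=
    ((contDiff_moll (shrinkBump n) (hl.sub hgcont.locallyIntegrable) 0).continuous).aestronglyMeasurable
  have m2 : AEStronglyMeasurable (moll (shrinkBump n) g - g) (volume.restrict (ball 0 R)) :=
    (((contDiff_moll (shrinkBump n) hgcont.locallyIntegrable 0).continuous).sub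
      hgcont).aestronglyMeasurable
  have m3 : AEStronglyMeasurable (g - f) (volume.restrict (ball 0 R)) :=
    hgcont.aestronglyMeasurable.sub hf.restrict
  have h2 : eLpNorm (moll (shrinkBump n) g - g) 3 (volume.restrict (ball 0 R)) ≤ ε / 3 := by
    refine le_trans (eLpNorm_le_of_ae_bound (C := δ) ?_) (by simpa using hδε)
    filter_upwards [ae_restrict_mem measurableSet_ball] with x hx
    have := hn x (ball_subset_closedBall hx)
    rw [dist_comm, dist_eq_norm] at this
    exact this.le
  rw [hsplit]
  calc _ ≤ ε / 3 + (ε / 3 + ε / 3) := by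
        refine (eLpNorm_add_le m1 (m2.add m3) (by norm_num)).trans (add_le_add
          ((eLpNorm_moll_le _ (hf.sub hgcont.aestronglyMeasurable) (shrinkBump_le n) R).trans hg1)
          ((eLpNorm_add_le m2 m3 (by norm_num)).trans (add_le_add h2 hg2)))
    _ = ε := by rw [← add_assoc, ENNReal.add_thirds]

end

/-- A sequence of smooth maps approximating `F` locally uniformly, and in `W^{1,3}` locally. -/
structure IsApprox (F : Euc 3 → Euc 3) (DF : Euc 3 → Euc 3 →L[ℝ] Euc 3)
    (G : ℕ → Euc 3 → Euc 3) : Prop where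
  smooth : ∀ n, ContDiff ℝ 2 (G n)
  unif : ∀ R, TendstoUniformlyOn G F atTop (closedBall 0 R)
  lim : ∀ R, Tendsto (fun n => eLpNorm (fun x => fderiv ℝ (G n) x - DF x) 3
    (volume.restrict (ball 0 R))) atTop (𝓝 0)

/-- Smooth approximation of a Sobolev map, with `0` a regular value. -/
theorem IsSobolev.exists_approx {F : Euc 3 → Euc 3} {DF : Euc 3 → Euc 3 →L[ℝ] Euc 3}
    (h : IsSobolev F DF) : ∃ G : ℕ → Euc 3 → Euc 3, IsApprox F DF G ∧
      ∀ n x, G n x = 0 → (fderiv ℝ (G n) x).det ≠ 0 := by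
  have hl := locallyIntegrable_of_cube h.meas h.int
  have hc : ∀ n, ContDiff ℝ 2 (moll (shrinkBump n) F) := fun n =>
    contDiff_moll (shrinkBump n) h.cont.locallyIntegrable 2
  have hsard : ∀ n : ℕ, ∃ c : Euc 3, ‖c‖ < 1 / (n + 1) ∧ ∀ x, moll (shrinkBump n) F x = c →
      (fderiv ℝ (moll (shrinkBump n) F) x).det ≠ 0 := fun n => by
    set G := moll (shrinkBump n) F
    have hz : volume (G '' {x | (fderiv ℝ G x).det = 0}) = 0 :=
      addHaar_image_eq_zero_of_det_fderivWithin_eq_zero volume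
        (fun x _ => ((hc n).differentiable (by norm_num) x).hasFDerivAt.hasFDerivWithinAt)
        (fun x hx => hx)
    have hne : ¬ (ball (0 : Euc 3) (1 / (n + 1)) ⊆ G '' {x | (fderiv ℝ G x).det = 0}) := fun hs => by
      have h1 := measure_mono_null hs hz
      exact (measure_ball_pos volume (0 : Euc 3) (by positivity : (0 : ℝ) < 1 / (n + 1))).ne' h1
    obtain ⟨c, hc1, hc2⟩ := not_subset.1 hne
    exact ⟨c, by simpa using hc1, fun x hx h0 => hc2 ⟨x, h0, hx⟩⟩
  choose c hc1 hc2 using hsard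
  have hd : ∀ n x, fderiv ℝ (fun x => moll (shrinkBump n) F x - c n) x =
      moll (shrinkBump n) DF x := fun n x => by
    rw [fderiv_sub_const, fderiv_moll_eq h.cont h.weak hl]
  refine ⟨fun n x => moll (shrinkBump n) F x - c n, ⟨fun n => (hc n).sub contDiff_const,
    fun R => ?_, fun R => ?_⟩, fun n x hx => ?_⟩
  · have h1 := tendstoUniformlyOn_moll h.cont R
    rw [Metric.tendstoUniformlyOn_iff] at *
    intro ε hε
    have h2 := (tendsto_one_div_add_atTop_nhds_zero_nat (𝕜 := ℝ)).eventually
      (gt_mem_nhds (half_pos hε))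
    filter_upwards [h1 (ε / 2) (half_pos hε), h2] with n hn hn2 x hx
    have h3 := hn x hx
    rw [dist_eq_norm] at *
    have : F x - (moll (shrinkBump n) F x - c n) = F x - moll (shrinkBump n) F x + c n := by abel
    rw [this]
    linarith [norm_add_le (F x - moll (shrinkBump n) F x) (c n), hc1 n]
  · simp only [hd]
    exact tendsto_eLpNorm_moll h.meas h.int R
  · rw [fderiv_sub_const]
    exact hc2 n x (sub_eq_zero.1 hx)

/-- A Sobolev map with vanishing differential is constant. -/
lemma IsSobolev.eq_of_ae_zero {F : Euc 3 → Euc 3} {DF : Euc 3 → Euc 3 →L[ℝ] Euc 3}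
    (h : IsSobolev F DF) (h0 : ∀ᵐ x, DF x = 0) (x : Euc 3) : F x = F 0 := by
  have := eq_add_of_fderiv_moll h.cont (v := x) (fun n y => by
    rw [fderiv_moll_eq h.cont h.weak (locallyIntegrable_of_cube h.meas h.int), moll_apply']
    rw [integral_eq_zero_of_ae (by filter_upwards [h0] with t ht; simp [ht])]
    rfl) 0
  simpa using this

lemma CubicLip.continuous {P : (Euc 3 →L[ℝ] Euc 3) → ℝ} (hP : CubicLip P) : Continuous P := by
  obtain ⟨C, -, -, h⟩ := hP
  rw [continuous_iff_continuousAt]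
  intro A
  rw [ContinuousAt, tendsto_iff_dist_tendsto_zero]
  have h1 : Tendsto (fun B => C * ‖B - A‖ * (1 + ‖B‖ ^ 2 + ‖A‖ ^ 2)) (𝓝 A)
      (𝓝 (C * ‖A - A‖ * (1 + ‖A‖ ^ 2 + ‖A‖ ^ 2))) :=
    Continuous.tendsto (by fun_prop) A
  rw [sub_self, norm_zero, mul_zero, zero_mul] at h1
  exact squeeze_zero (fun _ => dist_nonneg) (fun B => by rw [Real.dist_eq]; exact h B A) h1

lemma cubicLip_pointwise {a A δ : ℝ} (ha : 0 ≤ a) (hA : 0 ≤ A) (hδ : 0 < δ) (B : ℝ)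
    (hB0 : 0 ≤ B) (hB : B ≤ A + a) :
    a * (1 + B ^ 2 + A ^ 2) ≤ δ + 3 * δ * A ^ 3 + (2 + 4 / δ ^ 2) * a ^ 3 := by
  have hB2 : B ^ 2 ≤ 2 * A ^ 2 + 2 * a ^ 2 := by nlinarith [sq_nonneg (A - a)]
  have key : ∀ s : ℝ, 0 ≤ s → a * s ^ 2 ≤ δ * s ^ 3 + a ^ 3 / δ ^ 2 := fun s hs => by
    rcases le_total a (δ * s) with h | h
    · have h1 : a * s ^ 2 ≤ (δ * s) * s ^ 2 := by gcongr
      have h2 : 0 ≤ a ^ 3 / δ ^ 2 := by positivity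
      nlinarith
    · have h1 : s ≤ a / δ := by rw [le_div_iff₀ hδ]; linarith
      have h2 : a * s ^ 2 ≤ a * (a / δ) ^ 2 := by gcongr
      have h3 : a * (a / δ) ^ 2 = a ^ 3 / δ ^ 2 := by field_simp
      have h4 : 0 ≤ δ * s ^ 3 := by positivity
      linarith
  have h1 := key 1 zero_le_one
  have h2 := key A hA
  have h3 : a * (1 + B ^ 2 + A ^ 2) ≤ a * 1 ^ 2 + 3 * (a * A ^ 2) + 2 * a ^ 3 := by
    nlinarith [mul_le_mul_of_nonneg_left hB2 ha]
  calc _ ≤ _ := h3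
    _ ≤ (δ * 1 ^ 3 + a ^ 3 / δ ^ 2) + 3 * (δ * A ^ 3 + a ^ 3 / δ ^ 2) + 2 * a ^ 3 := by gcongr
    _ = _ := by ring

section

variable {P : (Euc 3 →L[ℝ] Euc 3) → ℝ} {μ : Measure (Euc 3)} [IsFiniteMeasure μ]

lemma integrable_norm_cube {μ : Measure (Euc 3)} {E : Type*} [NormedAddCommGroup E] {f : Euc 3 → E}
    (hf : MemLp f 3 μ) : Integrable (fun x => ‖f x‖ ^ 3) μ := by
  simpa using hf.integrable_norm_pow (p := 3) (by norm_num)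

lemma CubicLip.integrable (hP : CubicLip P) {A : Euc 3 → Euc 3 →L[ℝ] Euc 3} (hA : MemLp A 3 μ) :
    Integrable (fun x => P (A x)) μ := by
  obtain ⟨C, hC, h0, h⟩ := id hP
  refine Integrable.mono' (g := fun x => C * (1 + 6 * ‖A x‖ ^ 3))
    (((integrable_const _).add ((integrable_norm_cube hA).const_mul 6)).const_mul C)
    (hP.continuous.comp_aestronglyMeasurable hA.1) (ae_of_all _ fun x => ?_)
  have h1 := h (A x) 0
  rw [h0, sub_zero, sub_zero, norm_zero, mul_assoc] at h1
  refine h1.trans ?_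
  gcongr
  have := cubicLip_pointwise (norm_nonneg (A x)) le_rfl one_pos ‖A x‖ (norm_nonneg _) (by simp)
  norm_num at this ⊢
  linarith

lemma CubicLip.tendsto_integral_abs (hP : CubicLip P) {A : ℕ → Euc 3 → Euc 3 →L[ℝ] Euc 3}
    {A' : Euc 3 → Euc 3 →L[ℝ] Euc 3} (hA : ∀ n, MemLp (A n) 3 μ) (hA' : MemLp A' 3 μ)
    (hlim : Tendsto (fun n => eLpNorm (fun x => A n x - A' x) 3 μ) atTop (𝓝 0)) :
    Tendsto (fun n => ∫ x, |P (A n x) - P (A' x)| ∂μ) atTop (𝓝 0) := by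
  obtain ⟨C, hC, h0, h⟩ := id hP
  have hlim3 : Tendsto (fun n => ∫ x, ‖A n x - A' x‖ ^ 3 ∂μ) atTop (𝓝 0) := by
    have h1 : ∀ n, ∫ x, ‖A n x - A' x‖ ^ 3 ∂μ = (eLpNorm (fun x => A n x - A' x) 3 μ ^ 3).toReal :=
      fun n => by
        rw [eLpNorm_three_pow, integral_eq_lintegral_of_nonneg_ae (ae_of_all _ fun x => by positivity)
          (by exact (integrable_norm_cube ((hA n).sub hA')).1)]
        congr 1
        refine lintegral_congr fun x => ?_
        rw [ENNReal.ofReal_pow (norm_nonneg _), ofReal_norm]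
    simp only [h1]
    have h2 := ENNReal.Tendsto.pow (n := 3) hlim
    rw [zero_pow (by norm_num)] at h2
    exact (ENNReal.tendsto_toReal ENNReal.zero_ne_top).comp h2
  have hb : ∀ δ : ℝ, 0 < δ → ∀ n, ∫ x, |P (A n x) - P (A' x)| ∂μ ≤
      C * δ * (∫ x, (1 + 3 * ‖A' x‖ ^ 3) ∂μ) + C * (2 + 4 / δ ^ 2) * ∫ x, ‖A n x - A' x‖ ^ 3 ∂μ := by
    intro δ hδ n
    have i1 : Integrable (fun x => 1 + 3 * ‖A' x‖ ^ 3) μ :=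
      (integrable_const _).add ((integrable_norm_cube hA').const_mul 3)
    have i2 : Integrable (fun x => ‖A n x - A' x‖ ^ 3) μ := integrable_norm_cube ((hA n).sub hA')
    rw [← integral_const_mul, ← integral_const_mul,
      ← integral_add (i1.const_mul _) (i2.const_mul _)]
    refine integral_mono_of_nonneg (ae_of_all _ fun x => abs_nonneg _)
      ((i1.const_mul _).add (i2.const_mul _)) (ae_of_all _ fun x => ?_)
    refine (h _ _).trans ?_
    have := cubicLip_pointwise (norm_nonneg (A n x - A' x)) (norm_nonneg (A' x)) hδ ‖A n x‖
      (norm_nonneg _) (norm_le_norm_add_norm_sub' _ _)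
    calc _ = C * (‖A n x - A' x‖ * (1 + ‖A n x‖ ^ 2 + ‖A' x‖ ^ 2)) := by ring
      _ ≤ _ := mul_le_mul_of_nonneg_left this hC
      _ = _ := by ring
  rw [Metric.tendsto_atTop']
  intro ε hε
  set M := ∫ x, (1 + 3 * ‖A' x‖ ^ 3) ∂μ with hM
  have hM0 : 0 ≤ M := integral_nonneg fun x => by positivity
  set δ := ε / (2 * (C * M + 1)) with hδ
  have hCM : 0 ≤ C * M := mul_nonneg hC hM0
  have hδ0 : 0 < δ := by positivity
  have hδ2 : C * δ * M ≤ ε / 2 := by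
    rw [hδ]
    calc C * (ε / (2 * (C * M + 1))) * M = (C * M / (C * M + 1)) * (ε / 2) := by field_simp
      _ ≤ 1 * (ε / 2) := by
        gcongr
        rw [div_le_one (by positivity)]; linarith
      _ = _ := one_mul _
  have h3 := (hlim3.const_mul (C * (2 + 4 / δ ^ 2)))
  rw [mul_zero] at h3
  obtain ⟨N, hN⟩ := eventually_atTop.1 (h3.eventually (gt_mem_nhds (half_pos hε)))
  refine ⟨N, fun n hn => ?_⟩
  rw [Real.dist_eq, sub_zero, abs_of_nonneg (integral_nonneg fun x => abs_nonneg _)]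
  linarith [hb δ hδ0 n, hN n hn.le]

/-- Passage to the limit in integrals of cubic expressions in the differential. -/
lemma CubicLip.tendsto_integral (hP : CubicLip P) {A : ℕ → Euc 3 → Euc 3 →L[ℝ] Euc 3}
    {A' : Euc 3 → Euc 3 →L[ℝ] Euc 3} (hA : ∀ n, MemLp (A n) 3 μ) (hA' : MemLp A' 3 μ)
    (hlim : Tendsto (fun n => eLpNorm (fun x => A n x - A' x) 3 μ) atTop (𝓝 0))
    {h : ℕ → Euc 3 → ℝ} {h' : Euc 3 → ℝ} (hm : ∀ n, AEStronglyMeasurable (h n) μ) {M : ℝ}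
    (hM : ∀ᶠ n in atTop, ∀ᵐ x ∂μ, |h n x| ≤ M)
    (hh : ∀ᵐ x ∂μ, Tendsto (fun n => h n x) atTop (𝓝 (h' x))) :
    Integrable (fun x => h' x * P (A' x)) μ ∧
    Tendsto (fun n => ∫ x, h n x * P (A n x) ∂μ) atTop (𝓝 (∫ x, h' x * P (A' x) ∂μ)) := by
  have iA' := hP.integrable hA'
  have iA := fun n => hP.integrable (hA n)
  have m' : AEStronglyMeasurable h' μ := aestronglyMeasurable_of_tendsto_ae atTop hm hh
  have hM' : ∀ᵐ x ∂μ, |h' x| ≤ M := by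
    obtain ⟨N, hN⟩ := eventually_atTop.1 hM
    have hN' : ∀ᵐ x ∂μ, ∀ n, N ≤ n → |h n x| ≤ M := by
      rw [ae_all_iff]; intro n
      by_cases hn : N ≤ n
      · filter_upwards [hN n hn] with x hx _ using hx
      · exact ae_of_all _ fun x h => absurd h hn
    filter_upwards [hN', hh] with x h1 h2
    exact le_of_tendsto h2.abs (eventually_atTop.2 ⟨N, h1⟩)
  have i' : Integrable (fun x => h' x * P (A' x)) μ := iA'.bdd_mul m' hM'
  refine ⟨i', ?_⟩
  have hdct : Tendsto (fun n => ∫ x, h n x * P (A' x) ∂μ) atTop (𝓝 (∫ x, h' x * P (A' x) ∂μ)) := by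
    refine tendsto_integral_filter_of_dominated_convergence (fun x => M * |P (A' x)|)
      (Eventually.of_forall fun n => (hm n).mul iA'.1) ?_ (iA'.abs.const_mul M) ?_
    · filter_upwards [hM] with n hn
      filter_upwards [hn] with x hx
      rw [Real.norm_eq_abs, abs_mul]; gcongr
    · filter_upwards [hh] with x hx using hx.mul_const _
  have hdiff : Tendsto (fun n => ∫ x, h n x * P (A n x) ∂μ - ∫ x, h n x * P (A' x) ∂μ) atTop (𝓝 0) := by
    have h1 := (hP.tendsto_integral_abs hA hA' hlim).const_mul M
    rw [mul_zero] at h1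
    refine squeeze_zero_norm' ?_ h1
    filter_upwards [hM] with n hn
    have j1 : Integrable (fun x => h n x * P (A n x)) μ := (iA n).bdd_mul (hm n) hn
    have j2 : Integrable (fun x => h n x * P (A' x)) μ := iA'.bdd_mul (hm n) hn
    rw [← integral_sub j1 j2, ← integral_const_mul]
    refine norm_integral_le_of_norm_le (((iA n).sub iA').abs.const_mul M) ?_
    filter_upwards [hn] with x hx
    rw [← mul_sub, Real.norm_eq_abs, abs_mul]
    gcongr
  simpa using hdiff.add hdct

end

section

variable {F : Euc 3 → Euc 3} {DF : Euc 3 → Euc 3 →L[ℝ] Euc 3} {G : ℕ → Euc 3 → Euc 3}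

lemma continuous_mul_comp_of_tsupport {θ : Euc 3 → ℝ} (hθ : Continuous θ) {H : Euc 3 → Euc 3}
    (hH : Continuous H) {U : Set (Euc 3)} (hU : IsOpen U) {W : Euc 3 → ℝ} (hW : ContinuousOn W U)
    (hs : ∀ x ∈ tsupport θ, H x ∈ U) : Continuous fun x => θ x * W (H x) := by
  rw [continuous_iff_continuousAt]
  intro x
  by_cases hx : x ∈ tsupport θ
  · exact hθ.continuousAt.mul
      (ContinuousAt.comp (hW.continuousAt (hU.mem_nhds (hs x hx))) hH.continuousAt)
  · have : (fun x => θ x * W (H x)) =ᶠ[𝓝 x] fun _ => 0 := by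
      filter_upwards [notMem_tsupport_iff_eventuallyEq.1 hx] with y hy
      simp [hy]
    exact continuousAt_const.congr this.symm

lemma IsApprox.tendsto_apply (hG : IsApprox F DF G) (x : Euc 3) :
    Tendsto (fun n => G n x) atTop (𝓝 (F x)) :=
  (hG.unif ‖x‖).tendsto_at (by simp)

lemma IsApprox.exists_compact (hF : Continuous F) (hG : IsApprox F DF G) {S : Set (Euc 3)}
    (hS : IsCompact S) {U : Set (Euc 3)} (hU : IsOpen U) (hSU : ∀ x ∈ S, F x ∈ U) :
    ∃ K, IsCompact K ∧ K ⊆ U ∧ ∀ᶠ n in atTop, ∀ x ∈ S, G n x ∈ K := by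
  obtain ⟨δ, hδ, hδU⟩ := (hS.image hF).exists_cthickening_subset_open hU (image_subset_iff.2 hSU)
  refine ⟨cthickening δ (F '' S), (hS.image hF).cthickening, hδU, ?_⟩
  obtain ⟨R, hR⟩ := hS.isBounded.subset_closedBall 0
  have := hG.unif R
  rw [Metric.tendstoUniformlyOn_iff] at this
  filter_upwards [this δ hδ] with n hn x hx
  refine mem_cthickening_of_dist_le (G n x) (F x) δ _ (mem_image_of_mem F hx) ?_
  rw [dist_comm]
  exact (hn x (hR hx)).le

lemma memLp_ball_of_continuous {E : Type*} [NormedAddCommGroup E] {f : Euc 3 → E}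
    (hf : Continuous f) (R : ℝ) : MemLp f 3 (volume.restrict (ball 0 R)) := by
  have : IsFiniteMeasure (volume.restrict (ball (0 : Euc 3) R)) :=
    isFiniteMeasure_restrict.2 measure_ball_lt_top.ne
  obtain ⟨C, hC⟩ := (isCompact_closedBall (0 : Euc 3) R).exists_bound_of_continuousOn hf.continuousOn
  refine MemLp.of_bound hf.aestronglyMeasurable C ?_
  filter_upwards [ae_restrict_mem measurableSet_ball] with x hx using hC x (ball_subset_closedBall hx)

lemma IsSobolev.memLp (h : IsSobolev F DF) (R : ℝ) : MemLp DF 3 (volume.restrict (ball 0 R)) :=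
  memLp_three_of_integrable h.meas.restrict (h.int R)

/-- Passage to the limit along smooth approximations of a Sobolev map. -/
lemma IsSobolev.tendsto_integral (h : IsSobolev F DF) (hG : IsApprox F DF G)
    {P : (Euc 3 →L[ℝ] Euc 3) → ℝ} (hP : CubicLip P) {θ : Euc 3 → ℝ} (hθ : Continuous θ)
    (hc : HasCompactSupport θ) {U : Set (Euc 3)} (hU : IsOpen U) {W : Euc 3 → ℝ}
    (hW : ContinuousOn W U) (hs : ∀ x ∈ tsupport θ, F x ∈ U) :
    Integrable (fun x => θ x * W (F x) * P (DF x)) ∧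
    Tendsto (fun n => ∫ x, θ x * W (G n x) * P (fderiv ℝ (G n) x)) atTop
      (𝓝 (∫ x, θ x * W (F x) * P (DF x))) := by
  obtain ⟨K, hK, hKU, hev⟩ := hG.exists_compact h.cont hc hU hs
  obtain ⟨N, hN⟩ := eventually_atTop.1 hev
  obtain ⟨C, hC⟩ := hK.exists_bound_of_continuousOn (hW.mono hKU)
  obtain ⟨B, hB⟩ := hc.exists_bound_of_continuous hθ
  obtain ⟨R, hR⟩ := hc.isBounded.subset_ball 0
  have : IsFiniteMeasure (volume.restrict (ball (0 : Euc 3) R)) :=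
    isFiniteMeasure_restrict.2 measure_ball_lt_top.ne
  have hz : ∀ x, x ∉ ball (0 : Euc 3) R → θ x = 0 := fun x hx =>
    image_eq_zero_of_notMem_tsupport fun h' => hx (hR h')
  have key := hP.tendsto_integral (μ := volume.restrict (ball (0 : Euc 3) R))
    (A := fun n => fderiv ℝ (G (n + N))) (A' := DF)
    (fun n => memLp_ball_of_continuous ((hG.smooth _).continuous_fderiv (by norm_num)) R) (h.memLp R)
    ((hG.lim R).comp (tendsto_add_atTop_nat N))
    (h := fun n x => θ x * W (G (n + N) x)) (h' := fun x => θ x * W (F x)) (M := B * max C 0)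
    (fun n => (continuous_mul_comp_of_tsupport hθ (hG.smooth _).continuous hU hW
      fun x hx => hKU (hN _ (by simp) x hx)).aestronglyMeasurable)
    (Eventually.of_forall fun n => ae_of_all _ fun x => by
      rw [abs_mul]
      have hB0 : 0 ≤ B := (norm_nonneg _).trans (hB x)
      by_cases hx : x ∈ tsupport θ
      · have := (hC _ (hN (n + N) (by simp) x hx)).trans (le_max_left C 0)
        gcongr
        exacts [hB x, this]
      · rw [image_eq_zero_of_notMem_tsupport hx, abs_zero, zero_mul]
        positivity)
    (ae_of_all _ fun x => by
      by_cases hx : x ∈ tsupport θ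
      · exact (((hW.continuousAt (hU.mem_nhds (hs x hx))).tendsto.comp
          ((hG.tendsto_apply x).comp (tendsto_add_atTop_nat N))).const_mul _)
      · simp [image_eq_zero_of_notMem_tsupport hx])
  have hI : ∀ (H : Euc 3 → Euc 3) (D : Euc 3 → Euc 3 →L[ℝ] Euc 3),
      ∫ x in ball 0 R, θ x * W (H x) * P (D x) = ∫ x, θ x * W (H x) * P (D x) := fun H D =>
    setIntegral_eq_integral_of_forall_compl_eq_zero fun x hx => by rw [hz x hx]; ring
  refine ⟨(integrableOn_iff_integrable_of_support_subset fun x hx => ?_).1 key.1, ?_⟩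
  · by_contra h'
    exact hx (by simp [hz x h'])
  · have h2 := key.2
    simp only [hI] at h2
    exact (tendsto_add_atTop_iff_nat N).1 h2

lemma adjPair_eq_sum (A : Euc 3 →L[ℝ] Euc 3) (ξ : Euc 3 →L[ℝ] ℝ) (v : Euc 3) :
    adjPair A ξ v = ∑ i, ∑ j, ξ (stdVec j) * v i * cofactor A i j := rfl

lemma IsSobolev.tendsto_adjPair (h : IsSobolev F DF) (hG : IsApprox F DF G) {η : Euc 3 → ℝ}
    (hη : ContDiff ℝ 1 η) (hc : HasCompactSupport η) {U : Set (Euc 3)} (hU : IsOpen U)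
    {V : Euc 3 → Euc 3} (hV : ContinuousOn V U)
    (hs : ∀ x ∈ tsupport (fderiv ℝ η), F x ∈ U) :
    Integrable (fun x => adjPair (DF x) (fderiv ℝ η x) (V (F x))) ∧
    Tendsto (fun n => ∫ x, adjPair (fderiv ℝ (G n) x) (fderiv ℝ η x) (V (G n x))) atTop
      (𝓝 (∫ x, adjPair (DF x) (fderiv ℝ η x) (V (F x)))) := by
  have hVi : ∀ i, ContinuousOn (fun y => V y i) U := fun i =>
    (EuclideanSpace.proj (𝕜 := ℝ) i).continuous.comp_continuousOn hV
  have hd : ∀ j, Continuous fun x => fderiv ℝ η x (stdVec j) := fun j =>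
    (hη.continuous_fderiv (by norm_num)).clm_apply continuous_const
  have hdc : ∀ j, HasCompactSupport fun x => fderiv ℝ η x (stdVec j) := fun j =>
    hc.fderiv_apply (𝕜 := ℝ) _
  have hsub : ∀ j, tsupport (fun x => fderiv ℝ η x (stdVec j)) ⊆ tsupport (fderiv ℝ η) := fun j =>
    closure_mono fun x hx h' => hx (by simp [h'])
  have hds : ∀ j, ∀ x ∈ tsupport (fun x => fderiv ℝ η x (stdVec j)), F x ∈ U := fun j x hx =>
    hs x (hsub j hx)
  have key := fun i j => h.tendsto_integral hG (cubicLip_cofactor i j) (hd j) (hdc j) hU (hVi i)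
    (hds j)
  obtain ⟨K, hK, hKU, hev⟩ := hG.exists_compact h.cont (hc.fderiv (𝕜 := ℝ)) hU hs
  have hint : ∀ᶠ n in atTop, ∀ i j, Integrable fun x =>
      fderiv ℝ η x (stdVec j) * V (G n x) i * cofactor (fderiv ℝ (G n) x) i j := by
    filter_upwards [hev] with n hn i j
    refine Continuous.integrable_of_hasCompactSupport ?_ ?_
    · refine (continuous_mul_comp_of_tsupport (hd j) (hG.smooth n).continuous hU (hVi i)
        fun x hx => hKU (hn x (hsub j hx))).mul ?_
      exact (cubicLip_cofactor i j).continuous.comp ((hG.smooth n).continuous_fderiv (by norm_num))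
    · exact ((hdc j).mul_right).mul_right
  simp only [adjPair_eq_sum]
  refine ⟨integrable_finsetSum _ fun i _ => integrable_finsetSum _ fun j _ => (key i j).1, ?_⟩
  rw [integral_finsetSum _ fun i _ => integrable_finsetSum _ fun j _ => (key i j).1]
  have h3 : Tendsto (fun n => ∑ i : Fin 3, ∑ j : Fin 3, ∫ x,
      fderiv ℝ η x (stdVec j) * V (G n x) i * cofactor (fderiv ℝ (G n) x) i j) atTop
      (𝓝 (∑ i : Fin 3, ∫ x, ∑ j : Fin 3,
        fderiv ℝ η x (stdVec j) * V (F x) i * cofactor (DF x) i j)) := by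
    refine tendsto_finsetSum _ fun i _ => ?_
    rw [integral_finsetSum _ fun j _ => (key i j).1]
    exact tendsto_finsetSum _ fun j _ => (key i j).2
  refine h3.congr' ?_
  filter_upwards [hint] with n hn
  rw [integral_finsetSum _ fun i _ => integrable_finsetSum _ fun j _ => hn i j]
  exact Finset.sum_congr rfl fun i _ => (integral_finsetSum _ fun j _ => hn i j).symm

lemma continuousOn_divg {V : Euc 3 → Euc 3} {U : Set (Euc 3)} (hU : IsOpen U)
    (hV : ContDiffOn ℝ 1 V U) : ContinuousOn (divg V) U := by
  have h1 := hV.continuousOn_fderiv_of_isOpen hU le_rfl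
  unfold divg
  refine continuousOn_finsetSum _ fun i _ => ?_
  exact (EuclideanSpace.proj (𝕜 := ℝ) i).continuous.comp_continuousOn
    (h1.clm_apply continuousOn_const)

/-- The pullback of a divergence by a Sobolev map. -/
theorem IsSobolev.integral_pull (h : IsSobolev F DF) {η : Euc 3 → ℝ}
    (hη : ContDiff ℝ 1 η) (hc : HasCompactSupport η) {U : Set (Euc 3)} (hU : IsOpen U)
    {V : Euc 3 → Euc 3} (hV : ContDiffOn ℝ 1 V U) (hs : ∀ x ∈ tsupport η, F x ∈ U) :
    Integrable (fun x => η x * divg V (F x) * (DF x).det) ∧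
    Integrable (fun x => adjPair (DF x) (fderiv ℝ η x) (V (F x))) ∧
    ∫ x, η x * divg V (F x) * (DF x).det =
      - ∫ x, adjPair (DF x) (fderiv ℝ η x) (V (F x)) := by
  obtain ⟨G, hG, -⟩ := h.exists_approx
  have hW := continuousOn_divg hU hV
  have h1 := h.tendsto_integral hG cubicLip_det hη.continuous hc hU hW hs
  have h2 := h.tendsto_adjPair hG hη hc hU hV.continuousOn
    fun x hx => hs x (tsupport_fderiv_subset ℝ hx)
  refine ⟨h1.1, h2.1, tendsto_nhds_unique h1.2 (h2.2.neg.congr' ?_)⟩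
  obtain ⟨K, hK, hKU, hev⟩ := hG.exists_compact h.cont hc hU hs
  filter_upwards [hev] with n hn
  have hnU : ∀ x ∈ tsupport η, G n x ∈ U := fun x hx => hKU (hn x hx)
  obtain ⟨i1, i2⟩ := integral_pull_smooth (hG.smooth n) hη hc hU hV hnU
  have i3 : Integrable fun x => η x * divg V (G n x) * (fderiv ℝ (G n) x).det := by
    refine Continuous.integrable_of_hasCompactSupport ?_ hc.mul_right.mul_right
    exact (continuous_mul_comp_of_tsupport hη.continuous (hG.smooth n).continuous hU hW hnU).mul
      (cubicLip_det.continuous.comp ((hG.smooth n).continuous_fderiv (by norm_num)))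
  have i4 : ∫ x, adjPair (fderiv ℝ (G n) x) (fderiv ℝ η x) (V (G n x)) =
      ∫ x, (pullIntegrand (G n) (fderiv ℝ (G n)) η V x
        - η x * divg V (G n x) * (fderiv ℝ (G n) x).det) :=
    integral_congr_ae (ae_of_all _ fun x => by simp [pullIntegrand])
  rw [i4, integral_sub i1 i3, i2]
  ring

end

section
variable {F : Euc 3 → Euc 3} {DF : Euc 3 → Euc 3 →L[ℝ] Euc 3} {G : ℕ → Euc 3 → Euc 3}

/-- The radial field `h(y) |y|⁻³ y`. -/
def radialField (h : Euc 3 → ℝ) (y : Euc 3) : Euc 3 := (h y * (‖y‖ ^ 3)⁻¹) • y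

lemma adjPair_smul (A : Euc 3 →L[ℝ] Euc 3) (ξ : Euc 3 →L[ℝ] ℝ) (t : ℝ) (v : Euc 3) :
    adjPair A ξ (t • v) = t * adjPair A ξ v := by
  simp only [adjPair_eq_sum, Finset.mul_sum, PiLp.smul_apply, smul_eq_mul]
  exact Finset.sum_congr rfl fun i _ => Finset.sum_congr rfl fun j _ => by ring

lemma hasFDerivAt_norm_cube_inv {y : Euc 3} (hy : y ≠ 0) :
    ∃ L : Euc 3 →L[ℝ] ℝ, HasFDerivAt (fun y : Euc 3 => (‖y‖ ^ 3)⁻¹) L y ∧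
      L y = -3 * (‖y‖ ^ 3)⁻¹ := by
  have hd : DifferentiableAt ℝ (fun y : Euc 3 => (‖y‖ ^ 3)⁻¹) y :=
    ((differentiableAt_id.norm ℝ hy).pow 3).inv (by simpa using hy)
  refine ⟨_, hd.hasFDerivAt, ?_⟩
  have h1 : HasDerivAt (fun t : ℝ => t • y) y 1 := by simpa using (hasDerivAt_id (1 : ℝ)).smul_const y
  have h2 : HasDerivAt (fun t : ℝ => (‖t • y‖ ^ 3)⁻¹) (fderiv ℝ (fun y : Euc 3 => (‖y‖ ^ 3)⁻¹) y y) 1 :=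
    HasFDerivAt.comp_hasDerivAt_of_eq (1 : ℝ) hd.hasFDerivAt h1 (by simp)
  have h3 : HasDerivAt (fun t : ℝ => (t ^ 3)⁻¹ * (‖y‖ ^ 3)⁻¹) (-3 * (‖y‖ ^ 3)⁻¹) 1 := by
    have := ((hasDerivAt_pow 3 (1 : ℝ)).fun_inv (by norm_num)).mul_const ((‖y‖ ^ 3)⁻¹)
    norm_num at this ⊢
    exact this
  have h4 : (fun t : ℝ => (‖t • y‖ ^ 3)⁻¹) =ᶠ[𝓝 1] fun t : ℝ => (t ^ 3)⁻¹ * (‖y‖ ^ 3)⁻¹ := by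
    filter_upwards [lt_mem_nhds one_pos] with t ht
    rw [norm_smul, Real.norm_of_nonneg ht.le, mul_pow, mul_inv]
  exact h2.unique (h3.congr_of_eventuallyEq h4)

lemma divg_smul_id {f : Euc 3 → ℝ} {L : Euc 3 →L[ℝ] ℝ} {y : Euc 3} (hf : HasFDerivAt f L y) :
    divg (fun y => f y • y) y = L y + 3 * f y := by
  have h := (hf.fun_smul (hasFDerivAt_id y)).fderiv
  simp only [id] at h
  unfold divg
  rw [h, covector_apply L y]
  simp only [entry, Fin.sum_univ_three, stdVec]
  simp
  ring

lemma divg_radialField {h : Euc 3 → ℝ} {y : Euc 3} (hy : y ≠ 0) (hh : DifferentiableAt ℝ h y) :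
    divg (radialField h) y = fderiv ℝ h y y * (‖y‖ ^ 3)⁻¹ := by
  obtain ⟨L, hL, hLy⟩ := hasFDerivAt_norm_cube_inv hy
  unfold radialField
  rw [divg_smul_id (hh.hasFDerivAt.fun_mul hL)]
  simp [hLy]
  ring

lemma contDiffOn_radialField {h : Euc 3 → ℝ} {U : Set (Euc 3)} (hU : IsOpen U)
    (hh : ContDiffOn ℝ 1 h (U \ {0})) (h0 : 0 ∈ U → ∀ᶠ y in 𝓝[≠] 0, h y = 0) :
    ContDiffOn ℝ 1 (radialField h) U ∧
      ∀ y ∈ U, divg (radialField h) y = fderiv ℝ h y y * (‖y‖ ^ 3)⁻¹ := by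
  have hz : 0 ∈ U → radialField h =ᶠ[𝓝 0] fun _ => 0 := fun hU0 => by
    have := h0 hU0
    rw [eventually_nhdsWithin_iff] at this
    filter_upwards [this] with y hy
    by_cases hy0 : y = 0
    · simp [radialField, hy0]
    · simp [radialField, hy hy0]
  have hat : ∀ y ∈ U, y ≠ 0 → ContDiffAt ℝ 1 h y := fun y hy hy0 =>
    hh.contDiffAt ((hU.sdiff isClosed_singleton).mem_nhds ⟨hy, hy0⟩)
  refine ⟨fun y hy => ContDiffAt.contDiffWithinAt ?_, fun y hy => ?_⟩
  · by_cases hy0 : y = 0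
    · subst hy0
      exact (contDiffAt_const (c := (0 : Euc 3))).congr_of_eventuallyEq (hz hy)
    · have hn : ContDiffAt ℝ 1 (fun z : Euc 3 => (‖z‖ ^ 3)⁻¹) y :=
        ContDiffAt.inv ((ContDiffAt.norm ℝ contDiffAt_id hy0).pow 3) (by simpa using hy0)
      exact ((hat y hy hy0).mul hn).smul contDiffAt_id
  · by_cases hy0 : y = 0
    · subst hy0
      have := (hz hy).fderiv_eq (𝕜 := ℝ)
      simp [divg, this, entry]
    · exact divg_radialField hy0 ((hat y hy hy0).differentiableAt one_ne_zero)

/-- The pullback of the divergence of a radial field. -/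
theorem IsSobolev.integral_radial (h : IsSobolev F DF) {η : Euc 3 → ℝ}
    (hη : ContDiff ℝ 1 η) (hc : HasCompactSupport η) {U : Set (Euc 3)} (hU : IsOpen U)
    {g : Euc 3 → ℝ} (hg : ContDiffOn ℝ 1 g (U \ {0})) (g0 : 0 ∈ U → ∀ᶠ y in 𝓝[≠] 0, g y = 0)
    (hs : ∀ x ∈ tsupport η, F x ∈ U) :
    Integrable (fun x => η x * (fderiv ℝ g (F x) (F x) * (‖F x‖ ^ 3)⁻¹) * (DF x).det) ∧
    Integrable (fun x => g (F x) * (‖F x‖ ^ 3)⁻¹ * adjPair (DF x) (fderiv ℝ η x) (F x)) ∧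
    ∫ x, η x * (fderiv ℝ g (F x) (F x) * (‖F x‖ ^ 3)⁻¹) * (DF x).det =
      - ∫ x, g (F x) * (‖F x‖ ^ 3)⁻¹ * adjPair (DF x) (fderiv ℝ η x) (F x) := by
  obtain ⟨hV, hd⟩ := contDiffOn_radialField hU hg g0
  have key := h.integral_pull hη hc hU hV hs
  have e1 : (fun x => η x * divg (radialField g) (F x) * (DF x).det) =
      fun x => η x * (fderiv ℝ g (F x) (F x) * (‖F x‖ ^ 3)⁻¹) * (DF x).det := by
    ext x
    by_cases hx : x ∈ tsupport η
    · rw [hd _ (hs x hx)]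
    · simp [image_eq_zero_of_notMem_tsupport hx]
  have e2 : (fun x => adjPair (DF x) (fderiv ℝ η x) (radialField g (F x))) =
      fun x => g (F x) * (‖F x‖ ^ 3)⁻¹ * adjPair (DF x) (fderiv ℝ η x) (F x) := by
    ext x
    rw [radialField, adjPair_smul]
  rwa [e1, e2] at key

end

section

variable {g k : ℝ → ℝ}

lemma contDiffOn_comp_log_norm (hg : ContDiff ℝ 1 g) {U : Set (Euc 3)} :
    ContDiffOn ℝ 1 (fun y : Euc 3 => g (Real.log ‖y‖)) (U \ {0}) := fun y hy => by
  have hy0 : y ≠ 0 := fun h => hy.2 (by simp [h])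
  exact (hg.contDiffAt.comp y ((contDiffAt_id.norm ℝ hy0).log (by simpa using hy0))).contDiffWithinAt

lemma fderiv_comp_log_norm (hg : ∀ s, HasDerivAt g (k s) s) {y : Euc 3} (hy : y ≠ 0) :
    fderiv ℝ (fun y : Euc 3 => g (Real.log ‖y‖)) y =
      (k (Real.log ‖y‖) * (‖y‖ ^ 2)⁻¹) • innerSL ℝ y := by
  have hyn : ‖y‖ ≠ 0 := by simpa using hy
  have h1 : HasFDerivAt (fun y : Euc 3 => ‖y‖ ^ 2) ((2 : ℝ) • innerSL ℝ y) y := by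
    simpa [two_smul] using (hasStrictFDerivAt_norm_sq y).hasFDerivAt
  have h2 := ((hg (Real.log ‖y‖)).comp_hasFDerivAt_of_eq y
    ((h1.log (pow_ne_zero 2 hyn)).const_mul (1 / 2 : ℝ)) (by rw [Real.log_pow]; push_cast; ring))
  have h3 : (g ∘ fun y : Euc 3 => 1 / 2 * Real.log (‖y‖ ^ 2)) = fun y => g (Real.log ‖y‖) := by
    ext z
    simp only [Function.comp, Real.log_pow]
    congr 1
    push_cast
    ring
  rw [h3] at h2
  rw [h2.fderiv]
  ext z
  simp
  ring

lemma norm_fderiv_comp_log_norm (hg : ∀ s, HasDerivAt g (k s) s) {y : Euc 3} (hy : y ≠ 0) :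
    ‖fderiv ℝ (fun y : Euc 3 => g (Real.log ‖y‖)) y‖ = |k (Real.log ‖y‖)| * ‖y‖⁻¹ := by
  have hyn : ‖y‖ ≠ 0 := by simpa using hy
  rw [fderiv_comp_log_norm hg hy, norm_smul, innerSL_apply_norm, norm_mul, Real.norm_eq_abs]
  simp
  field_simp

lemma fderiv_comp_log_norm_self (hg : ∀ s, HasDerivAt g (k s) s) {y : Euc 3} (hy : y ≠ 0) :
    fderiv ℝ (fun y : Euc 3 => g (Real.log ‖y‖)) y y = k (Real.log ‖y‖) := by
  have hyn : ‖y‖ ≠ 0 := by simpa using hy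
  rw [fderiv_comp_log_norm hg hy]
  simp
  field_simp

/-- Primitive of a continuous function. -/
lemma exists_primitive (hk : Continuous k) (a : ℝ) :
    ContDiff ℝ 1 (fun s => ∫ u in a..s, k u) ∧
      ∀ s, HasDerivAt (fun s => ∫ u in a..s, k u) (k s) s := by
  have hd : ∀ s, HasDerivAt (fun s => ∫ u in a..s, k u) (k s) s := fun s =>
    intervalIntegral.integral_hasDerivAt_right (hk.intervalIntegrable _ _)
      (hk.stronglyMeasurableAtFilter _ _) hk.continuousAt
  refine ⟨contDiff_one_iff_deriv.2 ⟨fun s => (hd s).differentiableAt, ?_⟩, hd⟩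
  rwa [show deriv (fun s => ∫ u in a..s, k u) = k from funext fun s => (hd s).deriv]

lemma primitive_eq_zero {a b : ℝ} (hs : ∀ s, s ∉ Icc a b → k s = 0) {s : ℝ}
    (h : s ≤ a) : ∫ u in a..s, k u = 0 := by
  rw [intervalIntegral.integral_symm, intervalIntegral.integral_of_le h,
    integral_Ioc_eq_integral_Ioo,
    setIntegral_eq_zero_of_forall_eq_zero fun u hu => hs u fun h' => hu.2.not_ge h'.1, neg_zero]

lemma primitive_eq_integral {a b : ℝ} (hs : ∀ s, s ∉ Icc a b → k s = 0) {s : ℝ}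
    (hab : a ≤ s) (h : b ≤ s) : ∫ u in a..s, k u = ∫ u, k u := by
  rw [intervalIntegral.integral_of_le hab, ← integral_Icc_eq_integral_Ioc]
  exact setIntegral_eq_integral_of_forall_compl_eq_zero fun u hu => hs u fun h' =>
    hu ⟨h'.1, h'.2.trans h⟩

end

/-- The area of the unit sphere. -/
def sphereArea : ℝ := 3 * (volume : Measure (Euc 3)).real (ball 0 1)

lemma sphereArea_pos : 0 < sphereArea := by
  have : 0 < (volume : Measure (Euc 3)).real (ball 0 1) :=
    ENNReal.toReal_pos (measure_ball_pos _ _ one_pos).ne' measure_ball_lt_top.ne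
  unfold sphereArea
  positivity

lemma integral_comp_log_norm (k : ℝ → ℝ) :
    ∫ x : Euc 3, k (Real.log ‖x‖) * (‖x‖ ^ 3)⁻¹ = sphereArea * ∫ s, k s := by
  have h := integral_fun_norm_addHaar (volume : Measure (Euc 3))
    (fun r => k (Real.log r) * (r ^ 3)⁻¹)
  have h2 := integral_image_eq_integral_abs_deriv_smul MeasurableSet.univ
    (fun s _ => (Real.hasDerivAt_exp s).hasDerivWithinAt) Real.exp_injective.injOn
    (fun r : ℝ => r ^ 2 • (k (Real.log r) * (r ^ 3)⁻¹))
  rw [image_univ, Real.range_exp] at h2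
  rw [h]
  simp only [finrank_euclideanSpace, Fintype.card_fin, Nat.add_one_sub_one, smul_eq_mul,
    nsmul_eq_mul] at h2 ⊢
  rw [h2, setIntegral_univ, sphereArea]
  have : ∀ s : ℝ, |Real.exp s| * (Real.exp s ^ 2 * (k (Real.log (Real.exp s)) * (Real.exp s ^ 3)⁻¹))
      = k s := fun s => by
    rw [Real.log_exp, abs_of_pos (Real.exp_pos s)]
    field_simp
  simp only [this]
  push_cast
  ring

lemma isSobolev_of_contDiff {G : Euc 3 → Euc 3} (hG : ContDiff ℝ 1 G) :
    IsSobolev G (fderiv ℝ G) where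
  cont := hG.continuous
  meas := (hG.continuous_fderiv one_ne_zero).aestronglyMeasurable
  int R := ((hG.continuous_fderiv one_ne_zero).norm.pow 3).locallyIntegrable.integrableOn_isCompact
    (isCompact_closedBall 0 R) |>.mono_set ball_subset_closedBall
  weak := fun φ hφ hc v w => by
    have hφ' : Continuous fun x => fderiv ℝ φ x v :=
      (hφ.continuous_fderiv (by simp)).clm_apply continuous_const
    have hi : ContDiff ℝ 1 fun x => ⟪G x, w⟫ := hG.inner ℝ contDiff_const
    have hd : ∀ x, fderiv ℝ (fun x => ⟪G x, w⟫) x v = ⟪fderiv ℝ G x v, w⟫ := fun x => by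
      rw [fderiv_inner_apply ℝ (hG.differentiable one_ne_zero x) (differentiableAt_const w)]
      simp
    have hi' : Continuous fun x => fderiv ℝ (fun x => ⟪G x, w⟫) x v :=
      (hi.continuous_fderiv one_ne_zero).clm_apply continuous_const
    have key := integral_mul_fderiv_eq_neg_fderiv_mul_of_integrable (μ := volume) (𝕜 := ℝ)
      (f := φ) (g := fun x => ⟪G x, w⟫) (v := v)
      ((hφ'.mul hi.continuous).integrable_of_hasCompactSupport ((hc.fderiv_apply (𝕜 := ℝ) v).mul_right))
      ((hφ.continuous.mul hi').integrable_of_hasCompactSupport hc.mul_right)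
      ((hφ.continuous.mul hi.continuous).integrable_of_hasCompactSupport hc.mul_right)
      (fun x _ => hφ.differentiable (by simp) x) (fun x _ => hi.differentiable one_ne_zero x)
    simp only [hd] at key
    linarith

/-- The flux of `F` against the cutoff function `η`. -/
def flux (F : Euc 3 → Euc 3) (DF : Euc 3 → Euc 3 →L[ℝ] Euc 3) (η : Euc 3 → ℝ) (x : Euc 3) : ℝ :=
  (‖F x‖ ^ 3)⁻¹ * adjPair (DF x) (fderiv ℝ η x) (F x)

section
variable {F : Euc 3 → Euc 3} {DF : Euc 3 → Euc 3 →L[ℝ] Euc 3} {G : ℕ → Euc 3 → Euc 3}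
  {η : Euc 3 → ℝ}

lemma IsSobolev.tendsto_flux (h : IsSobolev F DF) (hG : IsApprox F DF G)
    (hη : ContDiff ℝ 1 η) (hc : HasCompactSupport η)
    (hs : ∀ x ∈ tsupport (fderiv ℝ η), F x ≠ 0) :
    Integrable (flux F DF η) ∧
    Tendsto (fun n => ∫ x, flux (G n) (fderiv ℝ (G n)) η x) atTop (𝓝 (∫ x, flux F DF η x)) := by
  have hU : IsOpen ({0}ᶜ : Set (Euc 3)) := isOpen_compl_singleton
  have hV := (contDiffOn_radialField (h := fun _ => 1) hU contDiffOn_const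
    (fun h => absurd rfl h)).1
  have := h.tendsto_adjPair hG hη hc hU hV.continuousOn hs
  simp only [radialField, adjPair_smul, one_mul] at this
  exact this

lemma IsSobolev.integrable_flux (h : IsSobolev F DF)
    (hη : ContDiff ℝ 1 η) (hc : HasCompactSupport η)
    (hs : ∀ x ∈ tsupport (fderiv ℝ η), F x ≠ 0) : Integrable (flux F DF η) := by
  obtain ⟨G, hG, -⟩ := h.exists_approx
  exact (h.tendsto_flux hG hη hc hs).1

lemma IsSobolev.integral_flux_eq_zero (h : IsSobolev F DF)
    (hη : ContDiff ℝ 1 η) (hc : HasCompactSupport η)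
    (hs : ∀ x ∈ tsupport η, F x ≠ 0) : ∫ x, flux F DF η x = 0 := by
  have := (h.integral_radial (g := fun _ => 1) hη hc (isOpen_compl_singleton (x := (0 : Euc 3)))
    contDiffOn_const (fun h => absurd rfl h) hs).2.2
  simp only [one_mul, fderiv_fun_const, Pi.zero_apply, _root_.zero_apply, zero_mul, mul_zero,
    integral_zero] at this
  simp only [flux]
  linarith

lemma exists_injOn_nhd {H : Euc 3 → Euc 3} (hH : ContDiff ℝ 1 H) {z : Euc 3}
    (hz : (fderiv ℝ H z).det ≠ 0) :
    ∃ N, IsOpen N ∧ z ∈ N ∧ InjOn H N ∧ ∃ σ : ℤ, ∀ x ∈ N,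
      (fderiv ℝ H x).det = σ * |(fderiv ℝ H x).det| := by
  have hs : HasStrictFDerivAt H (fderiv ℝ H z) z := hH.contDiffAt.hasStrictFDerivAt one_ne_zero
  rw [← ContinuousLinearMap.coe_toContinuousLinearEquivOfDetNeZero _ hz] at hs
  set e := hs.toOpenPartialHomeomorph H
  have hcont : Continuous fun x => (fderiv ℝ H x).det :=
    cubicLip_det.continuous.comp (hH.continuous_fderiv one_ne_zero)
  have hinj : InjOn H e.source := e.injOn
  rcases lt_or_gt_of_ne hz with h | h
  · refine ⟨e.source ∩ {x | (fderiv ℝ H x).det < 0}, e.open_source.inter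
      (isOpen_lt hcont continuous_const), ⟨hs.mem_toOpenPartialHomeomorph_source, h⟩,
      hinj.mono inter_subset_left, -1, fun x hx => ?_⟩
    rw [abs_of_neg hx.2]
    simp
  · refine ⟨e.source ∩ {x | 0 < (fderiv ℝ H x).det}, e.open_source.inter
      (isOpen_lt continuous_const hcont), ⟨hs.mem_toOpenPartialHomeomorph_source, h⟩,
      hinj.mono inter_subset_left, 1, fun x hx => ?_⟩
    rw [abs_of_pos hx.2]
    simp

lemma image_mem_nhds_of_det_ne_zero {H : Euc 3 → Euc 3} (hH : ContDiff ℝ 1 H) {z : Euc 3}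
    (hz : (fderiv ℝ H z).det ≠ 0) {N : Set (Euc 3)} (hN : N ∈ 𝓝 z) : H '' N ∈ 𝓝 (H z) := by
  have hs : HasStrictFDerivAt H (fderiv ℝ H z) z := hH.contDiffAt.hasStrictFDerivAt one_ne_zero
  rw [← ContinuousLinearMap.coe_toContinuousLinearEquivOfDetNeZero _ hz] at hs
  rw [← hs.map_nhds_eq_of_equiv]
  exact image_mem_map hN

end

/-- A continuous function with nonzero integral supported in `(a - 1, a)`. -/
lemma exists_bump_Icc (a : ℝ) : ∃ k : ℝ → ℝ, Continuous k ∧ (∀ s, s ∉ Ioo (a - 1) a → k s = 0) ∧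
    ∫ s, k s ≠ 0 := by
  let b : ContDiffBump (a - 1 / 2) := ⟨1 / 4, 1 / 2, by norm_num, by norm_num⟩
  refine ⟨b, b.continuous, fun s hs => ?_, (b.integral_pos (μ := volume)).ne'⟩
  refine b.zero_of_le_dist ?_
  rw [Real.dist_eq]
  by_contra! h
  have : |s - (a - 1 / 2)| < 1 / 2 := h
  rw [abs_lt] at this
  exact hs ⟨by linarith, by linarith⟩

/-- The flux of a smooth map around a ball containing only regular zeros is quantized. -/
lemma flux_quantized {H : Euc 3 → Euc 3} (hH : ContDiff ℝ 1 H)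
    (hreg : ∀ x, H x = 0 → (fderiv ℝ H x).det ≠ 0) {η : Euc 3 → ℝ} (hη : ContDiff ℝ 1 η)
    (hc : HasCompactSupport η) {r : ℝ} (h1 : ∀ x ∈ ball (0 : Euc 3) r, η x = 1)
    (hne : ∀ x ∈ tsupport η, x ∉ ball (0 : Euc 3) r → H x ≠ 0) :
    ∃ m : ℤ, - ∫ x, flux H (fderiv ℝ H) η x = sphereArea * m := by
  set Z := tsupport η ∩ H ⁻¹' {0} with hZ
  have hZc : IsCompact Z := hc.inter_right (isClosed_singleton.preimage hH.continuous)
  have hZr : ∀ z ∈ Z, z ∈ ball (0 : Euc 3) r := fun z hz => by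
    by_contra h
    exact hne z hz.1 h hz.2
  have hloc : ∀ z, ∃ N, z ∈ Z → IsOpen N ∧ z ∈ N ∧ InjOn H N ∧ ∃ σ : ℤ, ∀ x ∈ N,
      (fderiv ℝ H x).det = σ * |(fderiv ℝ H x).det| := fun z => by
    by_cases hz : z ∈ Z
    · obtain ⟨N, hN⟩ := exists_injOn_nhd hH (hreg z hz.2)
      exact ⟨N, fun _ => hN⟩
    · exact ⟨∅, fun h => absurd h hz⟩
  choose N₀ hN₀ using hloc
  have hZf : Z.Finite := by
    obtain ⟨t, ht, hcov⟩ := hZc.elim_nhds_subcover N₀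
      fun z hz => (hN₀ z hz).1.mem_nhds (hN₀ z hz).2.1
    refine t.finite_toSet.subset fun z hz => ?_
    obtain ⟨w, hw, hzw⟩ := mem_iUnion₂.1 (hcov hz)
    have := (hN₀ w (ht w hw)).2.2.1 hzw (hN₀ w (ht w hw)).2.1
      ((show H z = 0 from hz.2).trans (show H w = 0 from (ht w hw).2).symm)
    rwa [this]
  obtain ⟨D, hD, hdisj⟩ := hZf.t2_separation
  set N := fun z => N₀ z ∩ D z ∩ ball 0 r with hN
  have hNo : ∀ z ∈ Z, IsOpen (N z) := fun z hz =>
    ((hN₀ z hz).1.inter (hD z).2).inter isOpen_ball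
  have hNz : ∀ z ∈ Z, z ∈ N z := fun z hz => ⟨⟨(hN₀ z hz).2.1, (hD z).1⟩, hZr z hz⟩
  have hinj : ∀ z ∈ Z, InjOn H (N z) := fun z hz =>
    (hN₀ z hz).2.2.1.mono fun x hx => hx.1.1
  obtain ⟨δ₁, hδ₁, hδ₁'⟩ : ∃ δ > 0, ∀ z ∈ Z, ball 0 δ ⊆ H '' N z := by
    have : ∀ᶠ δ in 𝓝[>] (0 : ℝ), ∀ z ∈ Z, ball 0 δ ⊆ H '' N z := by
      rw [hZf.eventually_all]
      intro z hz
      have h2 := image_mem_nhds_of_det_ne_zero hH (hreg z hz.2) ((hNo z hz).mem_nhds (hNz z hz))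
      rw [show H z = 0 from hz.2] at h2
      obtain ⟨ε, hε, h3⟩ := Metric.mem_nhds_iff.1 h2
      filter_upwards [Ioo_mem_nhdsGT hε] with δ hδ
      exact (ball_subset_ball hδ.2.le).trans h3
    obtain ⟨δ, h2, h3⟩ := (this.and self_mem_nhdsWithin).exists
    exact ⟨δ, h3, h2⟩
  obtain ⟨δ₂, hδ₂, hδ₂'⟩ : ∃ δ > 0, ∀ x ∈ tsupport η \ ⋃ z ∈ Z, N z, δ ≤ ‖H x‖ := by
    have hcpt : IsCompact (tsupport η \ ⋃ z ∈ Z, N z) :=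
      IsCompact.diff hc (isOpen_biUnion hNo)
    refine hcpt.exists_forall_le' hH.continuous.norm.continuousOn fun x hx => ?_
    rw [norm_pos_iff]
    exact fun h => hx.2 (mem_biUnion (show x ∈ Z from ⟨hx.1, h⟩) (hNz x ⟨hx.1, h⟩))
  set a := Real.log (min δ₁ δ₂) with ha
  have hδ : 0 < min δ₁ δ₂ := lt_min hδ₁ hδ₂
  obtain ⟨k, hk, hks, hk0⟩ := exists_bump_Icc a
  obtain ⟨hg1, hg2⟩ := exists_primitive hk (a - 1)
  set g := fun s => ∫ u in (a - 1)..s, k u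
  have hks' : ∀ s, s ∉ Icc (a - 1) a → k s = 0 := fun s hs =>
    hks s fun h => hs (Ioo_subset_Icc_self h)
  have hg0 : ∀ᶠ y : Euc 3 in 𝓝[≠] 0, g (Real.log ‖y‖) = 0 := by
    rw [eventually_nhdsWithin_iff]
    filter_upwards [ball_mem_nhds (0 : Euc 3) (Real.exp_pos (a - 1))] with y hy hy0
    refine primitive_eq_zero hks' ?_
    rw [Real.log_le_iff_le_exp (norm_pos_iff.2 hy0)]
    exact (mem_ball_zero_iff.1 hy).le
  have key := (isSobolev_of_contDiff hH).integral_radial hη hc isOpen_univ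
    (g := fun y => g (Real.log ‖y‖)) (contDiffOn_comp_log_norm hg1) (fun _ => hg0)
    (fun _ _ => mem_univ _)
  have hf : ∀ y : Euc 3, fderiv ℝ (fun y : Euc 3 => g (Real.log ‖y‖)) y y * (‖y‖ ^ 3)⁻¹ =
      k (Real.log ‖y‖) * (‖y‖ ^ 3)⁻¹ := fun y => by
    by_cases hy : y = 0
    · simp [hy]
    · rw [fderiv_comp_log_norm_self hg2 hy]
  simp only [hf] at key
  obtain ⟨i1, -, key⟩ := key
  have hout : ∀ x, x ∉ ⋃ z ∈ Z, N z → x ∈ tsupport η → a ≤ Real.log ‖H x‖ := fun x hx hx' =>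
    Real.log_le_log hδ ((min_le_right _ _).trans (hδ₂' x ⟨hx', hx⟩))
  have hsub : (⋃ z ∈ Z, N z) ⊆ ball 0 r := iUnion₂_subset fun z _ x hx => hx.2
  have hR : ∫ x, g (Real.log ‖H x‖) * (‖H x‖ ^ 3)⁻¹ * adjPair (fderiv ℝ H x) (fderiv ℝ η x) (H x) =
      (∫ s, k s) * ∫ x, flux H (fderiv ℝ H) η x := by
    rw [← integral_const_mul]
    refine integral_congr_ae (ae_of_all _ fun x => ?_)
    simp only [flux]
    by_cases hx : x ∈ ⋃ z ∈ Z, N z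
    · have : fderiv ℝ η x = 0 := by
        have h2 : η =ᶠ[𝓝 x] fun _ => 1 := by
          filter_upwards [isOpen_ball.mem_nhds (hsub hx)] with y hy using h1 y hy
        rw [h2.fderiv_eq]
        simp
      simp [this, adjPair_eq_sum]
    · by_cases hx' : x ∈ tsupport η
      · have h3 := hout x hx hx'
        rw [show g (Real.log ‖H x‖) = ∫ s, k s from
          primitive_eq_integral hks' (by linarith) h3]
        ring
      · have : fderiv ℝ η x = 0 := by
          rw [(notMem_tsupport_iff_eventuallyEq.1 hx').fderiv_eq]
          simp
        simp [this, adjPair_eq_sum]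
  have hL : ∃ m : ℤ, ∫ x, η x * (k (Real.log ‖H x‖) * (‖H x‖ ^ 3)⁻¹) * (fderiv ℝ H x).det =
      m * (sphereArea * ∫ s, k s) := by
    have hzero : ∀ x, x ∉ ⋃ z ∈ hZf.toFinset, N z →
        η x * (k (Real.log ‖H x‖) * (‖H x‖ ^ 3)⁻¹) * (fderiv ℝ H x).det = 0 := fun x hx => by
      by_cases hx' : x ∈ tsupport η
      · have h3 := hout x (by simpa using hx) hx'
        rw [hks _ fun h => h.2.not_ge h3]
        ring
      · rw [image_eq_zero_of_notMem_tsupport hx']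
        ring
    rw [← setIntegral_eq_integral_of_forall_compl_eq_zero hzero, integral_biUnion_finset]
    · have hterm : ∀ z ∈ hZf.toFinset, ∃ σ : ℤ,
          ∫ x in N z, η x * (k (Real.log ‖H x‖) * (‖H x‖ ^ 3)⁻¹) * (fderiv ℝ H x).det =
            σ * (sphereArea * ∫ s, k s) := fun z hz => by
        rw [Set.Finite.mem_toFinset] at hz
        obtain ⟨σ, hσ⟩ := (hN₀ z hz).2.2.2
        refine ⟨σ, ?_⟩
        have hcv := integral_image_eq_integral_abs_det_fderiv_smul volume (hNo z hz).measurableSet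
          (fun x _ => (hH.differentiable one_ne_zero x).hasFDerivAt.hasFDerivWithinAt) (hinj z hz)
          (fun y : Euc 3 => k (Real.log ‖y‖) * (‖y‖ ^ 3)⁻¹)
        rw [setIntegral_eq_integral_of_forall_compl_eq_zero, integral_comp_log_norm] at hcv
        · rw [hcv, ← integral_const_mul]
          refine setIntegral_congr_fun (hNo z hz).measurableSet fun x hx => ?_
          simp only [smul_eq_mul]
          rw [h1 x hx.2]
          linear_combination (k (Real.log ‖H x‖) * (‖H x‖ ^ 3)⁻¹) * hσ x hx.1.1
        · intro y hy
          have hy' : min δ₁ δ₂ ≤ ‖y‖ := by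
            by_contra! h
            exact hy (hδ₁' z hz (mem_ball_zero_iff.2 (h.trans_le (min_le_left _ _))))
          rw [hks _ fun h => h.2.not_ge (Real.log_le_log hδ hy'), zero_mul]
      choose! σ hσ using hterm
      refine ⟨∑ z ∈ hZf.toFinset, σ z, ?_⟩
      rw [Finset.sum_congr rfl hσ, ← Finset.sum_mul]
      push_cast
      rfl
    · exact fun z hz => (hNo z (hZf.mem_toFinset.1 hz)).measurableSet
    · intro z hz w hw hzw
      have := hdisj (by simpa using hz) (by simpa using hw) hzw
      exact this.mono (fun x hx => hx.1.2) fun x hx => hx.1.2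
    · exact fun z hz => i1.integrableOn
  obtain ⟨m, hm⟩ := hL
  refine ⟨m, ?_⟩
  rw [hm, hR] at key
  apply mul_left_cancel₀ hk0
  linarith

lemma adjPair_sub_smul (A : Euc 3 →L[ℝ] Euc 3) (ξ ζ : Euc 3 →L[ℝ] ℝ) (t : ℝ) (v : Euc 3) :
    adjPair A (ξ - t • ζ) v = adjPair A ξ v - t * adjPair A ζ v := by
  simp only [adjPair_eq_sum, Finset.mul_sum, ← Finset.sum_sub_distrib]
  refine Finset.sum_congr rfl fun i _ => Finset.sum_congr rfl fun j _ => ?_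
  simp
  ring

lemma notMem_tsupport_fderiv_of_eventually_eq {η : Euc 3 → ℝ} {a : ℝ} {x : Euc 3}
    (h : ∀ᶠ y in 𝓝 x, η y = a) : x ∉ tsupport (fderiv ℝ η) := by
  rw [notMem_tsupport_iff_eventuallyEq]
  filter_upwards [h.eventually_nhds] with y hy
  rw [EventuallyEq.fderiv_eq (𝕜 := ℝ) (f := fun _ => a) hy]
  simp

/-- A standard cutoff function: equal to `1` on `ball 0 1`, supported in `closedBall 0 2`. -/
def stdBump : ContDiffBump (0 : Euc 3) := ⟨1, 2, one_pos, one_lt_two⟩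

lemma exists_cutoff (R : ℝ) : ∃ η : Euc 3 → ℝ, ContDiff ℝ 1 η ∧ HasCompactSupport η ∧
    (∀ x ∈ ball (0 : Euc 3) R, η x = 1) ∧ ∀ᶠ x in 𝓝 0, η x = 1 := by
  let b : ContDiffBump (0 : Euc 3) := ⟨max R 1, max R 1 + 1, by positivity, by linarith⟩
  have h : ∀ x ∈ ball (0 : Euc 3) (max R 1), b x = 1 := fun x hx =>
    b.one_of_mem_closedBall (ball_subset_closedBall hx)
  refine ⟨b, b.contDiff, b.hasCompactSupport, fun x hx => h x (ball_subset_ball (le_max_left _ _) hx),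
    ?_⟩
  filter_upwards [ball_mem_nhds (0 : Euc 3) (show 0 < max R 1 by positivity)] with x hx using h x hx

section
variable {F : Euc 3 ≃ₜ Euc 3} {DF : Euc 3 → Euc 3 →L[ℝ] Euc 3} {K : ℝ}

lemma Homeomorph.ne_zero_of_ne_zero (h0 : F 0 = 0) {x : Euc 3} (hx : x ≠ 0) : F x ≠ 0 := fun h =>
  hx (F.injective (h.trans h0.symm))

lemma IsSobolev.integral_flux_eq (h : IsSobolev F DF) (h0 : F 0 = 0) {η : Euc 3 → ℝ}
    (hη : ContDiff ℝ 1 η) (hc : HasCompactSupport η) (hη0 : ∀ᶠ x in 𝓝 0, η x = η 0) :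
    ∫ x, flux F DF η x = η 0 * ∫ x, flux F DF stdBump x := by
  have hb : ∀ᶠ x in 𝓝 0, stdBump x = 1 := stdBump.eventuallyEq_one
  have hb1 : ContDiff ℝ 1 (stdBump : Euc 3 → ℝ) := stdBump.contDiff
  have hne : ∀ {ζ : Euc 3 → ℝ} {a : ℝ}, (∀ᶠ x in 𝓝 0, ζ x = a) →
      ∀ x ∈ tsupport (fderiv ℝ ζ), F x ≠ 0 := fun hζ x hx =>
    F.ne_zero_of_ne_zero h0 fun hx0 =>
      notMem_tsupport_fderiv_of_eventually_eq hζ (hx0 ▸ hx)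
  have i1 := h.integrable_flux hη hc (hne hη0)
  have i2 := h.integrable_flux hb1 stdBump.hasCompactSupport (hne hb)
  have hz : ∫ x, flux F DF (fun x => η x - η 0 * stdBump x) x = 0 := by
    refine h.integral_flux_eq_zero (hη.sub (contDiff_const.mul hb1))
      (hc.sub (stdBump.hasCompactSupport.mul_left)) fun x hx => F.ne_zero_of_ne_zero h0 ?_
    rintro rfl
    refine notMem_tsupport_iff_eventuallyEq.2 ?_ hx
    filter_upwards [hη0, hb] with y h1 h2
    simp [h1, h2]
  have e : ∀ x, flux F DF (fun x => η x - η 0 * stdBump x) x =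
      flux F DF η x - η 0 * flux F DF stdBump x := fun x => by
    have hd := hb1.differentiable one_ne_zero x
    simp only [flux]
    rw [fderiv_fun_sub (hη.differentiable one_ne_zero x) (hd.const_mul _),
      fderiv_const_mul hd, adjPair_sub_smul]
    ring
  simp only [e] at hz
  rw [integral_sub i1 (i2.const_mul _), integral_const_mul] at hz
  linarith

lemma IsSobolev.integral_log (h : IsSobolev F DF) (h0 : F 0 = 0) {k : ℝ → ℝ} (hk : Continuous k)
    (hc : HasCompactSupport k) :
    Integrable (fun x => k (Real.log ‖F x‖) * (‖F x‖ ^ 3)⁻¹ * (DF x).det) ∧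
    ∫ x, k (Real.log ‖F x‖) * (‖F x‖ ^ 3)⁻¹ * (DF x).det =
      (- ∫ x, flux F DF stdBump x) * ∫ s, k s := by
  obtain ⟨M, hM⟩ := hc.isBounded.subset_closedBall 0
  have hks : ∀ s, s ∉ Icc (-M) M → k s = 0 := fun s hs => by
    by_contra h'
    have := hM (subset_tsupport k h')
    rw [mem_closedBall_zero_iff, Real.norm_eq_abs, abs_le] at this
    exact hs this
  obtain ⟨R, hR⟩ := ((isCompact_closedBall (0 : Euc 3) (Real.exp (max M 0))).image
    F.symm.continuous).isBounded.subset_ball 0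
  have hR' : ∀ x, x ∉ ball (0 : Euc 3) R → M < Real.log ‖F x‖ ∧ F x ≠ 0 := fun x hx => by
    have h1 : Real.exp (max M 0) < ‖F x‖ := by
      by_contra! h'
      exact hx (hR ⟨F x, mem_closedBall_zero_iff.2 h', by simp⟩)
    refine ⟨(le_max_left M 0).trans_lt ?_, fun h2 => ?_⟩
    · rwa [Real.lt_log_iff_exp_lt ((Real.exp_pos _).trans h1)]
    · rw [h2, norm_zero] at h1
      exact h1.not_gt (Real.exp_pos _)
  obtain ⟨η, hη, hηc, hη1, hη0⟩ := exists_cutoff R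
  obtain ⟨hg1, hg2⟩ := exists_primitive hk (-M)
  set g := fun s => ∫ u in (-M)..s, k u
  have hg0 : ∀ᶠ y : Euc 3 in 𝓝[≠] 0, g (Real.log ‖y‖) = 0 := by
    rw [eventually_nhdsWithin_iff]
    filter_upwards [ball_mem_nhds (0 : Euc 3) (Real.exp_pos (-M))] with y hy hy0
    refine primitive_eq_zero hks ?_
    rw [Real.log_le_iff_le_exp (norm_pos_iff.2 hy0)]
    exact (mem_ball_zero_iff.1 hy).le
  have key := h.integral_radial hη hηc isOpen_univ
    (g := fun y => g (Real.log ‖y‖)) (contDiffOn_comp_log_norm hg1) (fun _ => hg0)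
    (fun _ _ => mem_univ _)
  have hf : ∀ y : Euc 3, fderiv ℝ (fun y : Euc 3 => g (Real.log ‖y‖)) y y * (‖y‖ ^ 3)⁻¹ =
      k (Real.log ‖y‖) * (‖y‖ ^ 3)⁻¹ := fun y => by
    by_cases hy : y = 0
    · simp [hy]
    · rw [fderiv_comp_log_norm_self hg2 hy]
  simp only [hf] at key
  obtain ⟨i1, -, key⟩ := key
  have e1 : ∀ x, η x * (k (Real.log ‖F x‖) * (‖F x‖ ^ 3)⁻¹) * (DF x).det =
      k (Real.log ‖F x‖) * (‖F x‖ ^ 3)⁻¹ * (DF x).det := fun x => by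
    by_cases hx : x ∈ ball (0 : Euc 3) R
    · rw [hη1 x hx, one_mul]
    · rw [hks _ fun h' => h'.2.not_gt (hR' x hx).1]
      ring
  have e2 : ∀ x, g (Real.log ‖F x‖) * (‖F x‖ ^ 3)⁻¹ * adjPair (DF x) (fderiv ℝ η x) (F x) =
      (∫ s, k s) * flux F DF η x := fun x => by
    simp only [flux]
    by_cases hx : x ∈ ball (0 : Euc 3) R
    · have : fderiv ℝ η x = 0 := by
        have h2 : η =ᶠ[𝓝 x] fun _ => 1 := by
          filter_upwards [isOpen_ball.mem_nhds hx] with y hy using hη1 y hy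
        rw [h2.fderiv_eq]
        simp
      simp [this, adjPair_eq_sum]
    · by_cases hM0 : -M ≤ M
      · rw [show g (Real.log ‖F x‖) = ∫ s, k s from
          primitive_eq_integral hks (hM0.trans (hR' x hx).1.le) (hR' x hx).1.le]
        ring
      · have hk0 : k = fun _ => 0 := funext fun s => hks s fun h' => hM0 (h'.1.trans h'.2)
        simp [g, hk0]
  simp only [e1] at i1 key
  simp only [e2] at key
  rw [integral_const_mul, h.integral_flux_eq h0 hη hηc (hη0.mono fun x hx => by
    rw [hx, hη0.self_of_nhds]), hη0.self_of_nhds] at key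
  exact ⟨i1, by rw [key]; ring⟩

lemma IsSobolev.flux_quantized (h : IsSobolev F DF) (h0 : F 0 = 0) :
    ∃ m : ℤ, - ∫ x, flux F DF stdBump x = sphereArea * m := by
  obtain ⟨G, hG, hreg⟩ := h.exists_approx
  have hb : ∀ᶠ x in 𝓝 0, stdBump x = 1 := stdBump.eventuallyEq_one
  have hb1 : ContDiff ℝ 1 (stdBump : Euc 3 → ℝ) := stdBump.contDiff
  have hlim := (h.tendsto_flux hG hb1 stdBump.hasCompactSupport fun x hx =>
    F.ne_zero_of_ne_zero h0 fun hx0 =>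
      notMem_tsupport_fderiv_of_eventually_eq hb (hx0 ▸ hx)).2
  have hcpt : IsCompact (tsupport (stdBump : Euc 3 → ℝ) \ ball 0 1) :=
    IsCompact.diff stdBump.hasCompactSupport isOpen_ball
  obtain ⟨C, -, hCU, hev⟩ := hG.exists_compact h.cont hcpt
    (isOpen_compl_singleton (x := (0 : Euc 3))) fun x hx => F.ne_zero_of_ne_zero h0 (by
      rintro rfl
      exact hx.2 (mem_ball_self one_pos))
  have hq : ∀ᶠ n in atTop, -(∫ x, flux (G n) (fderiv ℝ (G n)) stdBump x) / sphereArea ∈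
      range ((↑) : ℤ → ℝ) := by
    filter_upwards [hev] with n hn
    obtain ⟨m, hm⟩ := _root_.flux_quantized ((hG.smooth n).of_le (by norm_num)) (hreg n) hb1
      stdBump.hasCompactSupport (r := 1)
      (fun x hx => stdBump.one_of_mem_closedBall (ball_subset_closedBall hx))
      (fun x hx hx' => hCU (hn x ⟨hx, hx'⟩))
    refine ⟨m, ?_⟩
    rw [hm, mul_div_cancel_left₀ _ sphereArea_pos.ne']
  obtain ⟨m, hm⟩ := Int.isClosedEmbedding_coe_real.isClosed_range.mem_of_tendsto
    (hlim.neg.div_const _) hq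
  refine ⟨m, ?_⟩
  rw [hm, mul_div_cancel₀ _ sphereArea_pos.ne']

/-- The degree of a quasiconformal homeomorphism is positive. -/
theorem IsSobolev.exists_degree (h : IsSobolev F DF) (h0 : F 0 = 0) (hK0 : 0 ≤ K)
    (hK : ∀ᵐ x, ‖DF x‖ ^ 3 ≤ K * (DF x).det) :
    ∃ c, sphereArea ≤ c ∧
    (∀ η : Euc 3 → ℝ, ContDiff ℝ 1 η → HasCompactSupport η → (∀ᶠ x in 𝓝 0, η x = η 0) →
      Integrable (flux F DF η) ∧ ∫ x, flux F DF η x = - c * η 0) ∧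
    ∀ k : ℝ → ℝ, Continuous k → HasCompactSupport k →
      Integrable (fun x => k (Real.log ‖F x‖) * (‖F x‖ ^ 3)⁻¹ * (DF x).det) ∧
      ∫ x, k (Real.log ‖F x‖) * (‖F x‖ ^ 3)⁻¹ * (DF x).det = c * ∫ s, k s := by
  obtain ⟨m, hm⟩ := h.flux_quantized h0
  refine ⟨- ∫ x, flux F DF stdBump x, ?_, fun η hη hc hη0 => ⟨?_, ?_⟩, fun k hk hc =>
    h.integral_log h0 hk hc⟩
  · rcases lt_or_ge 0 m with hm0 | hm0
    · rw [hm]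
      exact le_mul_of_one_le_right sphereArea_pos.le (by exact_mod_cast hm0)
    exfalso
    have hJ : ∀ᵐ x, 0 ≤ (DF x).det := by
      filter_upwards [hK] with x hx
      by_contra! hlt
      rcases hK0.eq_or_lt with rfl | hK0
      · have h1 : ‖DF x‖ = 0 := by
          have : 0 ≤ ‖DF x‖ ^ 3 := by positivity
          exact pow_eq_zero_iff (n := 3) (by norm_num) |>.1 (by linarith)
        rw [norm_eq_zero] at h1
        rw [h1, det_eq_entry] at hlt
        simp [entry] at hlt
      · have : 0 ≤ ‖DF x‖ ^ 3 := by positivity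
        nlinarith
    have hJ0 : ∀ᵐ x, DF x = 0 := by
      have hn : ∀ n : ℕ, ∀ᵐ x, (max 0 (n - |Real.log ‖F x‖|)) * (‖F x‖ ^ 3)⁻¹ * (DF x).det = 0 := by
        intro n
        set k : ℝ → ℝ := fun s => max 0 (n - |s|)
        have hkc : HasCompactSupport k := by
          refine HasCompactSupport.intro (isCompact_closedBall (0 : ℝ) n) fun s hs => ?_
          have : (n : ℝ) < |s| := by simpa using hs
          exact max_eq_left (by linarith)
        obtain ⟨i, e⟩ := h.integral_log h0 (k := k) (by fun_prop) hkc
        have hnn : 0 ≤ᵐ[volume] fun x => k (Real.log ‖F x‖) * (‖F x‖ ^ 3)⁻¹ * (DF x).det := by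
          filter_upwards [hJ] with x hx
          have : 0 ≤ k (Real.log ‖F x‖) := le_max_left _ _
          simp only [Pi.zero_apply]
          positivity
        have hle : ∫ x, k (Real.log ‖F x‖) * (‖F x‖ ^ 3)⁻¹ * (DF x).det ≤ 0 := by
          rw [e, hm]
          have h1 : (m : ℝ) ≤ 0 := by exact_mod_cast hm0
          have h2 : 0 ≤ ∫ s, k s := integral_nonneg fun s => le_max_left _ _
          exact mul_nonpos_of_nonpos_of_nonneg
            (mul_nonpos_of_nonneg_of_nonpos sphereArea_pos.le h1) h2
        exact (integral_eq_zero_iff_of_nonneg_ae hnn i).1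
          (le_antisymm hle (integral_nonneg_of_ae hnn))
      have hne : ∀ᵐ x : Euc 3, x ≠ 0 := by
        rw [ae_iff]
        simp
      filter_upwards [ae_all_iff.2 hn, hne, hK] with x hx hx0 hKx
      obtain ⟨n, hn⟩ := exists_nat_gt |Real.log ‖F x‖|
      have h1 := hx n
      rw [max_eq_right (by linarith)] at h1
      have h2 : 0 < (‖F x‖ ^ 3)⁻¹ := by
        have := norm_pos_iff.2 (F.ne_zero_of_ne_zero h0 hx0)
        positivity
      have h3 : (DF x).det = 0 := by
        rcases mul_eq_zero.1 h1 with h4 | h4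
        · rcases mul_eq_zero.1 h4 with h5 | h5 <;> linarith
        · exact h4
      rw [h3, mul_zero] at hKx
      have h4 : 0 ≤ ‖DF x‖ ^ 3 := by positivity
      exact norm_eq_zero.1 (pow_eq_zero_iff (n := 3) (by norm_num) |>.1 (by linarith))
    have h1 := h.eq_of_ae_zero hJ0 (stdVec 0)
    have h2 := F.injective h1
    have h3 := congrArg (fun v : Euc 3 => v 0) h2
    simp [stdVec] at h3
  · exact h.integrable_flux hη hc fun x hx => F.ne_zero_of_ne_zero h0 fun hx0 =>
      notMem_tsupport_fderiv_of_eventually_eq hη0 (hx0 ▸ hx)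
  · rw [h.integral_flux_eq h0 hη hc hη0]
    ring

end

/-- Coordinates of `ℝ³` adapted to the hyperplanes `x i = s`. -/
def slice (i : Fin 3) (z : ℝ × ℝ × ℝ) : Euc 3 :=
  WithLp.toLp 2 (i.insertNth z.1 ![z.2.1, z.2.2])

lemma slice_add_smul (i : Fin 3) (s r : ℝ) (p q : ℝ × ℝ) :
    slice i (s, p + r • q) = slice i (s, p) + r • slice i (0, q) := by
  ext j
  fin_cases i <;> fin_cases j <;> simp [slice, Fin.insertNth, Fin.succAboveCases]

lemma norm_sq_slice (i : Fin 3) (s : ℝ) (p : ℝ × ℝ) :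
    ‖slice i (s, p)‖ ^ 2 = s ^ 2 + p.1 ^ 2 + p.2 ^ 2 := by
  rw [EuclideanSpace.norm_sq_eq, Fin.sum_univ_three]
  fin_cases i <;> simp [slice, Fin.insertNth, Fin.succAboveCases] <;> ring

lemma exists_slice (i : Fin 3) (x : Euc 3) : ∃ p, x = slice i (x i, p) := by
  fin_cases i
  · exact ⟨(x 1, x 2), by ext j; fin_cases j <;> simp [slice]⟩
  · exact ⟨(x 0, x 2), by ext j; fin_cases j <;> simp [slice, Fin.insertNth, Fin.succAboveCases]⟩
  · exact ⟨(x 0, x 1), by ext j; fin_cases j <;> simp [slice, Fin.insertNth, Fin.succAboveCases]⟩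

lemma measurePreserving_slice (i : Fin 3) : MeasurePreserving (slice i) := by
  have h1 := (volume_preserving_finTwoArrow ℝ).symm
  have h2 := (MeasurePreserving.id (volume : Measure ℝ)).prod h1
  have h3 := (volume_preserving_piFinSuccAbove (fun _ : Fin 3 => ℝ) i).symm
  exact (PiLp.volume_preserving_toLp (Fin 3)).comp (h3.comp h2)

lemma lintegral_ge_of_slices {f : Euc 3 → ℝ≥0∞} (hf : Measurable f) (i : Fin 3) {S : Set ℝ}
    {c : ℝ≥0∞} (h : ∀ s ∈ S, c ≤ ∫⁻ p, f (slice i (s, p))) (hS : MeasurableSet S) :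
    c * volume S ≤ ∫⁻ x, f x := by
  rw [← (measurePreserving_slice i).lintegral_comp hf, Measure.volume_eq_prod,
    lintegral_prod (fun z => f (slice i z))
      (Measurable.aemeasurable (hf.comp (measurePreserving_slice i).measurable)),
    ← setLIntegral_const]
  exact (setLIntegral_mono' hS h).trans (setLIntegral_le_lintegral _ _)

lemma ray_estimate {v : Euc 3 → ℝ} (hv : ContDiff ℝ 1 v) {x ω : Euc 3} (hω : ‖ω‖ = 1) {L : ℝ}
    (hL : 0 < L) (h : v (x + L • ω) + 1 / 2 ≤ v x) :
    1 / (256 * L) ≤ ∫ r in 0..L, r * ‖fderiv ℝ v (x + r • ω)‖ ^ 3 := by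
  have hc : Continuous fun r : ℝ => ‖fderiv ℝ v (x + r • ω)‖ :=
    ((hv.continuous_fderiv one_ne_zero).comp (by fun_prop)).norm
  have hd : ∀ r : ℝ, HasDerivAt (fun r : ℝ => v (x + r • ω)) (fderiv ℝ v (x + r • ω) ω) r := fun r => by
    have h1 : HasDerivAt (fun r : ℝ => x + r • ω) ω r := by
      simpa using ((hasDerivAt_id r).smul_const ω).const_add x
    exact (hv.differentiable one_ne_zero _).hasFDerivAt.comp_hasDerivAt r h1
  have hcd : Continuous fun r : ℝ => fderiv ℝ v (x + r • ω) ω :=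
    ((hv.continuous_fderiv one_ne_zero).comp (by fun_prop)).clm_apply continuous_const
  have hftc := intervalIntegral.integral_eq_sub_of_hasDerivAt (a := 0) (b := L) (fun r _ => hd r)
    (hcd.intervalIntegrable _ _)
  set β := 1 / (8 * √L) with hβ
  have hsq : 0 < √L := Real.sqrt_pos.2 hL
  have hβ0 : 0 < β := by positivity
  have hβL : 64 * L * β ^ 2 = 1 := by
    rw [hβ, div_pow, mul_pow, Real.sq_sqrt hL.le]
    field_simp
    norm_num
  have hint : IntervalIntegrable (fun r : ℝ => β * r ^ (-(1 / 2) : ℝ)) volume 0 L :=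
    (intervalIntegral.intervalIntegrable_rpow' (by norm_num)).const_mul β
  have hI : ∫ r in 0..L, β * r ^ (-(1 / 2) : ℝ) = 1 / 4 := by
    rw [intervalIntegral.integral_const_mul, integral_rpow (Or.inl (by norm_num))]
    norm_num
    rw [← Real.sqrt_eq_rpow, hβ]
    field_simp
    norm_num
  have hint2 : IntervalIntegrable (fun r : ℝ => 64 * L * (r * ‖fderiv ℝ v (x + r • ω)‖ ^ 3)) volume 0 L :=
    Continuous.intervalIntegrable (by fun_prop) _ _
  have hmono : ∫ r in 0..L, -(fderiv ℝ v (x + r • ω) ω) ≤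
      ∫ r in 0..L, (64 * L * (r * ‖fderiv ℝ v (x + r • ω)‖ ^ 3) + β * r ^ (-(1 / 2) : ℝ)) := by
    refine intervalIntegral.integral_mono_on_of_le_Ioo hL.le (hcd.neg.intervalIntegrable _ _)
      (hint2.add hint) fun r hr => ?_
    have h1 : -(fderiv ℝ v (x + r • ω) ω) ≤ ‖fderiv ℝ v (x + r • ω)‖ := by
      have := (fderiv ℝ v (x + r • ω)).le_opNorm ω
      rw [hω, mul_one, Real.norm_eq_abs] at this
      exact (neg_le_abs _).trans this
    refine h1.trans ?_
    have hr0 : 0 < √r := Real.sqrt_pos.2 hr.1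
    have hrr : r ^ (-(1 / 2) : ℝ) = 1 / √r := by
      rw [Real.rpow_neg hr.1.le, Real.sqrt_eq_rpow, one_div (r ^ (1 / 2 : ℝ))]
    rw [hrr]
    set f := ‖fderiv ℝ v (x + r • ω)‖
    have hf : 0 ≤ f := norm_nonneg _
    have hr2 : r = √r ^ 2 := (Real.sq_sqrt hr.1.le).symm
    set ρ := √r
    rw [hr2]
    rcases le_total (f * ρ) β with h2 | h2
    · have h3 : f ≤ β * (1 / ρ) := by
        rw [mul_one_div, le_div_iff₀ hr0]
        exact h2
      have : 0 ≤ 64 * L * (ρ ^ 2 * f ^ 3) := by positivity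
      linarith
    · have h3 : β ^ 2 ≤ (f * ρ) ^ 2 := by gcongr
      have h4 : f * 1 ≤ f * (64 * L * (f * ρ) ^ 2) := by
        gcongr
        rw [← hβL]
        gcongr
      have : 0 ≤ β * (1 / ρ) := by positivity
      nlinarith
  rw [intervalIntegral.integral_neg, hftc, intervalIntegral.integral_add hint2 hint, hI,
    intervalIntegral.integral_const_mul, zero_smul, add_zero] at hmono
  rw [div_le_iff₀ (by positivity)]
  nlinarith

lemma lintegral_polar_translate (f : ℝ × ℝ → ℝ≥0∞) (p : ℝ × ℝ) :
    ∫⁻ q in Ioi (0 : ℝ) ×ˢ Ioo (-Real.pi) Real.pi,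
      ENNReal.ofReal q.1 * f (p + q.1 • (Real.cos q.2, Real.sin q.2)) = ∫⁻ q, f q := by
  have h := lintegral_comp_polarCoord_symm fun q => f (p + q)
  rw [lintegral_add_left_eq_self f p] at h
  exact h

lemma slice_lower_bound {v : Euc 3 → ℝ} (hv : ContDiff ℝ 1 v) {R : ℝ} (hR : 0 < R) {i : Fin 3}
    {x : Euc 3} (hx : ‖x‖ ≤ 3 * R) (hvx : 3 / 4 ≤ v x)
    (hout : ∀ y, 3 * R ≤ ‖y‖ → ‖y‖ ≤ 9 * R → v y ≤ 1 / 4) :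
    ENNReal.ofReal (1 / (256 * (6 * R))) ≤ ∫⁻ p, (closedBall (0 : Euc 3) (9 * R)).indicator
      (fun y => ENNReal.ofReal (‖fderiv ℝ v y‖ ^ 3)) (slice i (x i, p)) := by
  obtain ⟨p₀, hp₀⟩ := exists_slice i x
  have hcf : Continuous fun y => ‖fderiv ℝ v y‖ ^ 3 := (hv.continuous_fderiv one_ne_zero).norm.pow 3
  have hm : Measurable fun p => (closedBall (0 : Euc 3) (9 * R)).indicator
      (fun y => ENNReal.ofReal (‖fderiv ℝ v y‖ ^ 3)) (slice i (x i, p)) :=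
    (hcf.measurable.ennreal_ofReal.indicator measurableSet_closedBall).comp
      ((measurePreserving_slice i).measurable.comp measurable_prodMk_left)
  rw [← lintegral_polar_translate _ p₀, Measure.volume_eq_prod, ← Measure.prod_restrict,
    lintegral_prod_symm _ (by
      refine Measurable.aemeasurable ?_
      refine (measurable_fst.ennreal_ofReal).mul (hm.comp ?_)
      exact Continuous.measurable (by fun_prop))]
  have hθ : ∀ θ : ℝ, ENNReal.ofReal (1 / (256 * (6 * R))) ≤ ∫⁻ r in Ioi (0 : ℝ), ENNReal.ofReal r *
      (closedBall (0 : Euc 3) (9 * R)).indicator (fun y => ENNReal.ofReal (‖fderiv ℝ v y‖ ^ 3))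
        (slice i (x i, p₀ + r • (Real.cos θ, Real.sin θ))) := fun θ => by
    set ω := slice i (0, (Real.cos θ, Real.sin θ)) with hω
    have hω1 : ‖ω‖ = 1 := by
      have := norm_sq_slice i 0 (Real.cos θ, Real.sin θ)
      simp only at this
      rw [← hω, zero_pow two_ne_zero, zero_add, Real.cos_sq_add_sin_sq] at this
      exact (pow_eq_one_iff_of_nonneg (norm_nonneg _) two_ne_zero).1 this
    have hnr : ∀ r : ℝ, 0 ≤ r → ‖r • ω‖ = r := fun r hr => by
      rw [norm_smul, hω1, mul_one, Real.norm_of_nonneg hr]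
    have hL : v (x + (6 * R) • ω) + 1 / 2 ≤ v x := by
      have h6 := hnr (6 * R) (by positivity)
      have h1 : v (x + (6 * R) • ω) ≤ 1 / 4 := by
        refine hout _ ?_ ?_
        · have := norm_sub_norm_le ((6 * R) • ω) (-x)
          rw [norm_neg, sub_neg_eq_add, add_comm _ x] at this
          linarith
        · have := norm_add_le x ((6 * R) • ω)
          linarith
      linarith
    have hray := ray_estimate hv hω1 (by positivity) hL
    have hci : Continuous fun r : ℝ => r * ‖fderiv ℝ v (x + r • ω)‖ ^ 3 :=
      continuous_id.mul (hcf.comp (by fun_prop))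
    refine (ENNReal.ofReal_le_ofReal hray).trans ?_
    rw [intervalIntegral.integral_of_le (by positivity), ofReal_integral_eq_lintegral_ofReal]
    · refine (setLIntegral_mono' measurableSet_Ioc fun r hr => ?_).trans
        (lintegral_mono_set Ioc_subset_Ioi_self)
      rw [slice_add_smul, ← hp₀, ENNReal.ofReal_mul hr.1.le, indicator_of_mem]
      rw [mem_closedBall_zero_iff]
      have := norm_add_le x (r • ω)
      rw [hnr r hr.1.le] at this
      linarith [hr.2]
    · exact (hci.integrableOn_Icc).mono_set Ioc_subset_Icc_self
    · filter_upwards [ae_restrict_mem measurableSet_Ioc] with r hr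
      exact mul_nonneg hr.1.le (by positivity)
  calc ENNReal.ofReal (1 / (256 * (6 * R)))
      ≤ ENNReal.ofReal (1 / (256 * (6 * R))) * volume (Ioo (-Real.pi) Real.pi) := by
        refine le_mul_of_one_le_right' ?_
        rw [Real.volume_Ioo, ENNReal.one_le_ofReal]
        linarith [Real.pi_gt_three]
    _ ≤ _ := by
        rw [← setLIntegral_const]
        exact setLIntegral_mono' measurableSet_Ioo fun θ _ => hθ θ

/-- A lower bound for the conformal energy of a function separating a continuum of diameter
comparable to `R` from a shell. -/
lemma capacity_lower_bound {v : Euc 3 → ℝ} (hv : ContDiff ℝ 1 v) {R : ℝ} (hR : 0 < R) {i : Fin 3}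
    {a b : ℝ} (hab : R / 2 ≤ b - a)
    (hQ : ∀ s ∈ Icc a b, ∃ x : Euc 3, x i = s ∧ ‖x‖ ≤ 3 * R ∧ 3 / 4 ≤ v x)
    (hout : ∀ y, 3 * R ≤ ‖y‖ → ‖y‖ ≤ 9 * R → v y ≤ 1 / 4) :
    1 / 3072 ≤ ∫ y in closedBall (0 : Euc 3) (9 * R), ‖fderiv ℝ v y‖ ^ 3 := by
  have hcf : Continuous fun y => ‖fderiv ℝ v y‖ ^ 3 := (hv.continuous_fderiv one_ne_zero).norm.pow 3
  have h := lintegral_ge_of_slices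
    (hcf.measurable.ennreal_ofReal.indicator (measurableSet_closedBall (x := 0) (ε := 9 * R))) i
    (S := Icc a b) (c := ENNReal.ofReal (1 / (256 * (6 * R)))) (fun s hs => by
      obtain ⟨x, rfl, hx, hvx⟩ := hQ s hs
      exact slice_lower_bound hv hR hx hvx hout) measurableSet_Icc
  rw [lintegral_indicator measurableSet_closedBall, ← ofReal_integral_eq_lintegral_ofReal
    (hcf.locallyIntegrable.integrableOn_isCompact (isCompact_closedBall _ _))
    (ae_of_all _ fun y => by positivity), Real.volume_Icc, ← ENNReal.ofReal_mul (by positivity),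
    ENNReal.ofReal_le_ofReal_iff (integral_nonneg fun y => by positivity)] at h
  refine le_trans ?_ h
  calc (1 : ℝ) / 3072 = 1 / (256 * (6 * R)) * (R / 2) := by
        field_simp
        norm_num
    _ ≤ _ := by gcongr

/-- The trapezoidal function equal to `1` on `[a, b]` and vanishing off `[a - 1, b + 1]`. -/
def plateau (a b s : ℝ) : ℝ := max 0 (min 1 (min (s - a + 1) (b + 1 - s)))

section

variable {a b s : ℝ}

lemma continuous_plateau (a b : ℝ) : Continuous (plateau a b) := by
  unfold plateau
  fun_prop

lemma plateau_nonneg : 0 ≤ plateau a b s := le_max_left _ _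

lemma plateau_le_one : plateau a b s ≤ 1 := max_le zero_le_one (min_le_left _ _)

lemma plateau_eq_one (hs : s ∈ Icc a b) : plateau a b s = 1 := by
  have h1 : 1 ≤ min (s - a + 1) (b + 1 - s) := le_min (by linarith [hs.1]) (by linarith [hs.2])
  rw [plateau, min_eq_left h1, max_eq_right zero_le_one]

lemma plateau_eq_zero (hs : s ∉ Icc (a - 1) (b + 1)) : plateau a b s = 0 := by
  refine max_eq_left ((min_le_right _ _).trans ?_)
  by_contra! h
  obtain ⟨h1, h2⟩ := lt_min_iff.1 h
  exact hs ⟨by linarith, by linarith⟩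

lemma hasCompactSupport_plateau (a b : ℝ) : HasCompactSupport (plateau a b) :=
  HasCompactSupport.intro isCompact_Icc fun _ hs => plateau_eq_zero hs

lemma integrable_plateau (a b : ℝ) : Integrable (plateau a b) :=
  (continuous_plateau a b).integrable_of_hasCompactSupport (hasCompactSupport_plateau a b)

lemma le_integral_plateau (hab : a ≤ b) : b - a ≤ ∫ s, plateau a b s := by
  have h : ∫ s, (Icc a b).indicator (fun _ => (1 : ℝ)) s ≤ ∫ s, plateau a b s := by
    refine integral_mono ((integrable_indicator_iff measurableSet_Icc).2 (by simp))
      (integrable_plateau a b) fun s => ?_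
    by_cases hs : s ∈ Icc a b
    · rw [indicator_of_mem hs, plateau_eq_one hs]
    · rw [indicator_of_notMem hs]
      exact plateau_nonneg
  rwa [integral_indicator measurableSet_Icc, setIntegral_const, Measure.real, Real.volume_Icc,
    ENNReal.toReal_ofReal (by linarith), smul_eq_mul, mul_one] at h

lemma integral_plateau_le (hab : a ≤ b) : ∫ s, plateau a b s ≤ b - a + 2 := by
  have h : ∫ s, plateau a b s ≤ ∫ s, (Icc (a - 1) (b + 1)).indicator (fun _ => (1 : ℝ)) s := by
    refine integral_mono (integrable_plateau a b)
      ((integrable_indicator_iff measurableSet_Icc).2 (by simp)) fun s => ?_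
    by_cases hs : s ∈ Icc (a - 1) (b + 1)
    · rw [indicator_of_mem hs]
      exact plateau_le_one
    · rw [indicator_of_notMem hs, plateau_eq_zero hs]
  rw [integral_indicator measurableSet_Icc, setIntegral_const, Measure.real, Real.volume_Icc,
    ENNReal.toReal_ofReal (by linarith), smul_eq_mul, mul_one] at h
  linarith

end

/-- A quasiconformal homeomorphism fixing the origin, of degree `c / sphereArea`. -/
structure IsNormalizedQC (K c : ℝ) (F : Euc 3 ≃ₜ Euc 3) (DF : Euc 3 → Euc 3 →L[ℝ] Euc 3) :
    Prop where
  sob : IsSobolev F DF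
  map_zero : F 0 = 0
  pos : 0 < K
  dist : ∀ᵐ x, ‖DF x‖ ^ 3 ≤ K * (DF x).det
  area_le : sphereArea ≤ c
  flux : ∀ η : Euc 3 → ℝ, ContDiff ℝ 1 η → HasCompactSupport η → (∀ᶠ x in 𝓝 0, η x = η 0) →
    Integrable (flux F DF η) ∧ ∫ x, flux F DF η x = - c * η 0
  change : ∀ k : ℝ → ℝ, Continuous k → HasCompactSupport k →
    Integrable (fun x => k (Real.log ‖F x‖) * (‖F x‖ ^ 3)⁻¹ * (DF x).det) ∧
    ∫ x, k (Real.log ‖F x‖) * (‖F x‖ ^ 3)⁻¹ * (DF x).det = c * ∫ s, k s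

lemma continuous_comp_log_norm {k : ℝ → ℝ} (hk : Continuous k) (hc : HasCompactSupport k) :
    Continuous fun y : Euc 3 => k (Real.log ‖y‖) * (‖y‖ ^ 3)⁻¹ := by
  obtain ⟨M, hM⟩ := hc.isBounded.subset_closedBall 0
  rw [continuous_iff_continuousAt]
  intro y
  rcases eq_or_ne y 0 with rfl | hy
  · refine ContinuousAt.congr (f := fun _ => (0 : ℝ)) continuousAt_const ?_
    filter_upwards [ball_mem_nhds (0 : Euc 3) (Real.exp_pos (-M))] with y hy
    rcases eq_or_ne y 0 with rfl | hy0
    · simp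
    · rw [image_eq_zero_of_notMem_tsupport (f := k), zero_mul]
      intro h
      have h1 := (abs_le.1 (mem_closedBall_zero_iff.1 (hM h))).1
      rw [mem_ball_zero_iff, ← Real.log_lt_iff_lt_exp (norm_pos_iff.2 hy0)] at hy
      linarith
  · have h0 := norm_ne_zero_iff.2 hy
    exact (hk.continuousAt.comp (continuous_norm.continuousAt.log h0)).mul
      ((continuous_norm.continuousAt.pow 3).inv₀ (pow_ne_zero 3 h0))

namespace IsNormalizedQC

variable {K c : ℝ} {F : Euc 3 ≃ₜ Euc 3} {DF : Euc 3 → Euc 3 →L[ℝ] Euc 3}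

lemma c_pos (h : IsNormalizedQC K c F DF) : 0 < c := sphereArea_pos.trans_le h.area_le

lemma ne_zero (h : IsNormalizedQC K c F DF) {x : Euc 3} (hx : x ≠ 0) : F x ≠ 0 :=
  F.ne_zero_of_ne_zero h.map_zero hx

lemma energy (h : IsNormalizedQC K c F DF) {k : ℝ → ℝ} (hk : Continuous k)
    (hc : HasCompactSupport k) (hk0 : ∀ s, 0 ≤ k s) :
    Integrable (fun x => k (Real.log ‖F x‖) * (‖F x‖ ^ 3)⁻¹ * ‖DF x‖ ^ 3) ∧
    ∫ x, k (Real.log ‖F x‖) * (‖F x‖ ^ 3)⁻¹ * ‖DF x‖ ^ 3 ≤ K * c * ∫ s, k s := by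
  obtain ⟨i, e⟩ := h.change k hk hc
  have hle : ∀ᵐ x, k (Real.log ‖F x‖) * (‖F x‖ ^ 3)⁻¹ * ‖DF x‖ ^ 3 ≤
      K * (k (Real.log ‖F x‖) * (‖F x‖ ^ 3)⁻¹ * (DF x).det) := by
    filter_upwards [h.dist] with x hx
    have : 0 ≤ k (Real.log ‖F x‖) * (‖F x‖ ^ 3)⁻¹ := mul_nonneg (hk0 _) (by positivity)
    nlinarith
  have i2 : Integrable (fun x => k (Real.log ‖F x‖) * (‖F x‖ ^ 3)⁻¹ * ‖DF x‖ ^ 3) := by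
    refine (i.const_mul K).mono' ?_ ?_
    · exact ((continuous_comp_log_norm hk hc).comp F.continuous).aestronglyMeasurable.mul
        (h.sob.meas.norm.pow 3)
    · filter_upwards [hle] with x hx
      rwa [Real.norm_of_nonneg]
      have := hk0 (Real.log ‖F x‖)
      positivity
  refine ⟨i2, ?_⟩
  have := integral_mono_ae i2 (i.const_mul K) hle
  rwa [integral_const_mul, e, ← mul_assoc] at this

end IsNormalizedQC

/-- A smooth radial cutoff with prescribed logarithmic slope. -/
lemma exists_log_cutoff {k : ℝ → ℝ} (hk : Continuous k) {a b : ℝ} (hab : b ≤ a)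
    (hks : ∀ s, s ∉ Icc b a → k s = 0) :
    ∃ w : Euc 3 → ℝ, ContDiff ℝ 1 w ∧ (∀ y, Real.exp a ≤ ‖y‖ → w y = 0) ∧
      (∀ y, ‖y‖ ≤ Real.exp b → w y = ∫ s, k s) ∧
      ∀ y, ‖fderiv ℝ w y‖ ≤ |k (Real.log ‖y‖)| * ‖y‖⁻¹ := by
  obtain ⟨hg, hd⟩ := exists_primitive hk b
  set g := fun s => ∫ u in b..s, k u
  have hg0 : ∀ s ≤ b, g s = 0 := fun s hs => primitive_eq_zero hks hs
  have hg1 : ∀ s, a ≤ s → g s = ∫ s, k s := fun s hs => primitive_eq_integral hks (hab.trans hs) hs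
  set w : Euc 3 → ℝ := fun y => (∫ s, k s) - g (Real.log (max ‖y‖ (Real.exp b))) with hw
  have hlow : ∀ y, ‖y‖ ≤ Real.exp b → w y = ∫ s, k s := fun y hy => by
    rw [hw]
    simp only
    rw [max_eq_right hy, Real.log_exp, hg0 b le_rfl, sub_zero]
  have hne : ∀ y, y ≠ 0 → w y = (∫ s, k s) - g (Real.log ‖y‖) := fun y hy => by
    rcases le_total ‖y‖ (Real.exp b) with h | h
    · rw [hlow y h, hg0 _ ((Real.log_le_iff_le_exp (norm_pos_iff.2 hy)).2 h), sub_zero]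
    · rw [hw]
      simp only
      rw [max_eq_left h]
  have hev0 : w =ᶠ[𝓝 0] fun _ => ∫ s, k s := by
    filter_upwards [ball_mem_nhds (0 : Euc 3) (Real.exp_pos b)] with y hy
    exact hlow y (mem_ball_zero_iff.1 hy).le
  have hev : ∀ y, y ≠ 0 → w =ᶠ[𝓝 y] fun y => (∫ s, k s) - g (Real.log ‖y‖) := fun y hy => by
    filter_upwards [isOpen_compl_singleton.mem_nhds hy] with z hz using hne z hz
  refine ⟨w, ?_, fun y hy => ?_, hlow, fun y => ?_⟩
  · rw [contDiff_iff_contDiffAt]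
    intro y
    rcases eq_or_ne y 0 with rfl | hy
    · exact contDiffAt_const.congr_of_eventuallyEq hev0
    · refine ContDiffAt.congr_of_eventuallyEq ?_ (hev y hy)
      refine contDiffAt_const.sub ((contDiffOn_comp_log_norm (U := univ) hg).contDiffAt ?_)
      exact (isOpen_univ.sdiff isClosed_singleton).mem_nhds ⟨mem_univ _, hy⟩
  · have h0 : 0 < ‖y‖ := (Real.exp_pos a).trans_le hy
    rw [hne y (norm_pos_iff.1 h0), hg1 _ ((Real.le_log_iff_exp_le h0).2 hy), sub_self]
  · rcases eq_or_ne y 0 with rfl | hy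
    · rw [EventuallyEq.fderiv_eq (𝕜 := ℝ) hev0]
      simp
    · rw [EventuallyEq.fderiv_eq (𝕜 := ℝ) (hev y hy), fderiv_const_sub, norm_neg]
      exact (norm_fderiv_comp_log_norm hd hy).le

namespace IsNormalizedQC

variable {K c : ℝ} {F : Euc 3 ≃ₜ Euc 3} {DF : Euc 3 → Euc 3 →L[ℝ] Euc 3}

lemma log_norm_lower_step (h : IsNormalizedQC K c F DF) {R a : ℝ} (hR : 0 < R)
    (hout : ∀ x, 3 * R ≤ ‖x‖ → a ≤ Real.log ‖F x‖) {x : Euc 3} (hx : R ≤ ‖x‖) :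
    a - (4 + 12288 * (K * c)) ≤ Real.log ‖F x‖ := by
  by_contra! hlt
  set b := Real.log ‖F x‖ with hb
  have hKc : 0 < K * c := mul_pos h.pos h.c_pos
  have hab : 4 < a - b := by nlinarith
  have hx0 : x ≠ 0 := norm_pos_iff.1 (hR.trans_le hx)
  have hlog : ∀ y, y ≠ 0 → Real.exp (Real.log ‖F y‖) = ‖F y‖ := fun y hy =>
    Real.exp_log (norm_pos_iff.2 (h.ne_zero hy))
  have hx3 : ‖x‖ ≤ 3 * R := by
    by_contra! h3
    linarith [hout x h3.le]
  obtain ⟨i, hi⟩ : ∃ i, R / 2 ≤ |x i| := by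
    by_contra! hall
    have h1 := norm_sq_euc x
    have h2 : ∀ i, x i ^ 2 ≤ (R / 2) ^ 2 := fun i => sq_le_sq' (by linarith [(abs_lt.1 (hall i)).1])
      (abs_lt.1 (hall i)).2.le
    have h3 : R ^ 2 ≤ ‖x‖ ^ 2 := by gcongr
    nlinarith [h2 0, h2 1, h2 2]
  have hconn : IsPreconnected ((fun y : Euc 3 => y i) '' (F.symm '' closedBall 0 (Real.exp b))) :=
    ((convex_closedBall (0 : Euc 3) _).isPreconnected.image _ F.symm.continuous.continuousOn).image _
      (by fun_prop)
  have hsub : uIcc 0 (x i) ⊆ (fun y : Euc 3 => y i) '' (F.symm '' closedBall 0 (Real.exp b)) := by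
    refine hconn.ordConnected.uIcc_subset ⟨0, ⟨0, by simp [Real.exp_nonneg], ?_⟩, rfl⟩
      ⟨x, ⟨F x, ?_, F.symm_apply_apply x⟩, rfl⟩
    · rw [F.symm_apply_eq, h.map_zero]
    · rw [mem_closedBall_zero_iff, hb, hlog x hx0]
  have hQ : ∀ s ∈ uIcc 0 (x i), ∃ y : Euc 3, y i = s ∧ ‖y‖ ≤ 3 * R ∧ ‖F y‖ ≤ Real.exp b := by
    intro s hs
    obtain ⟨y, ⟨z, hz, rfl⟩, rfl⟩ := hsub hs
    refine ⟨F.symm z, rfl, ?_, by simpa using hz⟩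
    by_contra! h3
    have h4 := hout _ h3.le
    have h5 : F.symm z ≠ 0 := norm_pos_iff.1 (by linarith)
    have h6 : ‖F (F.symm z)‖ ≤ Real.exp b := by simpa using hz
    rw [← Real.log_le_iff_le_exp (norm_pos_iff.2 (h.ne_zero h5))] at h6
    linarith
  obtain ⟨lo, hi', hlohi, hQ'⟩ : ∃ lo hi : ℝ, R / 2 ≤ hi - lo ∧ Icc lo hi ⊆ uIcc 0 (x i) := by
    rcases le_total 0 (x i) with h0 | h0
    · exact ⟨0, x i, by rwa [abs_of_nonneg h0, ← sub_zero (x i)] at hi, (uIcc_of_le h0).ge⟩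
    · exact ⟨x i, 0, by rwa [abs_of_nonpos h0, ← zero_sub (x i)] at hi, (uIcc_of_ge h0).ge⟩
  set I := ∫ s, plateau (b + 1) (a - 1) s with hI
  have hI1 : (a - b) / 2 ≤ I := by
    have := le_integral_plateau (a := b + 1) (b := a - 1) (by linarith)
    linarith
  have hI0 : 0 < I := by linarith
  set k : ℝ → ℝ := fun s => I⁻¹ * plateau (b + 1) (a - 1) s with hkdef
  have hk : Continuous k := (continuous_plateau _ _).const_mul _
  have hks : ∀ s, s ∉ Icc b a → k s = 0 := fun s hs => by
    rw [hkdef]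
    simp only
    rw [plateau_eq_zero (by simpa using hs), mul_zero]
  have hkc : HasCompactSupport k := HasCompactSupport.intro isCompact_Icc fun s hs => hks s hs
  have hk0 : ∀ s, 0 ≤ k s := fun s => mul_nonneg (inv_nonneg.2 hI0.le) plateau_nonneg
  have hkI : ∀ s, k s ≤ I⁻¹ := fun s =>
    mul_le_of_le_one_right (inv_nonneg.2 hI0.le) plateau_le_one
  have hk1 : ∫ s, k s = 1 := by
    rw [hkdef, integral_const_mul, inv_mul_cancel₀ hI0.ne']
  obtain ⟨w, hw, hw0, hw1, hwd⟩ := exists_log_cutoff hk (by linarith) hks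
  rw [hk1] at hw1
  have hwc : HasCompactSupport w := by
    refine HasCompactSupport.intro (isCompact_closedBall (0 : Euc 3) (Real.exp a)) fun y hy => ?_
    rw [mem_closedBall_zero_iff, not_le] at hy
    exact hw0 y hy.le
  have hwu : UniformContinuous w := hwc.uniformContinuous_of_continuous hw.continuous
  obtain ⟨G, hG, -⟩ := h.sob.exists_approx
  set θ : Euc 3 → ℝ := fun y => max 0 (min 1 (9 * R + 1 - ‖y‖)) with hθ
  have hθc : Continuous θ := by fun_prop
  have hθ0 : ∀ y, 0 ≤ θ y := fun y => le_max_left _ _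
  have hθ1 : ∀ y, θ y ≤ 1 := fun y => max_le zero_le_one (min_le_left _ _)
  have hθs : HasCompactSupport θ := by
    refine HasCompactSupport.intro (isCompact_closedBall (0 : Euc 3) (9 * R + 1)) fun y hy => ?_
    rw [mem_closedBall_zero_iff, not_le] at hy
    exact max_eq_left ((min_le_right _ _).trans (by linarith))
  have hθe : ∀ y ∈ closedBall (0 : Euc 3) (9 * R), θ y = 1 := fun y hy => by
    rw [mem_closedBall_zero_iff] at hy
    rw [hθ]
    simp only
    rw [min_eq_left (by linarith), max_eq_right zero_le_one]
  have hk3 : Continuous fun s => k s ^ 3 := hk.pow 3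
  have hk3c : HasCompactSupport fun s => k s ^ 3 :=
    HasCompactSupport.intro isCompact_Icc fun s hs => by
      rw [hks s hs]
      norm_num
  obtain ⟨hint, hlim⟩ := h.sob.tendsto_integral hG cubicLip_norm_pow hθc hθs isOpen_univ
    (continuous_comp_log_norm hk3 hk3c).continuousOn fun _ _ => mem_univ _
  have hev : ∀ᶠ n in atTop, 1 / 3072 ≤ ∫ y, θ y * (k (Real.log ‖G n y‖) ^ 3 * (‖G n y‖ ^ 3)⁻¹) *
      ‖fderiv ℝ (G n) y‖ ^ 3 := by
    have hunif := Metric.tendstoUniformlyOn_iff.1 (hwu.comp_tendstoUniformlyOn (hG.unif (9 * R)))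
      (1 / 4) (by norm_num)
    filter_upwards [hunif] with n hn
    have hGn : ContDiff ℝ 1 (G n) := (hG.smooth n).of_le (by norm_num)
    have hv : ContDiff ℝ 1 (w ∘ G n) := hw.comp hGn
    have hn' : ∀ y, ‖y‖ ≤ 9 * R → |w (F y) - w (G n y)| < 1 / 4 := fun y hy =>
      hn y (mem_closedBall_zero_iff.2 hy)
    have hcap := capacity_lower_bound hv hR hlohi (i := i) (fun s hs => by
      obtain ⟨y, hys, hy3, hFy⟩ := hQ s (hQ' hs)
      refine ⟨y, hys, hy3, ?_⟩
      have := (abs_lt.1 (hn' y (by linarith))).2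
      rw [hw1 _ hFy] at this
      simp only [Function.comp_apply]
      linarith) (fun y hy hy9 => by
      have h1 := hout y hy
      have h2 : y ≠ 0 := norm_pos_iff.1 (by linarith)
      have := (abs_lt.1 (hn' y hy9)).1
      rw [Real.le_log_iff_exp_le (norm_pos_iff.2 (h.ne_zero h2))] at h1
      rw [hw0 _ h1] at this
      simp only [Function.comp_apply]
      linarith)
    refine hcap.trans ?_
    have hcont : Continuous fun y => θ y * (k (Real.log ‖G n y‖) ^ 3 * (‖G n y‖ ^ 3)⁻¹) *
        ‖fderiv ℝ (G n) y‖ ^ 3 :=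
      (hθc.mul ((continuous_comp_log_norm hk3 hk3c).comp hGn.continuous)).mul
        ((hGn.continuous_fderiv one_ne_zero).norm.pow 3)
    have hint2 : Integrable fun y => θ y * (k (Real.log ‖G n y‖) ^ 3 * (‖G n y‖ ^ 3)⁻¹) *
        ‖fderiv ℝ (G n) y‖ ^ 3 :=
      hcont.integrable_of_hasCompactSupport (hθs.mul_right.mul_right)
    have hnn : ∀ y, 0 ≤ θ y * (k (Real.log ‖G n y‖) ^ 3 * (‖G n y‖ ^ 3)⁻¹) *
        ‖fderiv ℝ (G n) y‖ ^ 3 := fun y => by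
      have := hθ0 y
      have := hk0 (Real.log ‖G n y‖)
      positivity
    refine le_trans ?_ (setIntegral_le_integral (s := closedBall (0 : Euc 3) (9 * R)) hint2
      (ae_of_all _ hnn))
    refine setIntegral_mono_on ?_ hint2.integrableOn measurableSet_closedBall fun y hy => ?_
    · exact ((hv.continuous_fderiv one_ne_zero).norm.pow 3).locallyIntegrable.integrableOn_isCompact
        (isCompact_closedBall _ _)
    · rw [hθe y hy, one_mul, fderiv_comp y (hw.differentiable one_ne_zero _)
        (hGn.differentiable one_ne_zero _)]
      have h1 := (fderiv ℝ w (G n y)).opNorm_comp_le (fderiv ℝ (G n) y)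
      have h2 := hwd (G n y)
      rw [abs_of_nonneg (hk0 _)] at h2
      calc _ ≤ (k (Real.log ‖G n y‖) * ‖G n y‖⁻¹ * ‖fderiv ℝ (G n) y‖) ^ 3 := by
            gcongr
            exact h1.trans (by gcongr)
        _ = _ := by
            rw [mul_pow, mul_pow, inv_pow]
  have hge := ge_of_tendsto hlim hev
  obtain ⟨iE, hE⟩ := h.energy hk hkc hk0
  have hle : ∫ y, θ y * (k (Real.log ‖F y‖) ^ 3 * (‖F y‖ ^ 3)⁻¹) * ‖DF y‖ ^ 3 ≤
      (I⁻¹) ^ 2 * (K * c) := by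
    calc _ ≤ ∫ y, (I⁻¹) ^ 2 * (k (Real.log ‖F y‖) * (‖F y‖ ^ 3)⁻¹ * ‖DF y‖ ^ 3) := by
          refine integral_mono hint (iE.const_mul _) fun y => ?_
          have h1 := hk0 (Real.log ‖F y‖)
          have h2 := hkI (Real.log ‖F y‖)
          have h3 := hθ1 y
          have h4 := hθ0 y
          calc _ = θ y * k (Real.log ‖F y‖) ^ 2 * (k (Real.log ‖F y‖) * (‖F y‖ ^ 3)⁻¹ * ‖DF y‖ ^ 3) := by
                ring
            _ ≤ 1 * (I⁻¹) ^ 2 * (k (Real.log ‖F y‖) * (‖F y‖ ^ 3)⁻¹ * ‖DF y‖ ^ 3) := by gcongr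
            _ = _ := by rw [one_mul]
      _ ≤ _ := by
          rw [integral_const_mul]
          rw [hk1, mul_one] at hE
          gcongr
  have hfin := hge.trans hle
  rw [inv_pow, inv_mul_eq_div, le_div_iff₀ (by positivity)] at hfin
  have : ((a - b) / 2) ^ 2 ≤ I ^ 2 := by gcongr
  nlinarith

/-- A power lower bound for the modulus of a quasiconformal map. -/
lemma exists_log_norm_lower (h : IsNormalizedQC K c F DF) :
    ∃ C, 0 ≤ C ∧ ∀ t, 0 ≤ t → ∀ x : Euc 3, Real.exp (-t) ≤ ‖x‖ → - (C * (t + 1)) ≤ Real.log ‖F x‖ := by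
  obtain ⟨M, hM⟩ : ∃ M, ∀ x : Euc 3, 1 ≤ ‖x‖ → M ≤ Real.log ‖F x‖ := by
    have hcont : Tendsto F.symm (𝓝 0) (𝓝 0) := by
      have := F.symm.continuous.tendsto 0
      rwa [show F.symm 0 = 0 by rw [F.symm_apply_eq, h.map_zero]] at this
    obtain ⟨δ, hδ, hball⟩ := Metric.mem_nhds_iff.1 (hcont (ball_mem_nhds 0 one_pos))
    refine ⟨Real.log δ, fun x hx => Real.log_le_log hδ ?_⟩
    by_contra! hlt
    have := hball (mem_ball_zero_iff.2 hlt)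
    simp only [mem_preimage, F.symm_apply_apply, mem_ball_zero_iff] at this
    linarith
  set D := 4 + 12288 * (K * c) with hD
  have hD0 : 0 ≤ D := by
    have := mul_pos h.pos h.c_pos
    positivity
  have hstep : ∀ j : ℕ, ∀ x : Euc 3, (3 ^ j : ℝ)⁻¹ ≤ ‖x‖ → M - j * D ≤ Real.log ‖F x‖ := by
    intro j
    induction j with
    | zero => simpa using hM
    | succ j ih =>
      intro x hx
      have := h.log_norm_lower_step (R := (3 ^ (j + 1) : ℝ)⁻¹) (by positivity) (fun y hy => ih y (by
        rwa [pow_succ, mul_inv, mul_comm _ (3 : ℝ)⁻¹, mul_inv_cancel_left₀ (by norm_num)] at hy)) hx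
      push_cast
      linarith
  refine ⟨D + |M|, by positivity, fun t ht x hx => ?_⟩
  have hexp : (3 ^ ⌈t⌉₊ : ℝ)⁻¹ ≤ Real.exp (-t) := by
    rw [Real.exp_neg]
    refine inv_anti₀ (Real.exp_pos _) ?_
    calc Real.exp t ≤ Real.exp ⌈t⌉₊ := Real.exp_le_exp.2 (Nat.le_ceil t)
      _ = Real.exp 1 ^ ⌈t⌉₊ := by rw [← Real.exp_nat_mul, mul_one]
      _ ≤ _ := by
        gcongr
        linarith [Real.exp_one_lt_d9]
  have h1 := hstep _ x (hexp.trans hx)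
  have h2 := (Nat.ceil_lt_add_one ht).le
  have h3 := neg_abs_le M
  nlinarith [abs_nonneg M]

end IsNormalizedQC

/-- The parameter of the `p`-spiral at distance `exp σ` from the origin. -/
def shellPhase (p σ : ℝ) : ℝ := Real.exp (-(σ / p))

/-- The horizontal coordinate of `x` along the direction of the spiral. -/
def shellTangent (p : ℝ) (x : Euc 3) : ℝ :=
  x 0 * Real.cos (shellPhase p (Real.log ‖x‖)) + x 1 * Real.sin (shellPhase p (Real.log ‖x‖))

/-- The horizontal coordinate of `x` orthogonal to the direction of the spiral. -/
def shellNormal (p : ℝ) (x : Euc 3) : ℝ :=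
  x 0 * Real.sin (shellPhase p (Real.log ‖x‖)) - x 1 * Real.cos (shellPhase p (Real.log ‖x‖))

lemma shellPhase_pos (p σ : ℝ) : 0 < shellPhase p σ := Real.exp_pos _

lemma hasDerivAt_shellPhase (p σ : ℝ) :
    HasDerivAt (shellPhase p) (-(shellPhase p σ / p)) σ := by
  have h : HasDerivAt (fun σ : ℝ => -(σ / p)) (-(1 / p)) σ := ((hasDerivAt_id σ).div_const p).fun_neg
  exact h.exp.congr_deriv (by simp only [shellPhase]; ring)

lemma contDiff_shellPhase (p : ℝ) : ContDiff ℝ 1 (shellPhase p) := by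
  unfold shellPhase
  fun_prop

lemma mem_spiralShell_iff {p : ℝ} (hp : 0 < p) {x : Euc 3} :
    x ∈ spiralShell p ↔ x ≠ 0 ∧ ‖x‖ ≤ 1 ∧ shellNormal p x = 0 := by
  constructor
  · rintro ⟨u, v, hu, hv, hx⟩
    have hu0 : 0 < u := one_pos.trans_le hu
    have h0 : x 0 = u ^ (-p) * Real.cos u * Real.sin v := by rw [hx]; rfl
    have h1 : x 1 = u ^ (-p) * Real.sin u * Real.sin v := by rw [hx]; rfl
    have h2 : x 2 = u ^ (-p) * Real.cos v := by rw [hx]; rfl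
    have hr : 0 < u ^ (-p) := Real.rpow_pos_of_pos hu0 _
    have hn : ‖x‖ = u ^ (-p) := by
      rw [← sq_eq_sq₀ (norm_nonneg _) hr.le, norm_sq_euc, h0, h1, h2]
      have e1 := Real.sin_sq_add_cos_sq u
      have e2 := Real.sin_sq_add_cos_sq v
      linear_combination (u ^ (-p)) ^ 2 * Real.sin v ^ 2 * e1 + (u ^ (-p)) ^ 2 * e2
    have hph : shellPhase p (Real.log ‖x‖) = u := by
      rw [shellPhase, hn, Real.log_rpow hu0, neg_mul, neg_div, neg_neg, mul_div_cancel_left₀ _ hp.ne',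
        Real.exp_log hu0]
    refine ⟨norm_pos_iff.1 (hn ▸ hr), ?_, ?_⟩
    · rw [hn]
      exact Real.rpow_le_one_of_one_le_of_nonpos hu (by linarith)
    · rw [shellNormal, hph, h0, h1]
      ring
  · rintro ⟨hx0, hx1, hB⟩
    have hr := norm_pos_iff.2 hx0
    set u := shellPhase p (Real.log ‖x‖) with hu
    have hu1 : 1 ≤ u := by
      rw [hu, shellPhase, Real.one_le_exp_iff, Left.nonneg_neg_iff]
      exact div_nonpos_of_nonpos_of_nonneg (Real.log_nonpos hr.le hx1) hp.le
    have hup : u ^ (-p) = ‖x‖ := by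
      rw [hu, shellPhase, ← Real.exp_mul, neg_mul_neg, div_mul_cancel₀ _ hp.ne', Real.exp_log hr]
    set a := shellTangent p x with ha
    rw [shellTangent, ← hu] at ha
    rw [shellNormal, ← hu] at hB
    have hcs := Real.sin_sq_add_cos_sq u
    have h0 : x 0 = a * Real.cos u := by
      rw [ha]
      linear_combination (-x 0) * hcs + Real.sin u * hB
    have h1 : x 1 = a * Real.sin u := by
      rw [ha]
      linear_combination (-x 1) * hcs - Real.cos u * hB
    set z : ℂ := ⟨x 2, a⟩ with hz
    have hzn : ‖z‖ = ‖x‖ := by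
      rw [← sq_eq_sq₀ (norm_nonneg _) (norm_nonneg _), norm_sq_euc, Complex.sq_norm, Complex.normSq_mk,
        h0, h1]
      linear_combination (-a ^ 2) * hcs
    have hc := Complex.norm_mul_cos_arg z
    have hs := Complex.norm_mul_sin_arg z
    rw [hzn] at hc hs
    refine ⟨u, z.arg + 2 * Real.pi, hu1, ?_, ?_⟩
    · linarith [Complex.neg_pi_lt_arg z, Real.pi_gt_three]
    · rw [hup, Real.sin_add_two_pi, Real.cos_add_two_pi, mul_assoc, mul_assoc,
        mul_left_comm, mul_left_comm ‖x‖, hs, hc]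
      ext j
      fin_cases j
      · simpa [mul_comm] using h0
      · simpa [mul_comm] using h1
      · rfl

lemma continuousAt_shellNormal {p : ℝ} {x : Euc 3} (hx : x ≠ 0) :
    ContinuousAt (shellNormal p) x := by
  have hl : ContinuousAt (fun x : Euc 3 => shellPhase p (Real.log ‖x‖)) x :=
    (contDiff_shellPhase p).continuous.continuousAt.comp
      (continuous_norm.continuousAt.log (norm_ne_zero_iff.2 hx))
  have h0 : ∀ i, ContinuousAt (fun x : Euc 3 => x i) x := fun i => by fun_prop
  exact ((h0 0).mul (Real.continuous_sin.continuousAt.comp hl)).sub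
    ((h0 1).mul (Real.continuous_cos.continuousAt.comp hl))

lemma closure_spiralShell_diff {p : ℝ} (hp : 0 < p) :
    closure (spiralShell p) \ spiralShell p = {0} := by
  ext x
  simp only [Set.mem_sdiff, mem_singleton_iff]
  constructor
  · rintro ⟨hc, hn⟩
    by_contra hx
    refine hn ((mem_spiralShell_iff hp).2 ⟨hx, ?_, ?_⟩)
    · have : closure (spiralShell p) ⊆ closedBall 0 1 :=
        closure_minimal (fun y hy => mem_closedBall_zero_iff.2 ((mem_spiralShell_iff hp).1 hy).2.1)
          isClosed_closedBall
      exact mem_closedBall_zero_iff.1 (this hc)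
    · by_contra hB
      obtain ⟨y, hy1, hy2⟩ := ((mem_closure_iff_frequently.1 hc).and_eventually
        ((continuousAt_shellNormal hx).eventually_ne hB)).exists
      exact hy2 ((mem_spiralShell_iff hp).1 hy1).2.2
  · rintro rfl
    refine ⟨Metric.mem_closure_iff.2 fun ε hε => ?_, fun h => ((mem_spiralShell_iff hp).1 h).1 rfl⟩
    have hn : ‖min (ε / 2) 1 • stdVec 2‖ = min (ε / 2) 1 := by
      rw [norm_smul, Real.norm_of_nonneg (by positivity)]
      simp [stdVec]
    have hpos : 0 < min (ε / 2) 1 := by positivity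
    refine ⟨min (ε / 2) 1 • stdVec 2, (mem_spiralShell_iff hp).2 ⟨?_, ?_, ?_⟩, ?_⟩
    · rw [← norm_pos_iff, hn]
      exact hpos
    · rw [hn]
      exact min_le_right _ _
    · simp [shellNormal, stdVec]
    · rw [dist_zero_left, hn]
      exact (min_le_left _ _).trans_lt (by linarith)

lemma map_zero_of_image_spiralShell {p q : ℝ} (hp : 0 < p) (hq : 0 < q) (F : Euc 3 ≃ₜ Euc 3)
    (h : F '' spiralShell p = spiralShell q) : F 0 = 0 := by
  have h1 : F '' (closure (spiralShell p) \ spiralShell p) = {0} := by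
    rw [image_sdiff F.injective, F.image_closure, h, closure_spiralShell_diff hq]
  rwa [closure_spiralShell_diff hp, image_singleton, singleton_eq_singleton_iff] at h1

/-- The angular distance to the spiral shell, as a multivalued function on its complement. -/
def shellAngle (q : ℝ) (y : Euc 3) : ℝ := Real.arctan (shellTangent q y / shellNormal q y)

lemma abs_shellAngle_le (q : ℝ) (y : Euc 3) : |shellAngle q y| ≤ Real.pi / 2 :=
  abs_le.2 ⟨(Real.neg_pi_div_two_lt_arctan _).le, (Real.arctan_lt_pi_div_two _).le⟩

lemma contDiffOn_mul_comp_log_norm {g : ℝ → ℝ} (hg : ContDiff ℝ 1 g) (i : Fin 3) (U : Set (Euc 3)) :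
    ContDiffOn ℝ 1 (fun y : Euc 3 => y i * g (Real.log ‖y‖)) (U \ {0}) :=
  (EuclideanSpace.proj (𝕜 := ℝ) i : Euc 3 →L[ℝ] ℝ).contDiff.contDiffOn.mul
    (contDiffOn_comp_log_norm hg)

lemma hasFDerivAt_mul_comp_log_norm {g k : ℝ → ℝ} (hg : ContDiff ℝ 1 g)
    (hd : ∀ s, HasDerivAt g (k s) s) (i : Fin 3) {y : Euc 3} (hy : y ≠ 0) :
    HasFDerivAt (fun y : Euc 3 => y i * g (Real.log ‖y‖))
      (y i • (k (Real.log ‖y‖) * (‖y‖ ^ 2)⁻¹) • innerSL ℝ y +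
        g (Real.log ‖y‖) • (EuclideanSpace.proj (𝕜 := ℝ) i : Euc 3 →L[ℝ] ℝ)) y := by
  have h1 : DifferentiableAt ℝ (fun y : Euc 3 => g (Real.log ‖y‖)) y :=
    ((contDiffOn_comp_log_norm (U := univ) hg).contDiffAt
      ((isOpen_univ.sdiff isClosed_singleton).mem_nhds ⟨mem_univ _, hy⟩)).differentiableAt one_ne_zero
  have h2 := h1.hasFDerivAt
  rw [fderiv_comp_log_norm hd hy] at h2
  exact (EuclideanSpace.proj (𝕜 := ℝ) i : Euc 3 →L[ℝ] ℝ).hasFDerivAt.mul h2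

lemma contDiffOn_shellAngle (q : ℝ) {U : Set (Euc 3)} (hU : ∀ y ∈ U, shellNormal q y ≠ 0) :
    ContDiffOn ℝ 1 (shellAngle q) (U \ {0}) := by
  have hs := contDiff_shellPhase q
  have hsin : ContDiff ℝ 1 fun σ => Real.sin (shellPhase q σ) := Real.contDiff_sin.comp hs
  have hcos : ContDiff ℝ 1 fun σ => Real.cos (shellPhase q σ) := Real.contDiff_cos.comp hs
  refine Real.contDiff_arctan.comp_contDiffOn (ContDiffOn.div ?_ ?_ fun y hy => hU y hy.1)
  · exact (contDiffOn_mul_comp_log_norm hcos 0 U).add (contDiffOn_mul_comp_log_norm hsin 1 U)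
  · exact (contDiffOn_mul_comp_log_norm hsin 0 U).sub (contDiffOn_mul_comp_log_norm hcos 1 U)

lemma isOpen_shellNormal_ne_zero (q : ℝ) : IsOpen {y : Euc 3 | y ≠ 0 ∧ shellNormal q y ≠ 0} := by
  rw [isOpen_iff_mem_nhds]
  rintro y ⟨hy, hB⟩
  filter_upwards [isOpen_compl_singleton.mem_nhds hy, (continuousAt_shellNormal hy).eventually_ne hB]
    with z h1 h2 using ⟨h1, h2⟩

lemma fderiv_shellAngle_self (q : ℝ) {y : Euc 3} (hy : y ≠ 0) (hB : shellNormal q y ≠ 0) :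
    fderiv ℝ (shellAngle q) y y = shellPhase q (Real.log ‖y‖) / q := by
  have hs := contDiff_shellPhase q
  have hsin : ContDiff ℝ 1 fun σ => Real.sin (shellPhase q σ) := Real.contDiff_sin.comp hs
  have hcos : ContDiff ℝ 1 fun σ => Real.cos (shellPhase q σ) := Real.contDiff_cos.comp hs
  have hdsin := fun σ => (hasDerivAt_shellPhase q σ).sin
  have hdcos := fun σ => (hasDerivAt_shellPhase q σ).cos
  have hA := (hasFDerivAt_mul_comp_log_norm hcos hdcos 0 hy).add
    (hasFDerivAt_mul_comp_log_norm hsin hdsin 1 hy)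
  have hB' := (hasFDerivAt_mul_comp_log_norm hsin hdsin 0 hy).sub
    (hasFDerivAt_mul_comp_log_norm hcos hdcos 1 hy)
  have hn : ‖y‖ ≠ 0 := norm_ne_zero_iff.2 hy
  have hγ : HasDerivAt (fun τ : ℝ => y + τ • y) y 0 := by
    simpa using ((hasDerivAt_id (0 : ℝ)).smul_const y).const_add y
  have hγ0 : y = y + (0 : ℝ) • y := by simp
  have hA1 : HasDerivAt (fun τ : ℝ => shellTangent q (y + τ • y))
      (shellTangent q y + shellNormal q y * (shellPhase q (Real.log ‖y‖) / q)) 0 := by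
    refine (hA.comp_hasDerivAt_of_eq 0 hγ hγ0).congr_deriv ?_
    simp [shellTangent, shellNormal]
    field_simp
    ring
  have hB1 : HasDerivAt (fun τ : ℝ => shellNormal q (y + τ • y))
      (shellNormal q y - shellTangent q y * (shellPhase q (Real.log ‖y‖) / q)) 0 := by
    refine (hB'.comp_hasDerivAt_of_eq 0 hγ hγ0).congr_deriv ?_
    simp [shellTangent, shellNormal]
    field_simp
    ring
  have h1 := (hA1.fun_div hB1 (by simpa using hB)).arctan
  have hdiff : DifferentiableAt ℝ (shellAngle q) y := by
    refine ((contDiffOn_shellAngle q (U := {z | z ≠ 0 ∧ shellNormal q z ≠ 0}) fun z hz => hz.2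
      ).contDiffAt ?_).differentiableAt one_ne_zero
    filter_upwards [(isOpen_shellNormal_ne_zero q).mem_nhds ⟨hy, hB⟩] with z hz using ⟨hz, hz.1⟩
  rw [(hdiff.hasFDerivAt.comp_hasDerivAt_of_eq 0 hγ hγ0).unique h1]
  simp only [zero_smul, add_zero]
  have : 0 < shellNormal q y ^ 2 := by positivity
  have h2 : shellNormal q y ^ 2 + shellTangent q y ^ 2 ≠ 0 := by positivity
  field_simp
  ring

lemma lintegral_polar {f : Euc 3 → ℝ≥0∞} (hf : Measurable f) :
    ∫⁻ x, f x = ∫⁻ r : Ioi (0 : ℝ), ∫⁻ ω : sphere (0 : Euc 3) 1, f (r.1 • ω.1)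
      ∂(volume : Measure (Euc 3)).toSphere ∂Measure.volumeIoiPow 2 := by
  have hm := (volume : Measure (Euc 3)).measurePreserving_homeomorphUnitSphereProd
  rw [finrank_euclideanSpace_fin] at hm
  have hg : Measurable fun z : sphere (0 : Euc 3) 1 × Ioi (0 : ℝ) => f (z.2.1 • z.1.1) :=
    hf.comp (by fun_prop)
  rw [← lintegral_prod_symm _ hg.aemeasurable, ← hm.lintegral_comp hg]
  have h0 : ∀ x : ({0}ᶜ : Set (Euc 3)), f ((homeomorphUnitSphereProd (Euc 3) x).2.1 •
      (homeomorphUnitSphereProd (Euc 3) x).1.1) = f x := fun x => by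
    rw [← homeomorphUnitSphereProd_symm_apply_coe, Homeomorph.symm_apply_apply]
  simp only [h0]
  rw [lintegral_subtype_comap (measurableSet_singleton _).compl, restrict_compl_singleton]

lemma volume_le_of_slices {i : Fin 3} {m δ : ℝ} (hm : 1 / 2 ≤ |m|) {l : ℝ × ℝ → ℝ} {E : Set (Euc 3)}
    (hE : MeasurableSet E) (h : ∀ s p, slice i (s, p) ∈ E →
      p ∈ Icc (-1 : ℝ) 1 ×ˢ Icc (-1 : ℝ) 1 ∧ |m * s + l p| < δ) :
    volume E ≤ ENNReal.ofReal (16 * δ) := by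
  have hm0 : 0 < |m| := by linarith
  have hpre := (measurePreserving_slice i).measure_preimage hE.nullMeasurableSet
  rw [← hpre, Measure.volume_eq_prod, Measure.prod_apply_symm ((measurePreserving_slice i).measurable hE)]
  calc _ ≤ ∫⁻ p : ℝ × ℝ, (Icc (-1 : ℝ) 1 ×ˢ Icc (-1 : ℝ) 1).indicator
        (fun _ => ENNReal.ofReal (4 * δ)) p := by
        refine lintegral_mono fun p => ?_
        by_cases hp : p ∈ Icc (-1 : ℝ) 1 ×ˢ Icc (-1 : ℝ) 1
        · rw [indicator_of_mem hp]
          calc _ ≤ volume (closedBall (-l p / m) (2 * δ)) := by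
                refine measure_mono fun s hs => ?_
                have h1 := (h s p hs).2
                rw [mem_closedBall, Real.dist_eq]
                have h2 : m * s + l p = m * (s - -l p / m) := by
                  field_simp [abs_pos.1 hm0]
                  ring
                rw [h2, abs_mul] at h1
                nlinarith [abs_nonneg (s - -l p / m)]
            _ = _ := by
              rw [Real.volume_closedBall]
              ring_nf
        · rw [indicator_of_notMem hp]
          refine le_of_eq ?_
          convert measure_empty (μ := (volume : Measure ℝ))
          refine eq_empty_of_forall_notMem fun s hs => hp (h s p hs).1
    _ = _ := by
        rw [lintegral_indicator (measurableSet_Icc.prod measurableSet_Icc), setLIntegral_const,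
          Measure.volume_eq_prod, Measure.prod_prod, Real.volume_Icc, ← ENNReal.ofReal_mul (by norm_num),
          ← ENNReal.ofReal_mul' (by norm_num)]
        ring_nf

lemma volume_slab_le {a b : ℝ} (hab : a ^ 2 + b ^ 2 = 1) (δ : ℝ) :
    volume {x : Euc 3 | x ∈ ball 0 1 ∧ |a * x 0 + b * x 1| < δ} ≤ ENNReal.ofReal (16 * δ) := by
  have hE : MeasurableSet {x : Euc 3 | x ∈ ball 0 1 ∧ |a * x 0 + b * x 1| < δ} :=
    (isOpen_ball.inter (isOpen_lt (f := fun x : Euc 3 => |a * x 0 + b * x 1|) (by fun_prop)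
      continuous_const)).measurableSet
  have hbox : ∀ {i s p}, slice i (s, p) ∈ ball (0 : Euc 3) 1 → p ∈ Icc (-1 : ℝ) 1 ×ˢ Icc (-1 : ℝ) 1 := by
    intro i s p hp
    rw [mem_ball_zero_iff] at hp
    have h1 := norm_sq_slice i s p
    have h2 : ‖slice i (s, p)‖ ^ 2 ≤ 1 := pow_le_one₀ (norm_nonneg _) hp.le
    exact ⟨abs_le.1 ((sq_le_one_iff_abs_le_one _).1 (by nlinarith)),
      abs_le.1 ((sq_le_one_iff_abs_le_one _).1 (by nlinarith))⟩
  rcases le_total (1 / 2) |a| with ha | ha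
  · refine volume_le_of_slices (i := 0) (m := a) (l := fun p => b * p.1) ha hE fun s p h => ⟨hbox h.1, ?_⟩
    simpa [slice, Fin.insertNth, Fin.succAboveCases] using h.2
  · have hb : 1 / 2 ≤ |b| := by
      by_contra! hb
      have := sq_abs a
      have := sq_abs b
      nlinarith [abs_nonneg a, abs_nonneg b]
    refine volume_le_of_slices (i := 1) (m := b) (l := fun p => a * p.1) hb hE fun s p h => ⟨hbox h.1, ?_⟩
    have := h.2
    rw [add_comm]
    simpa [slice, Fin.insertNth, Fin.succAboveCases] using this

lemma toSphere_band_le {a b : ℝ} (hab : a ^ 2 + b ^ 2 = 1) (δ : ℝ) :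
    (volume : Measure (Euc 3)).toSphere {ω | |a * ω.1 0 + b * ω.1 1| < δ} ≤
      ENNReal.ofReal (48 * δ) := by
  have hE : MeasurableSet {ω : sphere (0 : Euc 3) 1 | |a * ω.1 0 + b * ω.1 1| < δ} :=
    (isOpen_lt (f := fun ω : sphere (0 : Euc 3) 1 => |a * ω.1 0 + b * ω.1 1|) (by fun_prop)
      continuous_const).measurableSet
  rw [Measure.toSphere_apply' _ hE, finrank_euclideanSpace_fin]
  calc _ ≤ ((3 : ℕ) : ℝ≥0∞) * ENNReal.ofReal (16 * δ) := by
        gcongr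
        refine (measure_mono ?_).trans (volume_slab_le hab δ)
        rintro _ ⟨r, hr, _, ⟨ω, hω, rfl⟩, rfl⟩
        have hn : ‖ω.1‖ = 1 := mem_sphere_zero_iff_norm.1 ω.2
        refine ⟨?_, ?_⟩
        · rw [mem_ball_zero_iff]
          simp only [norm_smul, hn, mul_one, Real.norm_of_nonneg hr.1.le]
          exact hr.2
        · have : a * (r • ω.1) 0 + b * (r • ω.1) 1 = r * (a * ω.1 0 + b * ω.1 1) := by
            simp
            ring
          simp only [this, abs_mul, abs_of_pos hr.1]
          have hω' : |a * ω.1 0 + b * ω.1 1| < δ := hω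
          nlinarith [hr.2, hr.1, abs_nonneg (a * ω.1 0 + b * ω.1 1)]
    _ = _ := by
        rw [← ENNReal.ofReal_natCast, ← ENNReal.ofReal_mul (by norm_num)]
        push_cast
        ring_nf

lemma integrable_comp_log_norm {k : ℝ → ℝ} (hk : Continuous k) (hc : HasCompactSupport k) :
    Integrable fun y : Euc 3 => k (Real.log ‖y‖) * (‖y‖ ^ 3)⁻¹ := by
  refine (continuous_comp_log_norm hk hc).integrable_of_hasCompactSupport ?_
  obtain ⟨M, hM⟩ := hc.isBounded.subset_closedBall 0
  refine HasCompactSupport.intro (isCompact_closedBall (0 : Euc 3) (Real.exp M)) fun y hy => ?_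
  rw [mem_closedBall_zero_iff, not_le] at hy
  rw [image_eq_zero_of_notMem_tsupport (f := k), zero_mul]
  intro h
  have h1 := (abs_le.1 (mem_closedBall_zero_iff.1 (hM h))).2
  have h0 : 0 < ‖y‖ := (Real.exp_pos M).trans hy
  rw [← Real.lt_log_iff_exp_lt h0] at hy
  linarith

lemma measurable_shellNormal (p : ℝ) : Measurable (shellNormal p) := by
  have h := (contDiff_shellPhase p).continuous.measurable
  have h0 : ∀ i, Measurable fun x : Euc 3 => x i := fun i => by fun_prop
  have hl : Measurable fun x : Euc 3 => shellPhase p (Real.log ‖x‖) :=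
    h.comp (Real.measurable_log.comp measurable_norm)
  exact ((h0 0).mul (Real.measurable_sin.comp hl)).sub ((h0 1).mul (Real.measurable_cos.comp hl))

/-- The neighbourhood of the shell of angular width `δ`. -/
def shellBand (p δ : ℝ) : Set (Euc 3) := {x | |shellNormal p x| < δ * ‖x‖}

lemma measurableSet_shellBand (p δ : ℝ) : MeasurableSet (shellBand p δ) :=
  measurableSet_lt (measurable_shellNormal p).abs (measurable_norm.const_mul δ)

lemma setIntegral_shellBand_le (p : ℝ) {δ : ℝ} (hδ : 0 ≤ δ) {k : ℝ → ℝ} (hk : Continuous k)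
    (hc : HasCompactSupport k) (hk0 : ∀ s, 0 ≤ k s) :
    ∫ x in shellBand p δ, k (Real.log ‖x‖) * (‖x‖ ^ 3)⁻¹ ≤ 48 * δ * ∫ s, k s := by
  have hi := integrable_comp_log_norm hk hc
  have hnn : ∀ x : Euc 3, 0 ≤ k (Real.log ‖x‖) * (‖x‖ ^ 3)⁻¹ := fun x =>
    mul_nonneg (hk0 _) (by positivity)
  have hI : 0 ≤ ∫ s, k s := integral_nonneg hk0
  set f : Euc 3 → ℝ≥0∞ := fun x => ENNReal.ofReal (k (Real.log ‖x‖) * (‖x‖ ^ 3)⁻¹) with hf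
  have hfm : Measurable f := (continuous_comp_log_norm hk hc).measurable.ennreal_ofReal
  set ρ : Ioi (0 : ℝ) → ℝ≥0∞ := fun r => ENNReal.ofReal (k (Real.log r) * (r.1 ^ 3)⁻¹) with hρ
  have hfr : ∀ (r : Ioi (0 : ℝ)) (ω : sphere (0 : Euc 3) 1), ‖r.1 • ω.1‖ = r.1 := fun r ω => by
    rw [norm_smul, mem_sphere_zero_iff_norm.1 ω.2, mul_one, Real.norm_of_nonneg r.2.le]
  have hfρ : ∀ (r : Ioi (0 : ℝ)) (ω : sphere (0 : Euc 3) 1), f (r.1 • ω.1) = ρ r := fun r ω => by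
    simp only [hf, hρ, hfr]
  have hρm : Measurable ρ := by
    refine ((hk.measurable.comp (Real.measurable_log.comp measurable_subtype_coe)).mul
      (measurable_subtype_coe.pow_const 3).inv).ennreal_ofReal
  have hJ : ∫⁻ r, ρ r ∂Measure.volumeIoiPow 2 = ENNReal.ofReal (∫ s, k s) := by
    have h1 := lintegral_polar hfm
    simp only [hfρ, lintegral_const] at h1
    rw [← ofReal_integral_eq_lintegral_ofReal hi (ae_of_all _ hnn), integral_comp_log_norm,
      lintegral_mul_const _ hρm, Measure.toSphere_apply_univ, finrank_euclideanSpace_fin,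
      mul_comm sphereArea, ENNReal.ofReal_mul hI, sphereArea,
      ENNReal.ofReal_mul (by norm_num), Measure.real, ENNReal.ofReal_toReal measure_ball_lt_top.ne] at h1
    refine ((ENNReal.mul_left_inj ?_ ?_).1 (h1.symm.trans ?_))
    rotate_left 2
    · congr 2
      norm_num
    · exact mul_ne_zero (by norm_num) (measure_ball_pos _ _ one_pos).ne'
    · exact ENNReal.mul_ne_top (by simp) measure_ball_lt_top.ne
  have key : ∫⁻ x in shellBand p δ, f x ≤ ENNReal.ofReal (48 * δ * ∫ s, k s) := by
    rw [← lintegral_indicator (measurableSet_shellBand p δ),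
      lintegral_polar (hfm.indicator (measurableSet_shellBand p δ))]
    calc _ ≤ ∫⁻ r, ρ r * ENNReal.ofReal (48 * δ) ∂Measure.volumeIoiPow 2 := by
          refine lintegral_mono fun r => ?_
          set u := shellPhase p (Real.log r)
          have hab : Real.sin u ^ 2 + (-Real.cos u) ^ 2 = 1 := by
            rw [neg_sq]
            exact Real.sin_sq_add_cos_sq u
          have hE : MeasurableSet {ω : sphere (0 : Euc 3) 1 |
              |Real.sin u * ω.1 0 + -Real.cos u * ω.1 1| < δ} :=
            (isOpen_lt (f := fun ω : sphere (0 : Euc 3) 1 =>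
              |Real.sin u * ω.1 0 + -Real.cos u * ω.1 1|) (by fun_prop) continuous_const).measurableSet
          calc _ ≤ ∫⁻ ω, {ω : sphere (0 : Euc 3) 1 |
                |Real.sin u * ω.1 0 + -Real.cos u * ω.1 1| < δ}.indicator (fun _ => ρ r) ω
                ∂(volume : Measure (Euc 3)).toSphere := by
                refine lintegral_mono fun ω => ?_
                by_cases hω : r.1 • ω.1 ∈ shellBand p δ
                · rw [indicator_of_mem hω, hfρ, indicator_of_mem]
                  have h1 : |shellNormal p (r.1 • ω.1)| < δ * ‖r.1 • ω.1‖ := hω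
                  rw [shellNormal, hfr] at h1
                  have h2 : (r.1 • ω.1) 0 * Real.sin u - (r.1 • ω.1) 1 * Real.cos u =
                      r.1 * (Real.sin u * ω.1 0 + -Real.cos u * ω.1 1) := by
                    simp
                    ring
                  rw [h2, abs_mul, abs_of_pos r.2, mul_comm δ] at h1
                  exact lt_of_mul_lt_mul_left h1 (mem_Ioi.1 r.2).le
                · rw [indicator_of_notMem hω]
                  exact zero_le
            _ = ρ r * _ := by rw [lintegral_indicator hE, setLIntegral_const]
            _ ≤ _ := by
              gcongr
              exact toSphere_band_le hab δ
      _ = _ := by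
          rw [lintegral_mul_const _ hρm, hJ, mul_comm, ENNReal.ofReal_mul (p := 48 * δ) (by positivity)]
  rw [← ofReal_integral_eq_lintegral_ofReal hi.integrableOn (ae_of_all _ hnn),
    ENNReal.ofReal_le_ofReal_iff (by positivity)] at key
  exact key

lemma exists_deriv_smoothTransition_le :
    ∃ L, 0 ≤ L ∧ (∀ u, |deriv Real.smoothTransition u| ≤ L) ∧
      ∀ u ∉ Icc (0 : ℝ) 1, deriv Real.smoothTransition u = 0 := by
  have h0 : ∀ u ∉ Icc (0 : ℝ) 1, deriv Real.smoothTransition u = 0 := fun u hu => by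
    have h : Real.smoothTransition =ᶠ[𝓝 u] fun _ => Real.smoothTransition u := by
      rcases lt_or_ge u 0 with h | h
      · filter_upwards [Iio_mem_nhds h] with v hv
        rw [Real.smoothTransition.zero_of_nonpos hv.le, Real.smoothTransition.zero_of_nonpos h.le]
      · have h1 : 1 < u := by
          by_contra! h1
          exact hu ⟨h, h1⟩
        filter_upwards [Ioi_mem_nhds h1] with v hv
        rw [Real.smoothTransition.one_of_one_le hv.le, Real.smoothTransition.one_of_one_le h1.le]
    rw [h.deriv_eq, deriv_const]
  obtain ⟨L, hL⟩ := isCompact_Icc.exists_bound_of_continuousOn (s := Icc (0 : ℝ) 1)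
    (f := deriv Real.smoothTransition)
    ((Real.smoothTransition.contDiff (n := 1)).continuous_deriv le_rfl).continuousOn
  have hL0 : 0 ≤ L := (norm_nonneg _).trans (hL 0 (by simp))
  refine ⟨L, hL0, fun u => ?_, h0⟩
  by_cases hu : u ∈ Icc (0 : ℝ) 1
  · exact hL u hu
  · rwa [h0 u hu, abs_zero]

lemma norm_fderiv_mul_comp_log_norm_le {g k : ℝ → ℝ} (hg : ContDiff ℝ 1 g)
    (hd : ∀ s, HasDerivAt g (k s) s) (i : Fin 3) {y : Euc 3} (hy : y ≠ 0) {A B : ℝ}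
    (hA : |g (Real.log ‖y‖)| ≤ A * ‖y‖⁻¹) (hB : |k (Real.log ‖y‖)| ≤ B * ‖y‖⁻¹) :
    ‖fderiv ℝ (fun y : Euc 3 => y i * g (Real.log ‖y‖)) y‖ ≤ (A + B) * ‖y‖⁻¹ := by
  have hn : 0 < ‖y‖ := norm_pos_iff.2 hy
  have hi : ∀ z : Euc 3, |z i| ≤ ‖z‖ := fun z => PiLp.norm_apply_le z i
  have hproj : ‖(EuclideanSpace.proj (𝕜 := ℝ) i : Euc 3 →L[ℝ] ℝ)‖ ≤ 1 :=
    ContinuousLinearMap.opNorm_le_bound _ zero_le_one fun z => by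
      rw [one_mul]
      exact hi z
  rw [(hasFDerivAt_mul_comp_log_norm hg hd i hy).fderiv]
  calc _ ≤ ‖y‖ * (B * ‖y‖⁻¹ * (‖y‖ ^ 2)⁻¹ * ‖y‖) + A * ‖y‖⁻¹ * 1 := by
        refine (norm_add_le _ _).trans (add_le_add ?_ ?_)
        · rw [norm_smul, norm_smul, norm_mul, innerSL_apply_norm, Real.norm_eq_abs,
            Real.norm_eq_abs, Real.norm_of_nonneg (by positivity : 0 ≤ (‖y‖ ^ 2)⁻¹)]
          gcongr
          exact hi y
        · rw [norm_smul, Real.norm_eq_abs]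
          exact mul_le_mul hA hproj (norm_nonneg _) ((abs_nonneg _).trans hA)
    _ = _ := by
        field_simp
        ring

/-- The sine of the angle of `x` to the cone through the spiral at radius `‖x‖`. -/
def shellRatio (p : ℝ) (x : Euc 3) : ℝ :=
  x 0 * (Real.exp (-Real.log ‖x‖) * Real.sin (shellPhase p (Real.log ‖x‖))) -
    x 1 * (Real.exp (-Real.log ‖x‖) * Real.cos (shellPhase p (Real.log ‖x‖)))

lemma shellRatio_eq (p : ℝ) {x : Euc 3} (hx : x ≠ 0) :
    shellRatio p x = shellNormal p x * ‖x‖⁻¹ := by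
  rw [shellRatio, shellNormal, Real.exp_neg, Real.exp_log (norm_pos_iff.2 hx)]
  ring

lemma contDiff_exp_neg_mul_sin (p : ℝ) :
    ContDiff ℝ 1 fun σ => Real.exp (-σ) * Real.sin (shellPhase p σ) :=
  contDiff_neg.exp.mul (Real.contDiff_sin.comp (contDiff_shellPhase p))

lemma contDiff_exp_neg_mul_cos (p : ℝ) :
    ContDiff ℝ 1 fun σ => Real.exp (-σ) * Real.cos (shellPhase p σ) :=
  contDiff_neg.exp.mul (Real.contDiff_cos.comp (contDiff_shellPhase p))

lemma contDiffAt_comp_log_norm {g : ℝ → ℝ} (hg : ContDiff ℝ 1 g) {x : Euc 3} (hx : x ≠ 0) :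
    ContDiffAt ℝ 1 (fun y : Euc 3 => g (Real.log ‖y‖)) x :=
  (contDiffOn_comp_log_norm (U := univ) hg).contDiffAt
    ((isOpen_univ.sdiff isClosed_singleton).mem_nhds ⟨mem_univ _, hx⟩)

lemma contDiffAt_mul_comp_log_norm {g : ℝ → ℝ} (hg : ContDiff ℝ 1 g) (i : Fin 3) {x : Euc 3}
    (hx : x ≠ 0) : ContDiffAt ℝ 1 (fun y : Euc 3 => y i * g (Real.log ‖y‖)) x :=
  (contDiffOn_mul_comp_log_norm hg i univ).contDiffAt
    ((isOpen_univ.sdiff isClosed_singleton).mem_nhds ⟨mem_univ _, hx⟩)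

lemma contDiffAt_shellRatio (p : ℝ) {x : Euc 3} (hx : x ≠ 0) : ContDiffAt ℝ 1 (shellRatio p) x :=
  (contDiffAt_mul_comp_log_norm (contDiff_exp_neg_mul_sin p) 0 hx).sub
    (contDiffAt_mul_comp_log_norm (contDiff_exp_neg_mul_cos p) 1 hx)

lemma norm_fderiv_shellRatio_le {p : ℝ} (hp : 0 < p) {x : Euc 3} (hx : x ≠ 0) :
    ‖fderiv ℝ (shellRatio p) x‖ ≤ (4 + 2 * (shellPhase p (Real.log ‖x‖) / p)) * ‖x‖⁻¹ := by
  have hn : 0 < ‖x‖ := norm_pos_iff.2 hx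
  have he : Real.exp (-Real.log ‖x‖) = ‖x‖⁻¹ := by rw [Real.exp_neg, Real.exp_log hn]
  have hd1 : ∀ σ, HasDerivAt (fun σ => Real.exp (-σ) * Real.sin (shellPhase p σ))
      (Real.exp (-σ) * -1 * Real.sin (shellPhase p σ) +
        Real.exp (-σ) * (Real.cos (shellPhase p σ) * -(shellPhase p σ / p))) σ := fun σ =>
    (hasDerivAt_neg σ).exp.mul (hasDerivAt_shellPhase p σ).sin
  have hd2 : ∀ σ, HasDerivAt (fun σ => Real.exp (-σ) * Real.cos (shellPhase p σ))
      (Real.exp (-σ) * -1 * Real.cos (shellPhase p σ) +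
        Real.exp (-σ) * (-Real.sin (shellPhase p σ) * -(shellPhase p σ / p))) σ := fun σ =>
    (hasDerivAt_neg σ).exp.mul (hasDerivAt_shellPhase p σ).cos
  set s := shellPhase p (Real.log ‖x‖) with hs
  have hs0 : 0 ≤ s / p := (div_pos (shellPhase_pos _ _) hp).le
  have hsin : |Real.sin s| ≤ 1 := Real.abs_sin_le_one s
  have hcos : |Real.cos s| ≤ 1 := Real.abs_cos_le_one s
  have haux : ∀ a b : ℝ, |a| ≤ 1 → |b| ≤ 1 →
      |‖x‖⁻¹ * -1 * a + ‖x‖⁻¹ * (b * -(s / p))| ≤ (1 + s / p) * ‖x‖⁻¹ := fun a b ha hb => by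
    have : ‖x‖⁻¹ * -1 * a + ‖x‖⁻¹ * (b * -(s / p)) = -(a + b * (s / p)) * ‖x‖⁻¹ := by ring
    rw [this, abs_mul, abs_neg, abs_of_pos (inv_pos.2 hn)]
    gcongr
    refine (abs_add_le _ _).trans (add_le_add ha ?_)
    rw [abs_mul, abs_of_nonneg hs0]
    exact mul_le_of_le_one_left hs0 hb
  have haux1 : ∀ a : ℝ, |a| ≤ 1 → |‖x‖⁻¹ * a| ≤ 1 * ‖x‖⁻¹ := fun a ha => by
    rw [abs_mul, abs_of_pos (inv_pos.2 hn), mul_comm]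
    gcongr
  have b1 := norm_fderiv_mul_comp_log_norm_le (contDiff_exp_neg_mul_sin p) hd1 0 hx
    (A := 1) (B := 1 + s / p) (by rw [he]; exact haux1 _ hsin)
    (by rw [he]; exact haux _ _ hsin hcos)
  have b2 := norm_fderiv_mul_comp_log_norm_le (contDiff_exp_neg_mul_cos p) hd2 1 hx
    (A := 1) (B := 1 + s / p) (by rw [he]; exact haux1 _ hcos)
    (by rw [he]; exact haux _ _ hcos (by rwa [abs_neg]))
  have hsub := ((contDiffAt_mul_comp_log_norm (contDiff_exp_neg_mul_sin p) 0 hx).differentiableAt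
    one_ne_zero).hasFDerivAt.sub ((contDiffAt_mul_comp_log_norm (contDiff_exp_neg_mul_cos p) 1
      hx).differentiableAt one_ne_zero).hasFDerivAt
  have : fderiv ℝ (shellRatio p) x = _ := hsub.fderiv
  rw [this]
  refine (norm_sub_le _ _).trans ((add_le_add b1 b2).trans_eq ?_)
  ring

lemma exists_shell_cutoff {p ε : ℝ} (hp : 0 < p) (hε : 0 < ε) :
    ∃ M, 0 ≤ M ∧ ∀ t₁ t : ℝ, 0 ≤ t₁ → t₁ + 1 ≤ t → ∃ χ : Euc 3 → ℝ,
      ContDiff ℝ 1 χ ∧ HasCompactSupport χ ∧ (∀ x, 0 ≤ χ x) ∧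
      (∀ x ∈ tsupport χ, Real.exp (-(t + 1)) ≤ ‖x‖ ∧ ‖x‖ ≤ Real.exp (-t₁) ∧ shellNormal p x ≠ 0) ∧
      (∀ x, Real.exp (-t) ≤ ‖x‖ → ‖x‖ ≤ Real.exp (-(t₁ + 1)) →
        2 * ε * ‖x‖ ≤ |shellNormal p x| → χ x = 1) ∧
      ∀ x ∈ tsupport χ, ‖fderiv ℝ χ x‖ ≤ M * Real.exp ((t + 1) / p) * ‖x‖⁻¹ := by
  obtain ⟨L, hL0, hL, hLs⟩ := exists_deriv_smoothTransition_le
  have hT : ∀ u, HasDerivAt Real.smoothTransition (deriv Real.smoothTransition u) u := fun u =>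
    ((Real.smoothTransition.contDiff (n := 1)).differentiable one_ne_zero u).hasDerivAt
  refine ⟨L * 4 / ε * (4 + 2 / p) + 2 * L, by positivity, fun t₁ t ht₁ ht => ?_⟩
  set l : ℝ → ℝ := fun u => Real.smoothTransition (u ^ 2 - 1) with hl
  have hlc : ContDiff ℝ 1 l := Real.smoothTransition.contDiff.comp (by fun_prop)
  have hld : ∀ u, HasDerivAt l (deriv Real.smoothTransition (u ^ 2 - 1) * (2 * u)) u := fun u => by
    have h1 : HasDerivAt (fun u : ℝ => u ^ 2 - 1) (2 * u) u := by
      simpa using (hasDerivAt_pow 2 u).sub_const 1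
    exact (hT _).comp u h1
  have hlb : ∀ u, |deriv Real.smoothTransition (u ^ 2 - 1) * (2 * u)| ≤ L * 4 := fun u => by
    by_cases hu : u ^ 2 - 1 ∈ Icc (0 : ℝ) 1
    · rw [abs_mul]
      have : |u| ≤ 2 := abs_le_of_sq_le_sq (by linarith [hu.2]) (by norm_num)
      refine mul_le_mul (hL _) ?_ (abs_nonneg _) hL0
      rw [abs_mul, abs_two]
      linarith
    · rw [hLs _ hu, zero_mul, abs_zero]
      positivity
  set z : ℝ → ℝ := fun s => Real.smoothTransition (s + t + 1) * Real.smoothTransition (-t₁ - s)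
    with hz
  have hzc : ContDiff ℝ 1 z := (Real.smoothTransition.contDiff.comp (by fun_prop)).mul
    (Real.smoothTransition.contDiff.comp (by fun_prop))
  have hz0 : ∀ s, 0 ≤ z s := fun s =>
    mul_nonneg (Real.smoothTransition.nonneg _) (Real.smoothTransition.nonneg _)
  have hz1 : ∀ s, z s ≤ 1 := fun s => mul_le_one₀ (Real.smoothTransition.le_one _)
    (Real.smoothTransition.nonneg _) (Real.smoothTransition.le_one _)
  obtain ⟨z', hzd, hzb⟩ : ∃ z' : ℝ → ℝ, (∀ s, HasDerivAt z (z' s) s) ∧ ∀ s, |z' s| ≤ 2 * L := by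
    have h1 : ∀ s, HasDerivAt (fun s => Real.smoothTransition (s + t + 1))
        (deriv Real.smoothTransition (s + t + 1)) s := fun s => by
      have := (hT (s + t + 1)).comp s (((hasDerivAt_id s).add_const t).add_const 1)
      rwa [mul_one] at this
    have h2 : ∀ s, HasDerivAt (fun s => Real.smoothTransition (-t₁ - s))
        (-deriv Real.smoothTransition (-t₁ - s)) s := fun s => by
      have := (hT (-t₁ - s)).comp s ((hasDerivAt_id s).const_sub (-t₁))
      rwa [mul_neg_one] at this
    refine ⟨_, fun s => (h1 s).mul (h2 s), fun s => (abs_add_le _ _).trans ?_⟩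
    have h3 : ∀ u, |Real.smoothTransition u| ≤ 1 := fun u => by
      rw [abs_of_nonneg (Real.smoothTransition.nonneg _)]
      exact Real.smoothTransition.le_one _
    rw [abs_mul, abs_mul, abs_neg]
    have := mul_le_mul (hL (s + t + 1)) (h3 (-t₁ - s)) (abs_nonneg _) hL0
    have := mul_le_mul (h3 (s + t + 1)) (hL (-t₁ - s)) (abs_nonneg _) zero_le_one
    linarith
  set χ : Euc 3 → ℝ := fun x => l (shellRatio p x / ε) * z (Real.log ‖x‖) with hχ
  have hnz : ∀ x : Euc 3, Real.exp (-(t + 1)) ≤ ‖x‖ → x ≠ 0 := fun x hx =>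
    norm_pos_iff.1 ((Real.exp_pos _).trans_le hx)
  set S : Set (Euc 3) := {x | Real.exp (-(t + 1)) ≤ ‖x‖ ∧ ‖x‖ ≤ Real.exp (-t₁)} with hS
  have hSc : IsClosed S := (isClosed_le continuous_const continuous_norm).inter
    (isClosed_le continuous_norm continuous_const)
  have hTc : IsClosed {x ∈ S | ε * ‖x‖ ≤ |shellNormal p x|} :=
    hSc.isClosed_le (by fun_prop) (continuous_abs.comp_continuousOn fun x hx =>
      (continuousAt_shellNormal (hnz x hx.1)).continuousWithinAt)
  have hsupp : tsupport χ ⊆ {x ∈ S | ε * ‖x‖ ≤ |shellNormal p x|} := by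
    refine closure_minimal (fun x hx => ?_) hTc
    obtain ⟨hx1, hx2⟩ := mul_ne_zero_iff.1 (Function.mem_support.1 hx)
    obtain ⟨hx3, hx4⟩ := mul_ne_zero_iff.1 hx2
    have hx0 : x ≠ 0 := by
      rintro rfl
      refine hx1 (Real.smoothTransition.zero_of_nonpos ?_)
      simp [shellRatio]
    have hn : 0 < ‖x‖ := norm_pos_iff.2 hx0
    refine ⟨⟨?_, ?_⟩, ?_⟩
    · rw [← Real.le_log_iff_exp_le hn]
      by_contra! h
      exact hx3 (Real.smoothTransition.zero_of_nonpos (by linarith))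
    · rw [← Real.log_le_iff_le_exp hn]
      by_contra! h
      exact hx4 (Real.smoothTransition.zero_of_nonpos (by linarith))
    · by_contra! h
      refine hx1 (Real.smoothTransition.zero_of_nonpos ?_)
      rw [shellRatio_eq p hx0, sub_nonpos, sq_le_one_iff_abs_le_one, abs_div, abs_mul,
        abs_of_pos (inv_pos.2 hn), abs_of_pos hε, div_le_one hε, mul_inv_le_iff₀ hn]
      exact h.le
  have hx0 : ∀ x ∈ tsupport χ, x ≠ 0 := fun x hx => hnz x (hsupp hx).1.1
  have hr : ∀ x : Euc 3, x ≠ 0 → ContDiffAt ℝ 1 (fun x => l (shellRatio p x / ε)) x := fun x hx =>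
    hlc.contDiffAt.comp x ((contDiffAt_shellRatio p hx).div_const ε)
  have hzx : ∀ x : Euc 3, x ≠ 0 → ContDiffAt ℝ 1 (fun x : Euc 3 => z (Real.log ‖x‖)) x :=
    fun x hx => contDiffAt_comp_log_norm hzc hx
  refine ⟨χ, ?_, ?_, ?_, ?_, ?_, ?_⟩
  · rw [contDiff_iff_contDiffAt]
    intro x
    by_cases hx : x ∈ tsupport χ
    · exact (hr x (hx0 x hx)).mul (hzx x (hx0 x hx))
    · exact contDiffAt_const.congr_of_eventuallyEq (notMem_tsupport_iff_eventuallyEq.1 hx)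
  · refine HasCompactSupport.of_support_subset_isCompact
      (isCompact_closedBall (0 : Euc 3) (Real.exp (-t₁))) fun x hx => ?_
    rw [mem_closedBall_zero_iff]
    exact (hsupp (subset_tsupport _ hx)).1.2
  · exact fun x => mul_nonneg (Real.smoothTransition.nonneg _) (hz0 _)
  · intro x hx
    obtain ⟨⟨h1, h2⟩, h3⟩ := hsupp hx
    refine ⟨h1, h2, abs_pos.1 ((mul_pos hε (norm_pos_iff.2 (hx0 x hx))).trans_le h3)⟩
  · intro x h1 h2 h3
    have hn : 0 < ‖x‖ := (Real.exp_pos _).trans_le h1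
    rw [← Real.le_log_iff_exp_le hn] at h1
    rw [← Real.log_le_iff_le_exp hn] at h2
    have h4 : 2 ^ 2 ≤ (shellRatio p x / ε) ^ 2 := by
      rw [← sq_abs (_ / _)]
      gcongr
      rw [shellRatio_eq p (norm_pos_iff.1 hn), abs_div, abs_mul, abs_of_pos (inv_pos.2 hn),
        abs_of_pos hε, le_div_iff₀ hε, le_mul_inv_iff₀ hn]
      exact h3
    simp only [hχ, hl, hz]
    rw [Real.smoothTransition.one_of_one_le (by linarith),
      Real.smoothTransition.one_of_one_le (by linarith),
      Real.smoothTransition.one_of_one_le (by linarith)]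
    norm_num
  · intro x hx
    have h0 := hx0 x hx
    have hn : 0 < ‖x‖ := norm_pos_iff.2 h0
    have hE : 1 ≤ Real.exp ((t + 1) / p) := Real.one_le_exp (div_nonneg (by linarith) hp.le)
    have hph : shellPhase p (Real.log ‖x‖) ≤ Real.exp ((t + 1) / p) := by
      have := (Real.le_log_iff_exp_le hn).2 (hsupp hx).1.1
      rw [shellPhase, Real.exp_le_exp, ← neg_div]
      gcongr
      linarith
    have d0 : HasFDerivAt (fun x => shellRatio p x / ε) (ε⁻¹ • fderiv ℝ (shellRatio p) x) x := by
      simpa only [div_eq_mul_inv] using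
        ((contDiffAt_shellRatio p h0).differentiableAt one_ne_zero).hasFDerivAt.mul_const ε⁻¹
    have d1 := (hld (shellRatio p x / ε)).comp_hasFDerivAt_of_eq x d0 rfl
    have d2 := ((hzx x h0).differentiableAt one_ne_zero).hasFDerivAt
    have d3 : fderiv ℝ χ x = _ := (d1.mul d2).fderiv
    have hl1 : |l (shellRatio p x / ε)| ≤ 1 := by
      rw [abs_of_nonneg (Real.smoothTransition.nonneg _)]
      exact Real.smoothTransition.le_one _
    have hz2 : |z (Real.log ‖x‖)| ≤ 1 := by
      rw [abs_of_nonneg (hz0 _)]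
      exact hz1 _
    rw [d3]
    calc _ ≤ 1 * (2 * L * ‖x‖⁻¹) + 1 * (L * 4 * (ε⁻¹ *
          ((4 + 2 * (Real.exp ((t + 1) / p) / p)) * ‖x‖⁻¹))) := by
          refine (norm_add_le _ _).trans (add_le_add ?_ ?_)
          · rw [norm_smul, norm_fderiv_comp_log_norm hzd h0]
            exact mul_le_mul hl1 (by gcongr; exact hzb _) (by positivity) zero_le_one
          · rw [norm_smul, norm_smul, norm_smul, Real.norm_of_nonneg (inv_pos.2 hε).le]
            refine mul_le_mul hz2 ?_ (by positivity) zero_le_one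
            refine mul_le_mul (hlb _) ?_ (by positivity) (by positivity)
            gcongr
            refine (norm_fderiv_shellRatio_le hp h0).trans ?_
            gcongr
      _ = (L * 4 / ε * (4 * 1 + 2 / p * Real.exp ((t + 1) / p)) + 2 * L * 1) * ‖x‖⁻¹ := by
          ring
      _ ≤ (L * 4 / ε * (4 * Real.exp ((t + 1) / p) + 2 / p * Real.exp ((t + 1) / p)) +
          2 * L * Real.exp ((t + 1) / p)) * ‖x‖⁻¹ := by gcongr
      _ = _ := by ring

lemma three_mul_mul_sq_le {a b : ℝ} (ha : 0 ≤ a) (hb : 0 ≤ b) :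
    a * b ^ 2 ≤ 1 / 3 * a ^ 3 + 2 / 3 * b ^ 3 := by
  nlinarith [mul_nonneg (add_nonneg ha (add_nonneg hb hb)) (sq_nonneg (a - b))]

lemma abs_flux_le (F : Euc 3 → Euc 3) (DF : Euc 3 → Euc 3 →L[ℝ] Euc 3) (η : Euc 3 → ℝ) (x : Euc 3) :
    |flux F DF η x| ≤ ‖fderiv ℝ η x‖ * (‖DF x‖ * ‖F x‖⁻¹) ^ 2 := by
  rw [flux, abs_mul, abs_of_nonneg (by positivity)]
  calc _ ≤ (‖F x‖ ^ 3)⁻¹ * (‖fderiv ℝ η x‖ * ‖DF x‖ ^ 2 * ‖F x‖) := by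
        gcongr
        exact abs_adjPair_le _ _ _
    _ = _ := by
        rcases eq_or_ne ‖F x‖ 0 with h | h
        · simp [h]
        · field_simp

lemma integral_plateau_comp_log_norm_le {a b : ℝ} (hab : a ≤ b) :
    Integrable (fun x : Euc 3 => plateau a b (Real.log ‖x‖) * ‖x‖⁻¹ ^ 3) ∧
    ∫ x : Euc 3, plateau a b (Real.log ‖x‖) * ‖x‖⁻¹ ^ 3 ≤ sphereArea * (b - a + 2) := by
  simp only [inv_pow]
  refine ⟨integrable_comp_log_norm (continuous_plateau a b) (hasCompactSupport_plateau a b), ?_⟩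
  rw [integral_comp_log_norm]
  exact mul_le_mul_of_nonneg_left (integral_plateau_le hab) sphereArea_pos.le

namespace IsNormalizedQC

variable {K c : ℝ} {F : Euc 3 ≃ₜ Euc 3} {DF : Euc 3 → Euc 3 →L[ℝ] Euc 3}

lemma plateau_energy (h : IsNormalizedQC K c F DF) {a b : ℝ} (hab : a ≤ b) :
    Integrable (fun x => plateau a b (Real.log ‖F x‖) * (‖DF x‖ * ‖F x‖⁻¹) ^ 3) ∧
    ∫ x, plateau a b (Real.log ‖F x‖) * (‖DF x‖ * ‖F x‖⁻¹) ^ 3 ≤ K * c * (b - a + 2) := by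
  have e : (fun x => plateau a b (Real.log ‖F x‖) * (‖DF x‖ * ‖F x‖⁻¹) ^ 3) =
      fun x => plateau a b (Real.log ‖F x‖) * (‖F x‖ ^ 3)⁻¹ * ‖DF x‖ ^ 3 := by
    ext x
    rw [mul_pow, inv_pow]
    ring
  obtain ⟨i, hi⟩ := h.energy (continuous_plateau a b) (hasCompactSupport_plateau a b)
    fun _ => plateau_nonneg
  rw [e]
  refine ⟨i, hi.trans ?_⟩
  have := h.pos
  have := h.c_pos
  gcongr
  exact integral_plateau_le hab

/-- The part of the energy lying over the complement of the shell, weighted by the rotation of the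
spiral, is at most the energy needed to cut off around the shell. -/
lemma exists_rotation_bound (h : IsNormalizedQC K c F DF) {p q ε t₁ : ℝ} (hp : 0 < p) (hq : 0 < q)
    (hε : 0 < ε) (ht₁ : 0 ≤ t₁) (hF1 : ∀ x, ‖x‖ ≤ Real.exp (-t₁) → ‖F x‖ ≤ 1)
    (hS : ∀ x, x ≠ 0 → ‖x‖ ≤ Real.exp (-t₁) → shellNormal p x ≠ 0 → shellNormal q (F x) ≠ 0) :
    ∃ B, 0 ≤ B ∧ ∀ t, t₁ + 1 ≤ t → ∃ χ : Euc 3 → ℝ, (∀ x, 0 ≤ χ x) ∧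
      (∀ x, Real.exp (-t) ≤ ‖x‖ → ‖x‖ ≤ Real.exp (-(t₁ + 1)) →
        2 * ε * ‖x‖ ≤ |shellNormal p x| → χ x = 1) ∧
      Integrable (fun x => χ x * shellPhase q (Real.log ‖F x‖) * (‖DF x‖ * ‖F x‖⁻¹) ^ 3) ∧
      ∫ x, χ x * shellPhase q (Real.log ‖F x‖) * (‖DF x‖ * ‖F x‖⁻¹) ^ 3 ≤
        B * ((t + 1) * Real.exp ((t + 1) / p)) := by
  obtain ⟨M, hM, hχ⟩ := exists_shell_cutoff hp hε
  obtain ⟨C, hC, hlow⟩ := h.exists_log_norm_lower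
  have hK := h.pos
  have hc := h.c_pos
  have hκ := sphereArea_pos
  refine ⟨K * q * (Real.pi / 2 * (M * (1 / 3 * (sphereArea * 3) + 2 / 3 * (K * c * (2 * C + 2))))),
    by positivity, fun t ht => ?_⟩
  obtain ⟨χ, hχ1, hχc, hχ0, hχs, hχe, hχd⟩ := hχ t₁ t ht₁ ht
  refine ⟨χ, hχ0, hχe, ?_⟩
  have hx0 : ∀ x ∈ tsupport χ, x ≠ 0 := fun x hx =>
    norm_pos_iff.1 ((Real.exp_pos _).trans_le (hχs x hx).1)
  obtain ⟨i1, i2, e⟩ := h.sob.integral_radial hχ1 hχc (isOpen_shellNormal_ne_zero q)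
    (contDiffOn_shellAngle q fun y hy => hy.2) (fun h0 => absurd rfl h0.1) fun x hx =>
      ⟨h.ne_zero (hx0 x hx), hS x (hx0 x hx) (hχs x hx).2.1 (hχs x hx).2.2⟩
  have e1 : ∀ x, χ x * (fderiv ℝ (shellAngle q) (F x) (F x) * (‖F x‖ ^ 3)⁻¹) * (DF x).det =
      χ x * (shellPhase q (Real.log ‖F x‖) / q * (‖F x‖ ^ 3)⁻¹) * (DF x).det := fun x => by
    by_cases hx : x ∈ tsupport χ
    · rw [fderiv_shellAngle_self q (h.ne_zero (hx0 x hx))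
        (hS x (hx0 x hx) (hχs x hx).2.1 (hχs x hx).2.2)]
    · simp only [image_eq_zero_of_notMem_tsupport hx, zero_mul]
  simp only [e1] at i1 e
  have hT : ∀ᵐ x, χ x * shellPhase q (Real.log ‖F x‖) * (‖DF x‖ * ‖F x‖⁻¹) ^ 3 ≤ K * q *
      (χ x * (shellPhase q (Real.log ‖F x‖) / q * (‖F x‖ ^ 3)⁻¹) * (DF x).det) := by
    filter_upwards [h.dist] with x hx
    have h1 := shellPhase_pos q (Real.log ‖F x‖)
    have h2 := hχ0 x
    calc _ = χ x * shellPhase q (Real.log ‖F x‖) * (‖F x‖ ^ 3)⁻¹ * ‖DF x‖ ^ 3 := by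
          rw [mul_pow, inv_pow]
          ring
      _ ≤ χ x * shellPhase q (Real.log ‖F x‖) * (‖F x‖ ^ 3)⁻¹ * (K * (DF x).det) := by gcongr
      _ = _ := by
          rw [div_eq_mul_inv]
          linear_combination (-K * χ x * shellPhase q (Real.log ‖F x‖) * (‖F x‖ ^ 3)⁻¹ *
            (DF x).det) * mul_inv_cancel₀ hq.ne'
  have hTi : Integrable
      fun x => χ x * shellPhase q (Real.log ‖F x‖) * (‖DF x‖ * ‖F x‖⁻¹) ^ 3 := by
    refine (i1.const_mul (K * q)).mono' ?_ ?_
    · have hph : Measurable fun x => shellPhase q (Real.log ‖F x‖) :=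
        (contDiff_shellPhase q).continuous.measurable.comp
          (Real.measurable_log.comp F.continuous.norm.measurable)
      exact (hχ1.continuous.aestronglyMeasurable.mul hph.aestronglyMeasurable).mul
        ((h.sob.meas.norm.mul F.continuous.norm.measurable.inv.aestronglyMeasurable).pow 3)
    · filter_upwards [hT] with x hx
      rwa [Real.norm_of_nonneg]
      have h1 := shellPhase_pos q (Real.log ‖F x‖)
      have h2 := hχ0 x
      positivity
  refine ⟨hTi, (integral_mono_ae hTi (i1.const_mul (K * q)) hT).trans ?_⟩
  rw [integral_const_mul, e]
  set E := Real.exp ((t + 1) / p) with hE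
  obtain ⟨j1, b1⟩ := integral_plateau_comp_log_norm_le (show -(t + 1) ≤ -t₁ by linarith)
  obtain ⟨j2, b2⟩ := h.plateau_energy (show -(C * (t + 2)) ≤ 0 by
    rw [neg_nonpos]
    exact mul_nonneg hC (by linarith))
  have hR : ∀ x, ‖shellAngle q (F x) * (‖F x‖ ^ 3)⁻¹ * adjPair (DF x) (fderiv ℝ χ x) (F x)‖ ≤
      Real.pi / 2 * (M * E * (1 / 3 * (plateau (-(t + 1)) (-t₁) (Real.log ‖x‖) * ‖x‖⁻¹ ^ 3) +
      2 / 3 * (plateau (-(C * (t + 2))) 0 (Real.log ‖F x‖) * (‖DF x‖ * ‖F x‖⁻¹) ^ 3))) := fun x => by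
    have hpi := Real.pi_pos
    rw [mul_assoc, norm_mul, Real.norm_eq_abs, Real.norm_eq_abs]
    refine mul_le_mul (abs_shellAngle_le q _) ?_ (abs_nonneg _) (by positivity)
    refine (abs_flux_le F DF χ x).trans ?_
    by_cases hx : x ∈ tsupport χ
    · have hn : 0 < ‖x‖ := norm_pos_iff.2 (hx0 x hx)
      obtain ⟨h1, h2, -⟩ := hχs x hx
      rw [plateau_eq_one, plateau_eq_one, one_mul, one_mul]
      · refine (mul_le_mul_of_nonneg_right (hχd x hx) (by positivity)).trans ?_
        rw [mul_assoc (M * E)]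
        gcongr
        exact three_mul_mul_sq_le (by positivity) (by positivity)
      · refine ⟨?_, Real.log_nonpos (norm_nonneg _) (hF1 x h2)⟩
        have := hlow (t + 1) (by linarith) x h1
        linarith
      · exact ⟨(Real.le_log_iff_exp_le hn).2 h1, (Real.log_le_iff_le_exp hn).2 h2⟩
    · have : fderiv ℝ χ x = 0 :=
        image_eq_zero_of_notMem_tsupport fun h => hx (tsupport_fderiv_subset ℝ h)
      rw [this, norm_zero, zero_mul]
      have := plateau_nonneg (a := -(t + 1)) (b := -t₁) (s := Real.log ‖x‖)
      have := plateau_nonneg (a := -(C * (t + 2))) (b := 0) (s := Real.log ‖F x‖)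
      positivity
  have hfin := norm_integral_le_of_norm_le
    ((((j1.const_mul (1 / 3)).add (j2.const_mul (2 / 3))).const_mul (M * E)).const_mul
      (Real.pi / 2)) (ae_of_all _ hR)
  have hadd := integral_add (j1.const_mul (1 / 3)) (j2.const_mul (2 / 3))
  simp only [integral_const_mul] at hfin hadd
  simp only [Pi.add_apply] at hfin
  rw [hadd] at hfin
  have hb : Real.pi / 2 * (M * E * (1 / 3 * (sphereArea * (-t₁ - -(t + 1) + 2)) +
      2 / 3 * (K * c * (0 - -(C * (t + 2)) + 2)))) ≤
      Real.pi / 2 * (M * E * ((1 / 3 * (sphereArea * 3) + 2 / 3 * (K * c * (2 * C + 2))) *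
      (t + 1))) := by
    have hE0 := Real.exp_pos ((t + 1) / p)
    have hpi := Real.pi_pos
    gcongr
    rw [add_mul, mul_assoc (1 / 3), mul_assoc (2 / 3), mul_assoc sphereArea, mul_assoc (K * c)]
    gcongr
    · linarith
    · nlinarith
  have hKq : 0 ≤ K * q := by positivity
  refine (mul_le_mul_of_nonneg_left ((neg_le_abs _).trans (hfin.trans (le_trans ?_ hb))) hKq).trans_eq
    (by ring)
  have hE0 := Real.exp_pos ((t + 1) / p)
  have hpi := Real.pi_pos
  gcongr

end IsNormalizedQC

namespace IsNormalizedQC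

variable {K c : ℝ} {F : Euc 3 ≃ₜ Euc 3} {DF : Euc 3 → Euc 3 →L[ℝ] Euc 3}

/-- The degree is bounded below by the energy of the logarithm over a long annulus. -/
lemma mul_sub_le_of_energy_le (h : IsNormalizedQC K c F DF) {t₁ t : ℝ} (ht : t₁ + 3 ≤ t)
    {g : Euc 3 → ℝ} (hg : Integrable g) (hg0 : ∀ x, 0 ≤ g x)
    (hle : ∀ x, Real.exp (-t) ≤ ‖x‖ → ‖x‖ ≤ Real.exp (-(t₁ + 1)) →
      ‖x‖⁻¹ * (‖DF x‖ * ‖F x‖⁻¹) ^ 2 ≤ g x) :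
    c * (t - t₁ - 3) ≤ ∫ x, g x := by
  set k := plateau (-t + 1) (-(t₁ + 1) - 1) with hk
  obtain ⟨η, hη, hη0, hη1, hηd⟩ := exists_log_cutoff (k := k) (continuous_plateau _ _)
    (show -t ≤ -(t₁ + 1) by linarith) fun s hs => plateau_eq_zero (by
      rwa [add_sub_cancel_right, sub_add_cancel])
  have hηc : HasCompactSupport η :=
    HasCompactSupport.intro (isCompact_closedBall (0 : Euc 3) (Real.exp (-(t₁ + 1)))) fun x hx => by
      rw [mem_closedBall_zero_iff, not_le] at hx
      exact hη0 x hx.le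
  have hη00 : η 0 = ∫ s, k s := hη1 0 (by rw [norm_zero]; exact (Real.exp_pos _).le)
  have hev : ∀ᶠ x in 𝓝 0, η x = η 0 := by
    filter_upwards [ball_mem_nhds (0 : Euc 3) (Real.exp_pos (-t))] with x hx
    rw [hη00, hη1 x (mem_ball_zero_iff.1 hx).le]
  obtain ⟨-, e⟩ := h.flux η hη hηc hev
  have hb : ∀ x, ‖_root_.flux F DF η x‖ ≤ g x := fun x => by
    refine (abs_flux_le F DF η x).trans ?_
    rcases eq_or_ne x 0 with rfl | hx
    · have := hηd 0
      rw [norm_zero, inv_zero, mul_zero] at this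
      rw [le_antisymm this (norm_nonneg _), zero_mul]
      exact hg0 0
    have hn : 0 < ‖x‖ := norm_pos_iff.2 hx
    have hd := hηd x
    by_cases hs : Real.log ‖x‖ ∈ Icc (-t) (-(t₁ + 1))
    · refine le_trans ?_ (hle x ((Real.le_log_iff_exp_le hn).1 hs.1)
        ((Real.log_le_iff_le_exp hn).1 hs.2))
      gcongr
      refine hd.trans (mul_le_of_le_one_left (by positivity) ?_)
      rw [abs_of_nonneg plateau_nonneg]
      exact plateau_le_one
    · rw [hk, plateau_eq_zero (by rwa [add_sub_cancel_right, sub_add_cancel]), abs_zero,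
        zero_mul] at hd
      rw [le_antisymm hd (norm_nonneg _), zero_mul]
      exact hg0 x
  have hfin := norm_integral_le_of_norm_le hg (ae_of_all _ hb)
  rw [e, Real.norm_eq_abs, hη00, abs_mul, abs_neg, abs_of_pos h.c_pos] at hfin
  refine le_trans (mul_le_mul_of_nonneg_left ?_ h.c_pos.le) hfin
  refine le_trans ?_ (le_abs_self _)
  have := le_integral_plateau (show -t + 1 ≤ -(t₁ + 1) - 1 by linarith)
  linarith

lemma exists_annulus_bound (h : IsNormalizedQC K c F DF) {p q ε t₁ C α K' : ℝ} (hp : 0 < p)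
    (hq : 0 < q) (hε : 0 < ε) (hα : 0 < α) (hK' : 0 < K') (ht₁ : 0 ≤ t₁)
    (hF1 : ∀ x, ‖x‖ ≤ Real.exp (-t₁) → ‖F x‖ ≤ 1)
    (hS : ∀ x, x ≠ 0 → ‖x‖ ≤ Real.exp (-t₁) → shellNormal p x ≠ 0 → shellNormal q (F x) ≠ 0)
    (hC : 0 ≤ C) (hlow : ∀ t, 0 ≤ t → ∀ x, Real.exp (-t) ≤ ‖x‖ → -(C * (t + 1)) ≤ Real.log ‖F x‖) :
    ∃ B, 0 ≤ B ∧ ∀ t, t₁ + 3 ≤ t → c * (t - t₁ - 3) ≤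
      1 / 3 * (sphereArea * (t + 2)) + 2 / 3 * (K * c * (t / K' + 2)) +
      2 / 3 * Real.exp (-(t / (K' * q))) * (B * ((t + 1) * Real.exp ((t + 1) / p))) +
      1 / (3 * α ^ 2) * (48 * (2 * ε) * (t + 2)) + 2 / 3 * α * (K * c * (C * (t + 1) + 2)) := by
  obtain ⟨B, hB, hχ⟩ := h.exists_rotation_bound hp hq hε ht₁ hF1 hS
  refine ⟨B, hB, fun t ht => ?_⟩
  obtain ⟨χ, hχ0, hχ1, i3, b3⟩ := hχ t (by linarith)
  have ht0 : 0 ≤ t := by linarith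
  set a := plateau (-t) (-(t₁ + 1)) with ha
  have hac : Continuous a := continuous_plateau _ _
  have has : HasCompactSupport a := hasCompactSupport_plateau _ _
  have ha0 : ∀ s, 0 ≤ a s := fun _ => plateau_nonneg
  obtain ⟨i1, b1⟩ := integral_plateau_comp_log_norm_le (show -t ≤ -(t₁ + 1) by linarith)
  obtain ⟨i2, b2⟩ := h.plateau_energy (show -(t / K') ≤ 0 by
    rw [neg_nonpos]; positivity)
  obtain ⟨i5, b5⟩ := h.plateau_energy (show -(C * (t + 1)) ≤ 0 by
    rw [neg_nonpos]; positivity)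
  have i4 : Integrable ((shellBand p (2 * ε)).indicator
      fun x => a (Real.log ‖x‖) * (‖x‖ ^ 3)⁻¹) :=
    (integrable_comp_log_norm hac has).indicator (measurableSet_shellBand p (2 * ε))
  have b4 := setIntegral_shellBand_le p (show 0 ≤ 2 * ε by positivity) hac has ha0
  rw [← integral_indicator (measurableSet_shellBand p (2 * ε))] at b4
  set g1 : Euc 3 → ℝ := fun x => a (Real.log ‖x‖) * ‖x‖⁻¹ ^ 3 with hg1
  set g2 : Euc 3 → ℝ := fun x => plateau (-(t / K')) 0 (Real.log ‖F x‖) * (‖DF x‖ * ‖F x‖⁻¹) ^ 3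
    with hg2
  set g3 : Euc 3 → ℝ := fun x => χ x * shellPhase q (Real.log ‖F x‖) * (‖DF x‖ * ‖F x‖⁻¹) ^ 3
    with hg3
  set g4 : Euc 3 → ℝ := (shellBand p (2 * ε)).indicator
    fun x => a (Real.log ‖x‖) * (‖x‖ ^ 3)⁻¹ with hg4
  set g5 : Euc 3 → ℝ := fun x => plateau (-(C * (t + 1))) 0 (Real.log ‖F x‖) *
    (‖DF x‖ * ‖F x‖⁻¹) ^ 3 with hg5
  have g1n : ∀ x, 0 ≤ g1 x := fun x => mul_nonneg (ha0 _) (by positivity)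
  have g2n : ∀ x, 0 ≤ g2 x := fun x => mul_nonneg plateau_nonneg (by positivity)
  have g3n : ∀ x, 0 ≤ g3 x := fun x =>
    mul_nonneg (mul_nonneg (hχ0 x) (shellPhase_pos _ _).le) (by positivity)
  have g4n : ∀ x, 0 ≤ g4 x := fun x =>
    indicator_nonneg (fun x _ => mul_nonneg (ha0 _) (by positivity)) x
  have g5n : ∀ x, 0 ≤ g5 x := fun x => mul_nonneg plateau_nonneg (by positivity)
  set E := Real.exp (-(t / (K' * q))) with hE
  have hE0 : 0 < E := Real.exp_pos _
  have hG : Integrable fun x => 1 / 3 * g1 x + 2 / 3 * g2 x + 2 / 3 * E * g3 x +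
      1 / (3 * α ^ 2) * g4 x + 2 / 3 * α * g5 x :=
    ((((i1.const_mul (1 / 3)).add (i2.const_mul (2 / 3))).add (i3.const_mul (2 / 3 * E))).add
      (i4.const_mul (1 / (3 * α ^ 2)))).add (i5.const_mul (2 / 3 * α))
  have hmain := h.mul_sub_le_of_energy_le ht hG (fun x => by
    have := g1n x
    have := g2n x
    have := g3n x
    have := g4n x
    have := g5n x
    positivity) fun x hx1 hx2 => by
      have := g1n x
      have := g2n x
      have := g3n x
      have := g4n x
      have := g5n x
      have hn : 0 < ‖x‖ := (Real.exp_pos _).trans_le hx1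
      have hFn : 0 < ‖F x‖ := norm_pos_iff.2 (h.ne_zero (norm_pos_iff.1 hn))
      have ha1 : a (Real.log ‖x‖) = 1 :=
        plateau_eq_one ⟨(Real.le_log_iff_exp_le hn).2 hx1, (Real.log_le_iff_le_exp hn).2 hx2⟩
      have hF0 : Real.log ‖F x‖ ≤ 0 := Real.log_nonpos (norm_nonneg _)
        (hF1 x (hx2.trans (Real.exp_le_exp.2 (by linarith))))
      set X := ‖x‖⁻¹ with hX
      set Y := ‖DF x‖ * ‖F x‖⁻¹ with hY
      have hX0 : 0 ≤ X := by positivity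
      have hY0 : 0 ≤ Y := by positivity
      have e1 : g1 x = X ^ 3 := by simp only [hg1, ha1, one_mul, hX]
      have yo := three_mul_mul_sq_le hX0 hY0
      by_cases hs1 : -(t / K') ≤ Real.log ‖F x‖
      · have e2 : g2 x = Y ^ 3 := by
          simp only [hg2]
          rw [plateau_eq_one ⟨hs1, hF0⟩, one_mul]
        rw [e1, e2]
        have : 0 ≤ 2 / 3 * E * g3 x + 1 / (3 * α ^ 2) * g4 x + 2 / 3 * α * g5 x := by positivity
        linarith
      by_cases hs2 : 2 * ε * ‖x‖ ≤ |shellNormal p x|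
      · have e3 : Y ^ 3 ≤ E * g3 x := by
          simp only [hg3]
          rw [hχ1 x hx1 hx2 hs2, one_mul, ← mul_assoc]
          refine le_mul_of_one_le_left (by positivity) ?_
          rw [hE, shellPhase, ← Real.exp_add]
          refine Real.one_le_exp ?_
          have h1 : t / K' ≤ -Real.log ‖F x‖ := by linarith
          have h2 := div_le_div_of_nonneg_right h1 hq.le
          rw [div_div, neg_div] at h2
          linarith
        rw [e1]
        have : 0 ≤ 2 / 3 * g2 x + 1 / (3 * α ^ 2) * g4 x + 2 / 3 * α * g5 x := by positivity
        linarith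
      · have e4 : g4 x = X ^ 3 := by
          rw [hg4, indicator_of_mem (show x ∈ shellBand p (2 * ε) from not_le.1 hs2), ha1, one_mul,
            hX, inv_pow]
        have e5 : g5 x = Y ^ 3 := by
          simp only [hg5]
          rw [plateau_eq_one ⟨hlow t ht0 x hx1, hF0⟩, one_mul]
        have yo2 := three_mul_mul_sq_le (div_nonneg hX0 hα.le) hY0
        have h3 : X * Y ^ 2 ≤ 1 / (3 * α ^ 2) * X ^ 3 + 2 / 3 * α * Y ^ 3 := by
          calc X * Y ^ 2 = α * (X / α * Y ^ 2) := by field_simp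
            _ ≤ α * (1 / 3 * (X / α) ^ 3 + 2 / 3 * Y ^ 3) := by gcongr
            _ = _ := by
              field_simp
        rw [e4, e5]
        have : 0 ≤ 1 / 3 * g1 x + 2 / 3 * g2 x + 2 / 3 * E * g3 x := by positivity
        linarith
  refine hmain.trans ?_
  have s1 := integral_add (i1.const_mul (1 / 3)) (i2.const_mul (2 / 3))
  have s2 := integral_add ((i1.const_mul (1 / 3)).add (i2.const_mul (2 / 3)))
    (i3.const_mul (2 / 3 * E))
  have s3 := integral_add (((i1.const_mul (1 / 3)).add (i2.const_mul (2 / 3))).add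
    (i3.const_mul (2 / 3 * E))) (i4.const_mul (1 / (3 * α ^ 2)))
  have s4 := integral_add ((((i1.const_mul (1 / 3)).add (i2.const_mul (2 / 3))).add
    (i3.const_mul (2 / 3 * E))).add (i4.const_mul (1 / (3 * α ^ 2)))) (i5.const_mul (2 / 3 * α))
  simp only [integral_const_mul, Pi.add_apply] at s1 s2 s3 s4
  rw [s4, s3, s2, s1]
  have hK := h.pos
  have hc := h.c_pos
  have hκ := sphereArea_pos
  have bp := integral_plateau_le (show -t ≤ -(t₁ + 1) by linarith)
  gcongr
  · exact b1.trans (by gcongr; linarith)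
  · exact b2.trans_eq (by ring)
  · refine b4.trans ?_
    gcongr
    linarith
  · exact b5.trans_eq (by ring)

lemma not_preserves_shells (h : IsNormalizedQC K c F DF) {p q t₁ : ℝ} (hp : 0 < p) (hq : 0 < q)
    (hKpq : K < p / q) (ht₁ : 0 ≤ t₁) (hF1 : ∀ x, ‖x‖ ≤ Real.exp (-t₁) → ‖F x‖ ≤ 1)
    (hS : ∀ x, x ≠ 0 → ‖x‖ ≤ Real.exp (-t₁) → shellNormal p x ≠ 0 → shellNormal q (F x) ≠ 0) :
    False := by
  obtain ⟨C, hC, hlow⟩ := h.exists_log_norm_lower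
  have hK := h.pos
  have hc := h.c_pos
  have hκ := sphereArea_pos
  obtain ⟨K', hK1, hK2⟩ := exists_between hKpq
  have hK' : 0 < K' := hK.trans hK1
  set θ := c * (1 - K / K') with hθ
  have hθ0 : 0 < θ := mul_pos hc (by rw [sub_pos, div_lt_one hK']; exact hK1)
  set α := θ / (4 * (K * c * C + 1)) with hα
  have hα0 : 0 < α := by positivity
  set ε := α ^ 2 * θ / 192 with hε
  have hε0 : 0 < ε := by positivity
  obtain ⟨B, hB, hb⟩ := h.exists_annulus_bound hp hq hε0 hα0 hK' ht₁ hF1 hS hC hlow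
  set δ := 1 / (K' * q) - 1 / p with hδ
  have hδ0 : 0 < δ := by
    rw [hδ, sub_pos]
    refine one_div_lt_one_div_of_lt (by positivity) ?_
    rwa [lt_div_iff₀ hq] at hK2
  have hexp : ∀ t, 0 ≤ t → Real.exp (-(t / (K' * q))) * (B * ((t + 1) * Real.exp ((t + 1) / p))) ≤
      B * Real.exp (1 / p) * (1 / δ + 1) := fun t ht => by
    have e1 : Real.exp (-(t / (K' * q))) * (B * ((t + 1) * Real.exp ((t + 1) / p))) =
        B * Real.exp (1 / p) * ((t + 1) * Real.exp (-(δ * t))) := by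
      have : Real.exp (-(t / (K' * q))) * Real.exp ((t + 1) / p) =
          Real.exp (1 / p) * Real.exp (-(δ * t)) := by
        rw [← Real.exp_add, ← Real.exp_add, hδ]
        congr 1
        ring
      linear_combination B * (t + 1) * this
    rw [e1]
    gcongr
    rw [add_mul, one_mul]
    have h1 : δ * t ≤ Real.exp (δ * t) := by linarith [Real.add_one_le_exp (δ * t)]
    refine add_le_add ?_ (Real.exp_le_one_iff.2 (by rw [neg_nonpos]; positivity))
    rw [Real.exp_neg, ← div_eq_mul_inv, div_le_div_iff₀ (Real.exp_pos _) hδ0]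
    linarith
  have hA1 : 2 / 3 * α * (K * c * C) ≤ θ / 6 := by
    have h0 : K * c * C / (K * c * C + 1) ≤ 1 := by
      rw [div_le_one (by positivity)]
      linarith
    have h1 : 2 / 3 * α * (K * c * C) = θ / 6 * (K * c * C / (K * c * C + 1)) := by
      rw [hα]
      field_simp
      ring
    rw [h1]
    exact mul_le_of_le_one_right (by positivity) h0
  have hA2 : 1 / (3 * α ^ 2) * (48 * (2 * ε)) = θ / 6 := by
    rw [hε]
    field_simp
    norm_num
  set D := c * (t₁ + 3) + 2 / 3 * sphereArea + 4 / 3 * (K * c) +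
    2 / 3 * (B * Real.exp (1 / p) * (1 / δ + 1)) + 2 * (θ / 6) + θ / 6 +
    4 / 3 * α * (K * c) with hD
  have hD0 : 0 ≤ D := by positivity
  set t := max (t₁ + 3) (3 * D / θ + 1) with ht
  have ht2 : t₁ + 3 ≤ t := le_max_left _ _
  have ht3 : 3 * D / θ + 1 ≤ t := le_max_right _ _
  have ht0 : 0 ≤ t := by linarith
  have h1 := hb t ht2
  have h2 := hexp t ht0
  have h3 : 1 / (3 * α ^ 2) * (48 * (2 * ε) * (t + 2)) = θ / 6 * (t + 2) := by
    rw [← hA2]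
    ring
  have h4 : 2 / 3 * α * (K * c * (C * (t + 1) + 2)) ≤ θ / 6 * (t + 1) + 4 / 3 * α * (K * c) := by
    have := mul_le_mul_of_nonneg_right hA1 (show 0 ≤ t + 1 by linarith)
    linarith
  have h5 : sphereArea * t ≤ c * t := mul_le_mul_of_nonneg_right h.area_le ht0
  have h6 : 2 / 3 * θ * t = 2 / 3 * c * t - 2 / 3 * (K * c * (t / K')) := by
    rw [hθ]
    ring
  have h7 : θ / 3 * t ≤ D := by
    rw [h3] at h1
    rw [hD]
    linarith
  have h8 : D < θ / 3 * t := by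
    have : 3 * D / θ < t := by linarith
    rw [div_lt_iff₀ hθ0] at this
    linarith
  linarith

end IsNormalizedQC

/-- **Theorem (no quasiconformal map between shells below the critical dilatation).**
For `p ≥ q > 0` and `1 ≤ K < p/q`, there is no `K`-quasiconformal homeomorphism
`F : ℝ³ → ℝ³` with `F(𝒮_p) = 𝒮_q`. -/
theorem no_quasiconformal_shell_map (p q K : ℝ) (hq : 0 < q) (hpq : q ≤ p)
    (hK1 : 1 ≤ K) (hK : K < p / q) :
    ¬ ∃ F : Euc 3 ≃ₜ Euc 3, IsQuasiconformal K ⇑F ∧ ⇑F '' spiralShell p = spiralShell q := by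
  rintro ⟨F, ⟨DF, hint, hweak, hdist⟩, hF⟩
  have hp : 0 < p := hq.trans_le hpq
  have h0 := map_zero_of_image_spiralShell hp hq F hF
  have hs : IsSobolev F DF := by
    refine ⟨F.continuous, aestronglyMeasurable_weakDeriv F.continuous F.injective hweak,
      fun R => ?_, hweak⟩
    rcases lt_or_ge 0 R with hR | hR
    · exact hint R hR
    · rw [ball_eq_empty.2 hR]
      exact integrableOn_empty
  obtain ⟨c, hc, hflux, hchange⟩ := hs.exists_degree h0 (zero_le_one.trans hK1) hdist
  have h : IsNormalizedQC K c F DF := ⟨hs, h0, zero_lt_one.trans_le hK1, hdist, hc, hflux, hchange⟩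
  obtain ⟨r, hr, hr1⟩ := Metric.continuousAt_iff.1 (F.continuous.continuousAt (x := 0)) 1 one_pos
  simp only [h0, dist_zero_right] at hr1
  have hF1 : ∀ x, ‖x‖ ≤ Real.exp (-(max 0 (1 - Real.log r))) → ‖F x‖ ≤ 1 := fun x hx => by
    refine (hr1 (hx.trans_lt ?_)).le
    rw [← Real.lt_log_iff_exp_lt hr]
    have := le_max_right 0 (1 - Real.log r)
    linarith
  refine h.not_preserves_shells hp hq hK (le_max_left _ _) hF1 fun x hx hx1 hpx hqx => ?_
  have hmem : F x ∈ spiralShell q :=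
    (mem_spiralShell_iff hq).2 ⟨h.ne_zero hx, hF1 x hx1, hqx⟩
  rw [← hF, F.injective.mem_set_image] at hmem
  exact hpx ((mem_spiralShell_iff hp).1 hmem).2.2
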